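/- arXiv:2411.16069 — 3 statements merged into one kernel-verified Lean document; each statement's English description precedes it below -/
import Mathlib

section
/- Let F, f : (0,∞) → ℝ be the continuous functions of the linear sieve, determined by F(u) = 2e^γ/u and f(u) = 0 for 0 < u ≤ 2, and (uF(u))' = f(u−1), (uf(u))' = F(u−1) for u > 2, where γ is Euler's constant. Then: (1) F is positive and strictly decreasing on (0,∞) and F(u) = 1 + O(e^{−u}); (2) f is positive and strictly increasing for u > 2 and f(u) = 1 + O(e^{−u}); (3) F(u) − f(u) > 0 for all u ≥ 1. -/
open Real Filter MeasureTheory Topology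

/-- The entire function `(1 - exp (-t)) / t`. -/
noncomputable def einKernel : ℝ → ℝ := dslope (fun x => -exp (-x)) 0

theorem mul_einKernel (t : ℝ) : t * einKernel t = 1 - exp (-t) := by
  have h := sub_smul_dslope (fun x : ℝ => -exp (-x)) 0 t
  simp only [sub_zero, smul_eq_mul, neg_zero, exp_zero] at h
  rw [einKernel, h]
  ring

theorem einKernel_zero : einKernel 0 = 1 := by
  rw [einKernel, dslope_same, ((hasDerivAt_neg (0 : ℝ)).exp.fun_neg).deriv]
  simp

theorem continuous_einKernel : Continuous einKernel := by
  rw [← continuousOn_univ, einKernel, continuousOn_dslope univ_mem]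
  exact ⟨by fun_prop, by fun_prop⟩

theorem einKernel_nonneg {t : ℝ} (ht : 0 ≤ t) : 0 ≤ einKernel t := by
  rcases ht.eq_or_lt with rfl | ht
  · simp [einKernel_zero]
  · refine nonneg_of_mul_nonneg_right (?_ : 0 ≤ t * einKernel t) ht
    rw [mul_einKernel, sub_nonneg, exp_le_one_iff]
    linarith

theorem einKernel_le_one {t : ℝ} (ht : 0 ≤ t) : einKernel t ≤ 1 := by
  rcases ht.eq_or_lt with rfl | ht
  · simp [einKernel_zero]
  · refine le_of_mul_le_mul_left (?_ : t * einKernel t ≤ t * 1) ht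
    rw [mul_einKernel]
    linarith [add_one_le_exp (-t)]

/-- The complementary exponential integral `∫ t in 0..x, (1 - exp (-t)) / t`. -/
noncomputable def ein (x : ℝ) : ℝ := ∫ t in (0 : ℝ)..x, einKernel t

theorem ein_zero : ein 0 = 0 := by simp [ein]

theorem hasDerivAt_ein (x : ℝ) : HasDerivAt ein (einKernel x) x :=
  continuous_einKernel.integral_hasStrictDerivAt 0 x |>.hasDerivAt

theorem continuous_ein : Continuous ein :=
  continuous_iff_continuousAt.2 fun x => (hasDerivAt_ein x).continuousAt

theorem ein_nonneg {x : ℝ} (hx : 0 ≤ x) : 0 ≤ ein x :=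
  intervalIntegral.integral_nonneg hx fun _ ht => einKernel_nonneg ht.1

theorem ein_le_self {x : ℝ} (hx : 0 ≤ x) : ein x ≤ x := by
  have h := intervalIntegral.integral_mono_on (μ := volume) hx
    (continuous_einKernel.intervalIntegrable 0 x)
    ((continuous_const (y := (1 : ℝ))).intervalIntegrable 0 x) fun t ht => einKernel_le_one ht.1
  simpa [ein] using h

theorem integral_log_mul_exp_neg :
    ∫ t in Set.Ioi (0 : ℝ), log t * exp (-t) = -eulerMascheroniConstant := by
  have h := Complex.hasDerivAt_GammaIntegral (s := 1) (by simp)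
  have hev : Complex.Gamma =ᶠ[𝓝 1] Complex.GammaIntegral := by
    have : ∀ᶠ s : ℂ in 𝓝 1, 0 < s.re :=
      Complex.continuous_re.continuousAt.eventually (lt_mem_nhds (by simp))
    filter_upwards [this] with s hs
    exact Complex.Gamma_eq_integral hs
  have h2 := (h.congr_of_eventuallyEq hev).unique Complex.hasDerivAt_Gamma_one
  simp only [sub_self, Complex.cpow_zero, one_mul] at h2
  rw [← Complex.ofReal_inj, ← integral_complex_ofReal]
  push_cast at h2 ⊢
  exact h2

theorem integrableOn_log_mul_exp_neg :
    IntegrableOn (fun t : ℝ => log t * exp (-t)) (Set.Ioi 0) := by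
  by_contra h
  have h2 := integral_undef h
  rw [integral_log_mul_exp_neg] at h2
  linarith [one_half_lt_eulerMascheroniConstant]

theorem tendsto_ein_sub_log :
    Tendsto (fun x => ein x - log x) atTop (𝓝 eulerMascheroniConstant) := by
  have hcont : Continuous fun x => einKernel x * (x * log x) - ein x :=
    (continuous_einKernel.mul continuous_mul_log).sub continuous_ein
  have heq : ∀ x, einKernel x * (x * log x) - ein x = (1 - exp (-x)) * log x - ein x := by
    intro x
    rw [← mul_einKernel]
    ring
  simp only [heq] at hcont
  have h1 := intervalIntegral_tendsto_integral_Ioi 0 integrableOn_log_mul_exp_neg tendsto_id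
  rw [integral_log_mul_exp_neg] at h1
  have h2 : ∀ᶠ x : ℝ in atTop, ∫ t in (0 : ℝ)..x, log t * exp (-t) =
      (1 - exp (-x)) * log x - ein x := by
    filter_upwards [eventually_gt_atTop 0] with x hx
    rw [intervalIntegral.integral_eq_sub_of_hasDerivAt_of_le hx.le hcont.continuousOn (fun y hy => ?_)
      ((intervalIntegrable_iff_integrableOn_Ioc_of_le hx.le).2
        (integrableOn_log_mul_exp_neg.mono_set Set.Ioc_subset_Ioi_self))]
    · simp [ein_zero]
    · have hy0 : y ≠ 0 := hy.1.ne'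
      refine ((((hasDerivAt_neg y).exp.const_sub 1).mul (hasDerivAt_log hy0)).sub
        (hasDerivAt_ein y)).congr_deriv ?_
      rw [← mul_einKernel]
      field_simp
      ring
  have h3 : Tendsto (fun x : ℝ => exp (-x) * log x) atTop (𝓝 0) := by
    have h4 : Tendsto (fun x : ℝ => x ^ (1 : ℝ) * exp (-1 * x)) atTop (𝓝 0) :=
      tendsto_rpow_mul_exp_neg_mul_atTop_nhds_zero 1 1 one_pos
    refine squeeze_zero' ?_ ?_ h4
    · filter_upwards [eventually_ge_atTop 1] with x hx
      exact mul_nonneg (exp_pos _).le (log_nonneg hx)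
    · filter_upwards [eventually_ge_atTop 1] with x hx
      rw [rpow_one, neg_one_mul, mul_comm]
      exact mul_le_mul_of_nonneg_right (log_le_self (by linarith)) (exp_pos _).le
  have h5 := (h3.add (h1.congr' h2)).neg
  rw [zero_add, neg_neg] at h5
  refine h5.congr fun x => ?_
  ring

/-- The weight of the Laplace transform solving the adjoint equation. -/
noncomputable def adjointWeight (x : ℝ) : ℝ := exp (-ein x)

theorem continuous_adjointWeight : Continuous adjointWeight :=
  continuous_exp.comp continuous_ein.neg

theorem adjointWeight_nonneg (x : ℝ) : 0 ≤ adjointWeight x := (exp_pos _).le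

theorem adjointWeight_le_one {x : ℝ} (hx : 0 ≤ x) : adjointWeight x ≤ 1 :=
  exp_le_one_iff.2 (neg_nonpos.2 (ein_nonneg hx))

theorem exp_neg_le_adjointWeight {x : ℝ} (hx : 0 ≤ x) : exp (-x) ≤ adjointWeight x :=
  exp_le_exp.2 (neg_le_neg (ein_le_self hx))

theorem hasDerivAt_mul_adjointWeight (x : ℝ) :
    HasDerivAt (fun y => y * adjointWeight y) (exp (-x) * adjointWeight x) x := by
  refine ((hasDerivAt_id x).mul (hasDerivAt_ein x).neg.exp).congr_deriv ?_
  have := mul_einKernel x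
  simp only [adjointWeight, id, Pi.neg_apply]
  linear_combination (-exp (-ein x)) * this

theorem tendsto_mul_adjointWeight :
    Tendsto (fun x => x * adjointWeight x) atTop (𝓝 (exp (-eulerMascheroniConstant))) := by
  refine ((continuous_exp.tendsto _).comp tendsto_ein_sub_log.neg).congr' ?_
  filter_upwards [eventually_gt_atTop 0] with x hx
  rw [Function.comp_apply, adjointWeight, neg_sub, sub_eq_add_neg, exp_add, exp_log hx]

/-- The solution `∫ x in Ioi 0, exp (-s * x - ein x)` of the adjoint equation
`s * p' s = -p (s + 1)`. -/
noncomputable def sieveAdjoint (s : ℝ) : ℝ :=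
  ∫ x in Set.Ioi (0 : ℝ), exp (-s * x) * adjointWeight x

theorem integrableOn_exp_mul_adjointWeight {s : ℝ} (hs : 0 < s) :
    IntegrableOn (fun x => exp (-s * x) * adjointWeight x) (Set.Ioi 0) := by
  refine (exp_neg_integrableOn_Ioi 0 hs).mono' ?_ ?_
  · have := continuous_adjointWeight
    exact (Continuous.mul (by fun_prop) this).aestronglyMeasurable
  · filter_upwards [ae_restrict_mem measurableSet_Ioi] with x hx
    rw [norm_of_nonneg (mul_nonneg (exp_pos _).le (adjointWeight_nonneg x))]
    exact mul_le_of_le_one_right (exp_pos _).le (adjointWeight_le_one (le_of_lt hx))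

theorem integral_exp_neg_mul {s : ℝ} (hs : 0 < s) :
    ∫ x in Set.Ioi (0 : ℝ), exp (-s * x) = 1 / s := by
  rw [integral_exp_mul_Ioi (neg_lt_zero.2 hs)]
  simp

theorem sieveAdjoint_le {s : ℝ} (hs : 0 < s) : sieveAdjoint s ≤ 1 / s := by
  rw [← integral_exp_neg_mul hs]
  refine setIntegral_mono_on (integrableOn_exp_mul_adjointWeight hs)
    (exp_neg_integrableOn_Ioi 0 hs) measurableSet_Ioi fun x hx => ?_
  exact mul_le_of_le_one_right (exp_pos _).le (adjointWeight_le_one (le_of_lt hx))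

theorem le_sieveAdjoint {s : ℝ} (hs : 0 < s) : 1 / (s + 1) ≤ sieveAdjoint s := by
  have hs1 : 0 < s + 1 := by linarith
  rw [← integral_exp_neg_mul hs1]
  refine setIntegral_mono_on (exp_neg_integrableOn_Ioi 0 hs1)
    (integrableOn_exp_mul_adjointWeight hs) measurableSet_Ioi fun x hx => ?_
  rw [show -(s + 1) * x = -s * x + -x by ring, exp_add]
  exact mul_le_mul_of_nonneg_left (exp_neg_le_adjointWeight (le_of_lt hx)) (exp_pos _).le

theorem sieveAdjoint_one : sieveAdjoint 1 = exp (-eulerMascheroniConstant) := by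
  have h := integral_Ioi_of_hasDerivAt_of_tendsto' (a := 0)
    (fun x _ => hasDerivAt_mul_adjointWeight x)
    (by simpa using integrableOn_exp_mul_adjointWeight one_pos) tendsto_mul_adjointWeight
  simpa [sieveAdjoint] using h

theorem hasDerivAt_sieveAdjoint {s : ℝ} (hs : 0 < s) :
    HasDerivAt sieveAdjoint (-sieveAdjoint (s + 1) / s) s := by
  have hw := continuous_adjointWeight
  have hbound : IntegrableOn (fun x : ℝ => x * exp (-(s / 2) * x)) (Set.Ioi 0) := by
    simpa using integrableOn_rpow_mul_exp_neg_mul_rpow (s := 1) (p := 1) (b := s / 2)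
      (by norm_num) one_pos (half_pos hs)
  obtain ⟨hint, hder⟩ := hasDerivAt_integral_of_dominated_loc_of_deriv_le
    (μ := volume.restrict (Set.Ioi (0 : ℝ))) (s := Set.Ioi (s / 2)) (x₀ := s)
    (F := fun s x => exp (-s * x) * adjointWeight x)
    (F' := fun s x => exp (-s * x) * -x * adjointWeight x)
    (bound := fun x => x * exp (-(s / 2) * x)) (Ioi_mem_nhds (half_lt_self hs))
    (Eventually.of_forall fun r => (Continuous.mul (by fun_prop) hw).aestronglyMeasurable)
    (integrableOn_exp_mul_adjointWeight hs)
    (Continuous.mul (by fun_prop) hw).aestronglyMeasurable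
    (by
      filter_upwards [ae_restrict_mem measurableSet_Ioi] with x hx r hr
      have hx : 0 < x := hx
      have hr : s / 2 < r := hr
      rw [norm_mul, norm_mul, norm_neg, norm_of_nonneg (exp_pos _).le, norm_of_nonneg hx.le,
        norm_of_nonneg (adjointWeight_nonneg x), mul_comm x]
      refine (mul_le_of_le_one_right (by positivity) (adjointWeight_le_one hx.le)).trans ?_
      gcongr)
    hbound
    (Eventually.of_forall fun x r _ => by
      have h := (((hasDerivAt_id r).neg.mul_const x).exp).mul_const (adjointWeight x)
      simpa using h)
  have hprod : Tendsto (fun x => exp (-s * x) * (x * adjointWeight x)) atTop (𝓝 0) := by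
    have h1 : Tendsto (fun x : ℝ => exp (-s * x)) atTop (𝓝 0) :=
      tendsto_exp_atBot.comp (tendsto_id.const_mul_atTop_of_neg (neg_lt_zero.2 hs))
    simpa using h1.mul tendsto_mul_adjointWeight
  have hint2 : IntegrableOn (fun x => exp (-(s + 1) * x) * adjointWeight x) (Set.Ioi 0) :=
    integrableOn_exp_mul_adjointWeight (by linarith)
  have hparts := integral_Ioi_of_hasDerivAt_of_tendsto' (a := 0)
    (f' := fun x => s * (exp (-s * x) * -x * adjointWeight x) +
      exp (-(s + 1) * x) * adjointWeight x)
    (fun x _ => by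
      have h := (((hasDerivAt_id x).const_mul (-s)).exp).mul (hasDerivAt_mul_adjointWeight x)
      refine h.congr_deriv ?_
      rw [show -(s + 1) * x = -s * x + -x by ring, exp_add]
      simp only [id]
      ring)
    ((hint.const_mul s).add hint2) hprod
  rw [integral_add (hint.const_mul s) hint2, integral_const_mul] at hparts
  refine hder.congr_deriv ?_
  rw [eq_div_iff hs.ne']
  simp only [zero_mul, mul_zero, sub_zero] at hparts
  rw [sieveAdjoint]
  linarith

theorem pos_on_Ici_of_forall_lt {g : ℝ → ℝ} {a : ℝ} (hg : ContinuousOn g (Set.Ici a))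
    (h : ∀ u, a ≤ u → (∀ v, a ≤ v → v < u → 0 < g v) → 0 < g u) (u : ℝ) (hu : a ≤ u) :
    0 < g u := by
  by_contra hneg
  set S : Set ℝ := Set.Ici a ∩ g ⁻¹' Set.Iic 0
  have hclosed : IsClosed S := hg.preimage_isClosed_of_isClosed isClosed_Ici isClosed_Iic
  have hbdd : BddBelow S := ⟨a, fun x hx => hx.1⟩
  have hmem : sInf S ∈ S := hclosed.csInf_mem ⟨u, hu, not_lt.1 hneg⟩ hbdd
  refine absurd (h _ hmem.1 fun v hv hvlt => ?_) (not_lt.2 hmem.2)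
  by_contra hv0
  exact absurd (csInf_le hbdd ⟨hv, not_lt.1 hv0⟩) (not_le.2 hvlt)

theorem eq_of_hasDerivAt_zero {g : ℝ → ℝ} {a b : ℝ} (hab : a ≤ b)
    (hg : ContinuousOn g (Set.Icc a b)) (h : ∀ x ∈ Set.Ioo a b, HasDerivAt g 0 x) :
    g b = g a := by
  rcases hab.eq_or_lt with rfl | hab
  · rfl
  · obtain ⟨c, -, hc⟩ := exists_hasDerivAt_eq_slope g (fun _ => 0) hab hg h
    rw [eq_div_iff (sub_pos.2 hab).ne', zero_mul] at hc
    linarith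

theorem exists_hasDerivAt_of_continuousOn_Ioi {g : ℝ → ℝ} (hg : ContinuousOn g (Set.Ioi 0)) :
    ∃ Φ : ℝ → ℝ, ∀ x, 0 < x → HasDerivAt Φ (g x) x := by
  refine ⟨fun x => ∫ t in (1 : ℝ)..x, g t, fun x hx => ?_⟩
  refine intervalIntegral.integral_hasDerivAt_right (ContinuousOn.intervalIntegrable ?_)
    (hg.stronglyMeasurableAtFilter isOpen_Ioi x hx) (hg.continuousAt (Ioi_mem_nhds hx))
  exact hg.mono fun y hy => lt_of_lt_of_le (lt_min one_pos hx) hy.1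

theorem exists_sub_eq_of_hasDerivAt {Φ g : ℝ → ℝ} (h : ∀ x, 0 < x → HasDerivAt Φ (g x) x)
    {u : ℝ} (hu : 1 < u) : ∃ c ∈ Set.Ioo (u - 1) u, Φ u - Φ (u - 1) = g c := by
  obtain ⟨c, hc, hcs⟩ := exists_hasDerivAt_eq_slope Φ g (sub_one_lt u)
    (fun x hx => (h x (by linarith [hx.1])).continuousAt.continuousWithinAt)
    (fun x hx => h x (by linarith [hx.1]))
  refine ⟨c, hc, ?_⟩
  rw [hcs]
  simp

theorem HasDerivAt.of_id_mul {G : ℝ → ℝ} {d u : ℝ} (hu : u ≠ 0)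
    (h : HasDerivAt (fun v => v * G v) d u) : HasDerivAt G ((d - G u) / u) u := by
  have h2 := h.div (hasDerivAt_id u) hu
  refine (h2.congr_of_eventuallyEq ?_).congr_deriv ?_
  · filter_upwards [isOpen_ne.mem_nhds hu] with v hv
    have hv : v ≠ 0 := hv
    simp [hv]
  · simp only [id]
    field_simp

theorem exists_exp_bound {g : ℝ → ℝ} (hg : ContinuousOn g (Set.Ici 2))
    (h : ∀ u, 4 < u → ∃ c ∈ Set.Ioo (u - 1) u, 3 * |g u| ≤ |g c|) :
    ∃ C, ∀ u, 2 ≤ u → |g u| < C * exp (-u) := by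
  obtain ⟨M, hM⟩ := isCompact_Icc.exists_bound_of_continuousOn
    (hg.mono (Set.Icc_subset_Ici_self (a := 4) (b := 2)))
  have hM0 : 0 ≤ M := (norm_nonneg _).trans (hM 2 ⟨le_rfl, by norm_num⟩)
  refine ⟨(M + 1) * exp 4, fun u hu => sub_pos.1 <|
    pos_on_Ici_of_forall_lt (g := fun u => (M + 1) * exp 4 * exp (-u) - |g u|)
      ?_ (fun u hu ih => ?_) u hu⟩
  · exact ContinuousOn.sub (by fun_prop) hg.abs
  · rw [sub_pos]
    rcases le_or_gt u 4 with h4 | h4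
    · have h1 : |g u| ≤ M := hM u ⟨hu, h4⟩
      have h2 : 1 ≤ exp 4 * exp (-u) := by
        rw [← exp_add]
        exact one_le_exp (by linarith)
      nlinarith
    · obtain ⟨c, hc, hcu⟩ := h u h4
      have h1 := sub_pos.1 (ih c (by linarith [hc.1]) hc.2)
      have h2 : exp (-c) ≤ 3 * exp (-u) := by
        calc exp (-c) ≤ exp (1 + -u) := exp_le_exp.2 (by linarith [hc.1])
          _ = exp 1 * exp (-u) := exp_add _ _
          _ ≤ 3 * exp (-u) := by
            have := exp_one_lt_three.le
            gcongr
      have h3 : (M + 1) * exp 4 * exp (-c) ≤ (M + 1) * exp 4 * (3 * exp (-u)) := by gcongr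
      linarith

section DelayMinus

variable {Q : ℝ → ℝ} {c : ℝ} (hQ : ContinuousOn Q (Set.Ioi 0))
  (hinit : ∀ u : ℝ, 0 < u → u ≤ 2 → Q u = c / u)
  (hdiff : ∀ u : ℝ, 2 < u → HasDerivAt (fun v => v * Q v) (-Q (u - 1)) u)

include hQ hinit hdiff

theorem exists_sub_one_mul_eq_of_delay (u : ℝ) (hu : 2 ≤ u) :
    ∃ x ∈ Set.Ioo (u - 1) u, (u - 1) * (u * Q u) = x * Q x := by
  have hxQ : ContinuousOn (fun x => x * Q x) (Set.Ioi 0) := continuousOn_id.mul hQ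
  obtain ⟨Φ, hΦ⟩ := exists_hasDerivAt_of_continuousOn_Ioi hxQ
  have hΦ' : ∀ v, 2 ≤ v → HasDerivAt (fun v => Φ (v - 1)) ((v - 1) * Q (v - 1)) v := fun v hv => by
    simpa using (hΦ (v - 1) (by linarith)).comp_sub_const v 1
  have hconst := eq_of_hasDerivAt_zero (g := fun v => (v - 1) * (v * Q v) - (Φ v - Φ (v - 1))) hu
    (fun v hv => ContinuousAt.continuousWithinAt (by
      have h0 : 0 < v := by linarith [hv.1]
      exact (ContinuousAt.mul (by fun_prop) (hxQ.continuousAt (Ioi_mem_nhds h0))).sub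
        ((hΦ v h0).continuousAt.sub (hΦ' v hv.1).continuousAt)))
    (fun v hv => by
      refine ((((hasDerivAt_id v).sub_const 1).mul (hdiff v hv.1)).sub
        ((hΦ v (by linarith [hv.1])).sub (hΦ' v hv.1.le))).congr_deriv ?_
      simp only [id]
      ring)
  obtain ⟨y, hy, hy2⟩ := exists_sub_eq_of_hasDerivAt hΦ (u := 2) one_lt_two
  obtain ⟨x, hx, hxu⟩ := exists_sub_eq_of_hasDerivAt hΦ (u := u) (by linarith)
  have hy0 : 0 < y := by linarith [hy.1]
  rw [hinit y hy0 hy.2.le, mul_div_cancel₀ c hy0.ne'] at hy2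
  refine ⟨x, hx, ?_⟩
  simp only [hy2, hxu, hinit 2 two_pos le_rfl] at hconst
  linarith

theorem pos_of_delay (hc : 0 < c) (u : ℝ) (hu : 0 < u) : 0 < Q u := by
  have hsmall : ∀ v, 0 < v → v ≤ 2 → 0 < Q v := fun v hv hv2 => by
    rw [hinit v hv hv2]
    positivity
  rcases le_total u 2 with h2 | h2
  · exact hsmall u hu h2
  · refine pos_on_Ici_of_forall_lt (hQ.mono fun x (hx : 2 ≤ x) => two_pos.trans_le hx)
      (fun v hv ih => ?_) u h2
    obtain ⟨x, hx, hxv⟩ := exists_sub_one_mul_eq_of_delay hQ hinit hdiff v hv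
    have hx0 : 0 < x := by linarith [hx.1]
    have hQx : 0 < Q x := by
      rcases le_total x 2 with hx2 | hx2
      · exact hsmall x hx0 hx2
      · exact ih x hx2 hx.2
    have hpos : 0 < (v - 1) * (v * Q v) := hxv ▸ mul_pos hx0 hQx
    exact pos_of_mul_pos_right (pos_of_mul_pos_right hpos (by linarith)) (by linarith)

theorem exists_exp_bound_of_delay_minus : ∃ C, ∀ u, 2 ≤ u → |Q u| ≤ C * exp (-u) := by
  obtain ⟨C, hC⟩ := exists_exp_bound (g := fun u => u * Q u)
    (continuousOn_id.mul (hQ.mono fun x (hx : 2 ≤ x) => two_pos.trans_le hx)) fun u hu => by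
      obtain ⟨x, hx, hxu⟩ := exists_sub_one_mul_eq_of_delay hQ hinit hdiff u (by linarith)
      refine ⟨x, hx, ?_⟩
      rw [← hxu, abs_mul (u - 1), abs_of_pos (by linarith : 0 < u - 1)]
      have := abs_nonneg (u * Q u)
      nlinarith
  refine ⟨C, fun u hu => ?_⟩
  have h1 := hC u hu
  rw [abs_mul, abs_of_pos (by linarith : 0 < u)] at h1
  nlinarith [abs_nonneg (Q u)]

end DelayMinus

section DelayPlus

variable {P : ℝ → ℝ} (hP : ContinuousOn P (Set.Ioi 0))
  (hdiff : ∀ u : ℝ, 2 < u → HasDerivAt (fun v => v * P v) (P (u - 1)) u)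

include hP hdiff

theorem exists_exp_bound_of_delay_plus {L : ℝ} (hL : Tendsto P atTop (𝓝 L)) :
    ∃ C, ∀ u, 2 ≤ u → |P u - L| ≤ C * exp (-u) := by
  have hP2 : ContinuousOn P (Set.Ici 2) := hP.mono fun x (hx : 2 ≤ x) => two_pos.trans_le hx
  have hder : ∀ u, 2 < u → HasDerivAt P ((P (u - 1) - P u) / u) u := fun u hu =>
    (hdiff u hu).of_id_mul (by linarith)
  obtain ⟨C, hC⟩ := exists_exp_bound (g := fun u => (P (u - 1) - P u) / u)
    (((hP.comp (f := fun x => x - 1) (by fun_prop) fun x (hx : (2 : ℝ) ≤ x) =>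
      show 0 < x - 1 by linarith).sub hP2).div continuousOn_id fun x (hx : (2 : ℝ) ≤ x) =>
        show x ≠ 0 by linarith) fun u hu => by
      obtain ⟨x, hx, hxu⟩ := exists_hasDerivAt_eq_slope P _ (sub_one_lt u)
        (hP2.mono fun y hy => show 2 ≤ y by linarith [hy.1])
        (fun y hy => hder y (by linarith [hy.1]))
      refine ⟨x, hx, ?_⟩
      rw [hxu, sub_sub_cancel, div_one, abs_div, abs_sub_comm, abs_of_pos (by linarith : 0 < u)]
      rw [mul_div_assoc', div_le_iff₀ (by linarith)]
      nlinarith [abs_nonneg (P u - P (u - 1))]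
  have hexp : ∀ u : ℝ, HasDerivAt (fun v => C * exp (-v)) (-(C * exp (-u))) u := fun u => by
    simpa using ((hasDerivAt_neg u).exp).const_mul C
  have hexpc : ContinuousOn (fun v => C * exp (-v)) (Set.Ici 2) := by fun_prop
  have hexp0 : Tendsto (fun v => C * exp (-v)) atTop (𝓝 0) := by
    simpa using (tendsto_exp_neg_atTop_nhds_zero).const_mul C
  have hanti : AntitoneOn (fun v => P v + C * exp (-v)) (Set.Ici 2) := by
    refine antitoneOn_of_hasDerivWithinAt_nonpos (convex_Ici 2) (hP2.add hexpc)
      (fun x hx => ((hder x (by simpa using hx)).add (hexp x)).hasDerivWithinAt) fun x hx => ?_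
    rw [interior_Ici, Set.mem_Ioi] at hx
    linarith [(abs_lt.1 (hC x hx.le)).2]
  have hmono : MonotoneOn (fun v => P v - C * exp (-v)) (Set.Ici 2) := by
    refine monotoneOn_of_hasDerivWithinAt_nonneg (convex_Ici 2) (hP2.sub hexpc)
      (fun x hx => ((hder x (by simpa using hx)).sub (hexp x)).hasDerivWithinAt) fun x hx => ?_
    rw [interior_Ici, Set.mem_Ioi] at hx
    linarith [(abs_lt.1 (hC x hx.le)).1]
  refine ⟨C, fun u hu => abs_le.2 ⟨?_, ?_⟩⟩
  · have := le_of_tendsto (hL.add hexp0) ((eventually_ge_atTop u).mono fun v hv =>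
      hanti hu (hu.trans hv) hv)
    linarith
  · have := ge_of_tendsto (hL.sub hexp0) ((eventually_ge_atTop u).mono fun v hv =>
      hmono hu (hu.trans hv) hv)
    linarith

theorem tendsto_of_delay_plus {c K : ℝ} (hinit : ∀ u : ℝ, 0 < u → u ≤ 2 → P u = c / u)
    (hK : ∀ u, 1 ≤ u → |P u| ≤ K) :
    Tendsto P atTop (𝓝 (c * exp (-eulerMascheroniConstant))) := by
  have hp : ∀ v, 0 < v → HasDerivAt sieveAdjoint (-sieveAdjoint (v + 1) / v) v :=
    fun v => hasDerivAt_sieveAdjoint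
  have hp1 : ∀ v, 0 < v → ContinuousAt (fun x => sieveAdjoint (x + 1)) v := fun v hv =>
    ((hp (v + 1) (by linarith)).comp_add_const v 1).continuousAt
  have hPp : ContinuousOn (fun x => P x * sieveAdjoint (x + 1)) (Set.Ioi 0) :=
    hP.mul fun v hv => (hp1 v hv).continuousWithinAt
  obtain ⟨Φ, hΦ⟩ := exists_hasDerivAt_of_continuousOn_Ioi hPp
  have hΦ' : ∀ v, 2 ≤ v →
      HasDerivAt (fun v => Φ (v - 1)) (P (v - 1) * sieveAdjoint v) v := fun v hv => by
    simpa using (hΦ (v - 1) (by linarith)).comp_sub_const v 1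
  have hstart : c * sieveAdjoint 2 + Φ 2 = c * sieveAdjoint 1 + Φ 1 :=
    eq_of_hasDerivAt_zero (g := fun v => c * sieveAdjoint v + Φ v) one_le_two
      (fun v hv => by
        have h0 : 0 < v := by linarith [hv.1]
        exact (((hp v h0).const_mul c).add (hΦ v h0)).continuousAt.continuousWithinAt)
      (fun v hv => by
        have h0 : 0 < v := by linarith [hv.1]
        refine (((hp v h0).const_mul c).add (hΦ v h0)).congr_deriv ?_
        rw [hinit v h0 hv.2.le]
        ring)
  have hinv : ∀ u, 2 ≤ u →
      u * P u * sieveAdjoint u + (Φ u - Φ (u - 1)) = c * exp (-eulerMascheroniConstant) := by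
    intro u hu
    have hconst := eq_of_hasDerivAt_zero
      (g := fun v => v * P v * sieveAdjoint v + (Φ v - Φ (v - 1))) hu
      (fun v hv => ContinuousAt.continuousWithinAt (by
        have h0 : 0 < v := by linarith [hv.1]
        exact ((continuousAt_id.mul (hP.continuousAt (Ioi_mem_nhds h0))).mul
          (hp v h0).continuousAt).add ((hΦ v h0).continuousAt.sub (hΦ' v hv.1).continuousAt)))
      (fun v hv => by
        have h0 : 0 < v := by linarith [hv.1]
        refine (((hdiff v hv.1).mul (hp v h0)).add
          ((hΦ v h0).sub (hΦ' v hv.1.le))).congr_deriv ?_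
        field_simp
        ring)
    simp only [hinit 2 two_pos le_rfl, ← sieveAdjoint_one] at hconst ⊢
    rw [show (2 : ℝ) - 1 = 1 by norm_num] at hconst
    linarith
  have hwin : Tendsto (fun u => Φ u - Φ (u - 1)) atTop (𝓝 0) := by
    refine squeeze_zero_norm' (a := fun u => K / u) ?_ (tendsto_const_nhds.div_atTop tendsto_id)
    filter_upwards [eventually_ge_atTop 2] with u hu
    obtain ⟨x, hx, hxu⟩ := exists_sub_eq_of_hasDerivAt hΦ (u := u) (by linarith)
    have hx1 : 0 < x + 1 := by linarith [hx.1]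
    have h1 : 0 ≤ sieveAdjoint (x + 1) := le_trans (by positivity) (le_sieveAdjoint hx1)
    have h2 : sieveAdjoint (x + 1) ≤ 1 / u := (sieveAdjoint_le hx1).trans
      (one_div_le_one_div_of_le (by linarith) (by linarith [hx.1]))
    have h3 := hK x (by linarith [hx.1])
    rw [hxu, norm_mul, norm_of_nonneg h1, norm_eq_abs, div_eq_mul_one_div]
    exact mul_le_mul h3 h2 h1 ((abs_nonneg _).trans h3)
  have hup : Tendsto (fun u => u * sieveAdjoint u) atTop (𝓝 1) := by
    have hlow : Tendsto (fun u : ℝ => 1 - 1 / (u + 1)) atTop (𝓝 1) := by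
      simpa using (tendsto_const_nhds (x := (1 : ℝ))).sub
        ((tendsto_const_nhds (x := (1 : ℝ))).div_atTop
          (tendsto_id.atTop_add (tendsto_const_nhds (x := (1 : ℝ)))))
    refine tendsto_of_tendsto_of_tendsto_of_le_of_le' hlow tendsto_const_nhds ?_ ?_
    · filter_upwards [eventually_gt_atTop 0] with u hu
      have h := mul_le_mul_of_nonneg_left (le_sieveAdjoint hu) hu.le
      refine le_trans (le_of_eq ?_) h
      field_simp
      ring
    · filter_upwards [eventually_gt_atTop 0] with u hu
      have h := mul_le_mul_of_nonneg_left (sieveAdjoint_le hu) hu.le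
      rwa [mul_one_div_cancel hu.ne'] at h
  have hlim := ((tendsto_const_nhds (x := c * exp (-eulerMascheroniConstant))).sub hwin).div
    hup one_ne_zero
  rw [sub_zero, div_one] at hlim
  refine hlim.congr' ?_
  filter_upwards [eventually_ge_atTop 2] with u hu
  have hu0 : 0 < u := by linarith
  have h1 : 0 < sieveAdjoint u := lt_of_lt_of_le (by positivity) (le_sieveAdjoint hu0)
  rw [Pi.div_apply, ← hinv u hu]
  field_simp
  ring

end DelayPlus

theorem strictAntiOn_and_strictMonoOn_of_pos {F f : ℝ → ℝ} {s : Set ℝ} (hs : Convex ℝ s)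
    (hs2 : s ⊆ Set.Ici 2) (hF : ContinuousOn F (Set.Ioi 0)) (hf : ContinuousOn f (Set.Ioi 0))
    (hFdiff : ∀ u : ℝ, 2 < u → HasDerivAt (fun v => v * F v) (f (u - 1)) u)
    (hfdiff : ∀ u : ℝ, 2 < u → HasDerivAt (fun v => v * f v) (F (u - 1)) u)
    (h : ∀ u ∈ interior s, f (u - 1) < F u ∧ f u < F (u - 1)) :
    StrictAntiOn F s ∧ StrictMonoOn f s := by
  have hs0 : s ⊆ Set.Ioi 0 := fun x hx => Set.mem_Ioi.2 (two_pos.trans_le (hs2 hx))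
  have hint : ∀ x ∈ interior s, 2 < x := fun x hx => by
    simpa using interior_mono hs2 hx
  constructor
  · refine strictAntiOn_of_hasDerivWithinAt_neg hs (hF.mono hs0) (fun x hx =>
      ((hFdiff x (hint x hx)).of_id_mul (by linarith [hint x hx])).hasDerivWithinAt) fun x hx => ?_
    exact div_neg_of_neg_of_pos (sub_neg.2 (h x hx).1) (by linarith [hint x hx])
  · refine strictMonoOn_of_hasDerivWithinAt_pos hs (hf.mono hs0) (fun x hx =>
      ((hfdiff x (hint x hx)).of_id_mul (by linarith [hint x hx])).hasDerivWithinAt) fun x hx => ?_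
    exact div_pos (sub_pos.2 (h x hx).2) (by linarith [hint x hx])


/-- **Lemma 2.5.** Monotonicity, positivity and asymptotics of the linear sieve
functions `F` and `f`. -/
theorem linear_sieve_functions_properties (F f : ℝ → ℝ)
    (hFcont : ContinuousOn F (Set.Ioi 0)) (hfcont : ContinuousOn f (Set.Ioi 0))
    (hFinit : ∀ u : ℝ, 0 < u → u ≤ 2 → F u = 2 * Real.exp eulerMascheroniConstant / u)
    (hfinit : ∀ u : ℝ, 0 < u → u ≤ 2 → f u = 0)
    (hFdiff : ∀ u : ℝ, 2 < u → HasDerivAt (fun v => v * F v) (f (u - 1)) u)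
    (hfdiff : ∀ u : ℝ, 2 < u → HasDerivAt (fun v => v * f v) (F (u - 1)) u) :
    -- (1) `F` is positive, strictly decreasing, and `F(u) = 1 + O(e^{-u})`
    ((∀ u : ℝ, 0 < u → 0 < F u) ∧ StrictAntiOn F (Set.Ioi 0) ∧
      (fun u => F u - 1) =O[atTop] fun u => Real.exp (-u)) ∧
    -- (2) `f` is positive and strictly increasing for `u > 2`, and `f(u) = 1 + O(e^{-u})`
    ((∀ u : ℝ, 2 < u → 0 < f u) ∧ StrictMonoOn f (Set.Ioi 2) ∧
      (fun u => f u - 1) =O[atTop] fun u => Real.exp (-u)) ∧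
    -- (3) `F(u) − f(u) > 0` for `u ≥ 1`
    (∀ u : ℝ, 1 ≤ u → 0 < F u - f u) := by
  set c : ℝ := 2 * exp eulerMascheroniConstant with hc
  have hc0 : 0 < c := by positivity
  have hQinit : ∀ u, 0 < u → u ≤ 2 → F u - f u = c / u := fun u hu hu2 => by
    rw [hFinit u hu hu2, hfinit u hu hu2, sub_zero]
  have hQdiff : ∀ u : ℝ, 2 < u → HasDerivAt (fun v => v * (F v - f v))
      (-(F (u - 1) - f (u - 1))) u := fun u hu => by
    refine (((hFdiff u hu).sub (hfdiff u hu)).congr_of_eventuallyEq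
      (Eventually.of_forall fun v => ?_)).congr_deriv ?_
    · simp only [Pi.sub_apply]
      ring
    · ring
  have hQ : ∀ u, 0 < u → 0 < F u - f u := pos_of_delay (hFcont.sub hfcont) hQinit hQdiff hc0
  obtain ⟨CQ, hCQ⟩ := exists_exp_bound_of_delay_minus (Q := fun u => F u - f u)
    (hFcont.sub hfcont) hQinit hQdiff
  have hanti2 : StrictAntiOn F (Set.Ioc 0 2) := fun x hx y hy hxy => by
    rw [hFinit x hx.1 hx.2, hFinit y hy.1 hy.2]
    exact div_lt_div_of_pos_left hc0 hx.1 hxy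
  have hf2 : f 2 = 0 := hfinit 2 two_pos le_rfl
  have hpos := pos_on_Ici_of_forall_lt (a := 2)
    (g := fun u => min (F u - f (u - 1)) (F (u - 1) - f u))
    (by
      have hsub : Set.Ici (2 : ℝ) ⊆ Set.Ioi 0 := fun x hx => Set.mem_Ioi.2 (two_pos.trans_le hx)
      have hmaps : Set.MapsTo (fun u : ℝ => u - 1) (Set.Ici 2) (Set.Ioi 0) :=
        fun x (hx : 2 ≤ x) => show 0 < x - 1 by linarith
      exact ((hFcont.mono hsub).sub (hfcont.comp (by fun_prop) hmaps)).inf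
        ((hFcont.comp (by fun_prop) hmaps).sub (hfcont.mono hsub)))
    (fun u hu ih => by
      obtain ⟨hanti, hmono⟩ := strictAntiOn_and_strictMonoOn_of_pos (convex_Icc 2 u)
        Set.Icc_subset_Ici_self hFcont hfcont hFdiff hfdiff fun v hv => by
          rw [interior_Icc] at hv
          have := lt_min_iff.1 (ih v hv.1.le hv.2)
          exact ⟨sub_pos.1 this.1, sub_pos.1 this.2⟩
      have hmem2 : (2 : ℝ) ∈ Set.Icc 2 u := ⟨le_rfl, hu⟩
      have hmemu : u ∈ Set.Icc 2 u := ⟨hu, le_rfl⟩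
      have hFu : F u ≤ F (u - 1) := by
        rcases le_total 2 (u - 1) with h | h
        · exact hanti.antitoneOn ⟨h, by linarith⟩ hmemu (by linarith)
        · exact (hanti.antitoneOn hmem2 hmemu hu).trans
            (hanti2.antitoneOn ⟨by linarith, h⟩ ⟨two_pos, le_rfl⟩ h)
      have hfu : f (u - 1) ≤ f u := by
        rcases le_total 2 (u - 1) with h | h
        · exact hmono.monotoneOn ⟨h, by linarith⟩ hmemu (by linarith)
        · rw [hfinit (u - 1) (by linarith) h, ← hf2]
          exact hmono.monotoneOn hmem2 hmemu hu
      have := hQ u (by linarith)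
      exact lt_min (by linarith) (by linarith))
  obtain ⟨hantiI, hmono⟩ := strictAntiOn_and_strictMonoOn_of_pos (convex_Ici 2) subset_rfl
    hFcont hfcont hFdiff hfdiff fun v hv => by
      rw [interior_Ici] at hv
      have := lt_min_iff.1 (hpos v (le_of_lt hv))
      exact ⟨sub_pos.1 this.1, sub_pos.1 this.2⟩
  have hanti : StrictAntiOn F (Set.Ioi 0) := by
    rw [← Set.Ioc_union_Ici_eq_Ioi (two_pos : (0 : ℝ) < 2)]
    exact hanti2.union hantiI ⟨⟨two_pos, le_rfl⟩, fun x hx => hx.2⟩ isLeast_Ici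
  have hfpos : ∀ u, 2 < u → 0 < f u := fun u hu =>
    hf2 ▸ hmono Set.self_mem_Ici hu.le hu
  have hfnonneg : ∀ u, 0 < u → 0 ≤ f u := fun u hu => by
    rcases le_or_gt u 2 with h | h
    · exact (hfinit u hu h).ge
    · exact (hfpos u h).le
  have hFpos : ∀ u, 0 < u → 0 < F u := fun u hu => by linarith [hQ u hu, hfnonneg u hu]
  have hPdiff : ∀ u : ℝ, 2 < u → HasDerivAt (fun v => v * (F v + f v))
      (F (u - 1) + f (u - 1)) u := fun u hu => by
    refine (((hFdiff u hu).add (hfdiff u hu)).congr_of_eventuallyEq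
      (Eventually.of_forall fun v => ?_)).congr_deriv ?_
    · simp only [Pi.add_apply]
      ring
    · ring
  have hlim := tendsto_of_delay_plus (P := fun u => F u + f u) (c := c) (K := 2 * F 1)
    (hFcont.add hfcont) hPdiff
    (fun u hu hu2 => by rw [hFinit u hu hu2, hfinit u hu hu2, add_zero])
    (fun u hu => by
      have hu0 : 0 < u := by linarith
      have h1 : F u ≤ F 1 := hanti.antitoneOn (Set.mem_Ioi.2 one_pos) hu0 hu
      have h2 := hQ u hu0
      have h3 := hfnonneg u hu0
      rw [abs_of_nonneg (by linarith)]
      linarith)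
  have hlimval : c * exp (-eulerMascheroniConstant) = 2 := by
    rw [hc, mul_assoc, ← exp_add, add_neg_cancel, exp_zero, mul_one]
  rw [hlimval] at hlim
  obtain ⟨CP, hCP⟩ := exists_exp_bound_of_delay_plus (P := fun u => F u + f u)
    (hFcont.add hfcont) hPdiff hlim
  refine ⟨⟨hFpos, hanti, ?_⟩, ⟨hfpos, hmono.mono Set.Ioi_subset_Ici_self, ?_⟩,
    fun u hu => hQ u (by linarith)⟩
  all_goals
    refine Asymptotics.IsBigO.of_bound ((CP + CQ) / 2) ?_
    filter_upwards [eventually_ge_atTop 2] with u hu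
    have h1 := abs_le.1 (hCP u hu)
    have h2 := abs_le.1 (hCQ u hu)
    rw [norm_of_nonneg (exp_pos _).le, norm_eq_abs]
    exact abs_le.2 ⟨by linarith, by linarith⟩
end

section
/- Let 0 < η ≤ 1, 0 < β ≤ 1, 0 < δ < 1/2, let ε > 0 be sufficiently small with η + β ≥ 4(1+δ)/3 + ε, set Δ = N^{−δ}, X = 2Δ|𝔄||𝔅| and α = ((η+β)/2 − 2/3 − 2δ/3)/(η+β−δ) − ε. Then for any constants c₂ ≥ c₁ > 0 there exist a constant C > 0 and N₀ such that for all N ≥ N₀, all 𝔄, 𝔅 ⊆ {N+1, …, 2N} with c₁N^η ≤ |𝔄| ≤ c₂N^η and c₁N^β ≤ |𝔅| ≤ c₂N^β, and every integer 1 ≤ d ≤ X^α, one has |r(𝒜,d)| ≤ C · X · N^{−ε} / d. -/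
/-- `ψ(t) = t − ⌊t⌋ − 1/2`. -/
noncomputable def psiSaw (t : ℝ) : ℝ := t - ⌊t⌋ - 1 / 2

/-- The remainder term `r(𝒜,d)` from (3.15):
`r(𝒜,d) = Σ_{a∈𝔄} Σ_{b∈𝔅} (ψ((√(ab) − Δ)/d) − ψ((√(ab) + Δ)/d))`. -/
noncomputable def remTerm (A B : Finset ℕ) (Δ : ℝ) (d : ℕ) : ℝ :=
  ∑ a ∈ A, ∑ b ∈ B,
    (psiSaw ((Real.sqrt (a * b) - Δ) / d) - psiSaw ((Real.sqrt (a * b) + Δ) / d))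

section

open scoped Real

/-- The quadratic polynomial `ψ² / 2 - 1 / 24`, an antiderivative of `ψ`, is approximated by its
truncated Fourier series. -/
lemma abs_psiSaw_sq_sub_fourier_le (y : ℝ) {K : ℕ} (hK : 1 ≤ K) :
    |psiSaw y ^ 2 / 2 - 1 / 24
        - ∑ h ∈ Finset.Icc 1 K, Real.cos (2 * π * h * y) / (2 * π ^ 2 * (h : ℝ) ^ 2)|
      ≤ 1 / (4 * (K : ℝ)) := by
  have hpi : (3 : ℝ) < π := Real.pi_gt_three
  have hx : Int.fract y ∈ Set.Icc (0 : ℝ) 1 :=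
    ⟨Int.fract_nonneg y, (Int.fract_lt_one y).le⟩
  have hsum := hasSum_one_div_nat_pow_mul_cos (k := 1) one_ne_zero hx
  have hval : (-1 : ℝ) ^ (1 + 1) * (2 * π) ^ (2 * 1) / 2 / ((2 * 1).factorial : ℝ) *
      Polynomial.eval (Int.fract y) (Polynomial.map (algebraMap ℚ ℝ) (Polynomial.bernoulli (2 * 1)))
      = 2 * π ^ 2 * (psiSaw y ^ 2 / 2 - 1 / 24) := by
    have hps : psiSaw y = Int.fract y - 1 / 2 := by
      rw [psiSaw, Int.fract]
    rw [hps]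
    simp [Polynomial.bernoulli_def, Finset.sum_range_succ, bernoulli_eq_bernoulli'_of_ne_one,
      bernoulli_one, Nat.factorial]
    ring
  rw [hval] at hsum
  have hcos : ∀ n : ℕ, Real.cos (2 * π * n * Int.fract y) = Real.cos (2 * π * n * y) := by
    intro n
    have : 2 * π * n * y = 2 * π * n * Int.fract y + ((n : ℤ) * ⌊y⌋ : ℤ) * (2 * π) := by
      have := Int.fract_add_floor y
      push_cast
      linear_combination (-2 * π * n) * this
    rw [this, Real.cos_add_int_mul_two_pi]
  have htend := hsum.tendsto_sum_nat
  set S : ℕ → ℝ := fun n => ∑ i ∈ Finset.range n,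
    1 / (i : ℝ) ^ (2 * 1) * Real.cos (2 * π * i * Int.fract y) with hS
  have hSK : S (K + 1)
      = 2 * π ^ 2 *
        ∑ h ∈ Finset.Icc 1 K, Real.cos (2 * π * h * y) / (2 * π ^ 2 * (h : ℝ) ^ 2) := by
    rw [hS, Finset.mul_sum]
    simp only
    rw [Finset.range_eq_Ico, Finset.sum_eq_sum_Ico_succ_bot (Nat.succ_pos K)]
    simp only [Nat.cast_zero, zero_add, mul_one]
    rw [show Finset.Ico 1 (K + 1) = Finset.Icc 1 K from rfl]
    simp only [ne_eq, OfNat.ofNat_ne_zero, not_false_eq_true, zero_pow, div_zero, zero_mul,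
      zero_add]
    refine Finset.sum_congr rfl fun i hi => ?_
    have : (i : ℝ) ≠ 0 := by
      have := (Finset.mem_Icc.mp hi).1
      positivity
    rw [hcos]
    field_simp
  have hbound : |2 * π ^ 2 * (psiSaw y ^ 2 / 2 - 1 / 24) - S (K + 1)| ≤ 1 / (K : ℝ) := by
    refine le_of_tendsto ((htend.sub_const (S (K + 1))).abs) ?_
    filter_upwards [Filter.eventually_ge_atTop (K + 1)] with n hn
    obtain ⟨m, rfl⟩ : ∃ m, n = m + 1 := ⟨n - 1, by omega⟩
    have hdiff : S (m + 1) - S (K + 1) = ∑ i ∈ Finset.Ioc K m,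
        1 / (i : ℝ) ^ (2 * 1) * Real.cos (2 * π * i * Int.fract y) := by
      rw [hS]
      simp only
      rw [← Finset.sum_Ico_eq_sub _ hn]
      congr 1
      ext i
      simp only [Finset.mem_Ico, Finset.mem_Ioc]
      omega
    change |S (m + 1) - S (K + 1)| ≤ _
    rw [hdiff]
    refine (Finset.abs_sum_le_sum_abs _ _).trans ?_
    have h1 : ∑ i ∈ Finset.Ioc K m,
        |1 / (i : ℝ) ^ (2 * 1) * Real.cos (2 * π * i * Int.fract y)|
        ≤ ∑ i ∈ Finset.Ioc K m, ((i : ℝ) ^ 2)⁻¹ := by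
      refine Finset.sum_le_sum fun i _ => ?_
      rw [abs_mul, mul_one, one_div, abs_of_nonneg (by positivity : (0 : ℝ) ≤ ((i : ℝ) ^ 2)⁻¹)]
      exact mul_le_of_le_one_right (by positivity) (Real.abs_cos_le_one _)
    have h2 := sum_Ioc_inv_sq_le_sub (α := ℝ) (k := K) (n := m) (by omega) (by omega)
    have h3 : (0 : ℝ) ≤ (m : ℝ)⁻¹ := by positivity
    rw [one_div]
    linarith
  rw [hSK, ← mul_sub, abs_mul, abs_of_pos (by positivity : (0 : ℝ) < 2 * π ^ 2)] at hbound
  have hK0 : (0 : ℝ) < K := by exact_mod_cast hK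
  rw [le_div_iff₀ (by positivity)]
  rw [le_div_iff₀ hK0] at hbound
  refine le_trans ?_ hbound
  have hnn := mul_nonneg (abs_nonneg (psiSaw y ^ 2 / 2 - 1 / 24
        - ∑ h ∈ Finset.Icc 1 K, Real.cos (2 * π * h * y) / (2 * π ^ 2 * (h : ℝ) ^ 2))) hK0.le
  have h4 : 4 ≤ 2 * π ^ 2 := by nlinarith
  linarith [mul_le_mul_of_nonneg_right h4 hnn]

lemma psiSaw_le (y : ℝ) : psiSaw y ≤ 1 / 2 := by
  have := Int.lt_floor_add_one y
  rw [psiSaw]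
  linarith

lemma neg_half_le_psiSaw (y : ℝ) : -(1 / 2) ≤ psiSaw y := by
  have := Int.floor_le y
  rw [psiSaw]
  linarith

lemma psiSaw_add_le (y : ℝ) {s : ℝ} (hs : 0 ≤ s) : psiSaw (y + s) ≤ psiSaw y + s := by
  have : (⌊y⌋ : ℝ) ≤ ⌊y + s⌋ := by
    exact_mod_cast Int.floor_mono (by linarith)
  rw [psiSaw, psiSaw]
  linarith

/-- `ψ` at the right end of an interval is at most its average over the interval plus the length. -/
lemma psiSaw_le_average (y : ℝ) {k : ℝ} (hk : 0 < k) :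
    psiSaw y ≤ (psiSaw y ^ 2 / 2 - psiSaw (y - k) ^ 2 / 2) / k + k := by
  obtain ⟨m, hm⟩ : ∃ m : ℤ, psiSaw (y - k) = psiSaw y - k + m :=
    ⟨⌊y⌋ - ⌊y - k⌋, by rw [psiSaw, psiSaw]; push_cast; ring⟩
  have hm0 : (0 : ℝ) ≤ m := by
    have := psiSaw_add_le (y - k) hk.le
    rw [sub_add_cancel] at this
    linarith
  have hm2 : (0 : ℝ) ≤ m * (m - 1) := by
    have : 0 ≤ m * (m - 1) := by
      have hm' : 0 ≤ m := by exact_mod_cast hm0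
      rcases hm'.eq_or_lt with h | h
      · simp [← h]
      · exact mul_nonneg hm' (by omega)
    exact_mod_cast this
  have hup := psiSaw_le (y - k)
  rw [← sub_le_iff_le_add, le_div_iff₀ hk, hm]
  nlinarith [mul_nonneg hm0 (by linarith : (0 : ℝ) ≤ 1 / 2 - (psiSaw y - k + m)), sq_nonneg k]

/-- `ψ` at the left end of an interval is at least its average over the interval minus the
length. -/
lemma average_le_psiSaw (y : ℝ) {k : ℝ} (hk : 0 < k) :
    (psiSaw (y + k) ^ 2 / 2 - psiSaw y ^ 2 / 2) / k - k ≤ psiSaw y := by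
  obtain ⟨m, hm⟩ : ∃ m : ℤ, psiSaw (y + k) = psiSaw y + k - m :=
    ⟨⌊y + k⌋ - ⌊y⌋, by rw [psiSaw, psiSaw]; push_cast; ring⟩
  have hm0 : (0 : ℝ) ≤ m := by
    have := psiSaw_add_le y hk.le
    linarith
  have hm2 : (0 : ℝ) ≤ m * (m - 1) := by
    have : 0 ≤ m * (m - 1) := by
      have hm' : 0 ≤ m := by exact_mod_cast hm0
      rcases hm'.eq_or_lt with h | h
      · simp [← h]
      · exact mul_nonneg hm' (by omega)
    exact_mod_cast this
  have hlow := neg_half_le_psiSaw (y + k)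
  rw [sub_le_iff_le_add, div_le_iff₀ hk, hm]
  nlinarith [mul_nonneg hm0 (by linarith : (0 : ℝ) ≤ psiSaw y + k - m + 1 / 2), sq_nonneg k]

/-- The Fourier coefficients of the trapezoidal function obtained by smoothing
`ψ (t - D) - ψ (t + D)` over intervals of length `k`. -/
noncomputable def smoothCoeff (D k : ℝ) (h : ℕ) : ℝ :=
  (Real.cos (2 * π * h * (D + k / 2)) - Real.cos (2 * π * h * (D + 3 * k / 2)))
    / (π ^ 2 * (h : ℝ) ^ 2 * k)

lemma abs_smoothCoeff_le (D : ℝ) {k : ℝ} (hk : 0 < k) {h : ℕ} (hh : 1 ≤ h) :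
    |smoothCoeff D k h| ≤ 2 / (π ^ 2 * (h : ℝ) ^ 2 * k) := by
  have hh0 : (0 : ℝ) < h := by exact_mod_cast hh
  have hpos : 0 < π ^ 2 * (h : ℝ) ^ 2 * k := by positivity
  rw [smoothCoeff, abs_div, abs_of_pos hpos]
  gcongr
  have h1 := Real.abs_cos_le_one (2 * π * h * (D + k / 2))
  have h2 := Real.abs_cos_le_one (2 * π * h * (D + 3 * k / 2))
  have h3 := abs_sub (Real.cos (2 * π * h * (D + k / 2))) (Real.cos (2 * π * h * (D + 3 * k / 2)))
  linarith

lemma abs_smoothCoeff_le' (D : ℝ) {k : ℝ} (hk : 0 < k) {h : ℕ} (hh : 1 ≤ h) :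
    |smoothCoeff D k h| ≤ 2 / (π * h) := by
  have hh0 : (0 : ℝ) < h := by exact_mod_cast hh
  have hpos : 0 < π ^ 2 * (h : ℝ) ^ 2 * k := by positivity
  rw [smoothCoeff, abs_div, abs_of_pos hpos, div_le_iff₀ hpos]
  refine (Real.abs_cos_sub_cos_le _ _).trans (le_of_eq ?_)
  rw [show 2 * π * h * (D + k / 2) - 2 * π * h * (D + 3 * k / 2) = -(2 * π * h * k) by ring,
    abs_neg, abs_of_pos (by positivity)]
  field_simp

lemma abs_smoothCoeff_le'' (D : ℝ) {k : ℝ} (hk : 0 < k) {h : ℕ} (hh : 1 ≤ h) :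
    |smoothCoeff D k h| ≤ 4 * (|D| + k) := by
  have hh0 : (0 : ℝ) < h := by exact_mod_cast hh
  have hpos : 0 < π ^ 2 * (h : ℝ) ^ 2 * k := by positivity
  rw [smoothCoeff, abs_div, abs_of_pos hpos, div_le_iff₀ hpos, Real.cos_sub_cos]
  rw [show (2 * π * h * (D + k / 2) + 2 * π * h * (D + 3 * k / 2)) / 2
      = 2 * π * h * (D + k) by ring,
    show (2 * π * h * (D + k / 2) - 2 * π * h * (D + 3 * k / 2)) / 2 = -(π * h * k) by ring,
    Real.sin_neg, abs_mul, abs_mul, abs_neg, abs_neg]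
  have h1 : |Real.sin (2 * π * h * (D + k))| ≤ 2 * π * h * (|D| + k) := by
    refine Real.abs_sin_le_abs.trans ?_
    rw [abs_mul, abs_of_pos (by positivity : 0 < 2 * π * (h : ℝ))]
    gcongr
    simpa [abs_of_pos hk] using abs_add_le D k
  have h2 : |Real.sin (π * h * k)| ≤ π * h * k := by
    refine Real.abs_sin_le_abs.trans ?_
    rw [abs_of_pos (by positivity)]
  calc |(2 : ℝ)| * |Real.sin (2 * π * h * (D + k))| * |Real.sin (π * h * k)|
      ≤ 2 * (2 * π * h * (|D| + k)) * (π * h * k) := by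
        rw [abs_two]
        have := abs_nonneg D
        gcongr
    _ = 4 * (|D| + k) * (π ^ 2 * (h : ℝ) ^ 2 * k) := by ring

lemma smoothCoeff_sq_le (D : ℝ) {k : ℝ} (hk : 0 < k) {h : ℕ} (hh : 1 ≤ h) :
    smoothCoeff D k h ^ 2 ≤ 4 * (|D| + k) * (1 / h) := by
  have hh0 : (0 : ℝ) < h := by exact_mod_cast hh
  have hpi := Real.pi_gt_three
  rw [← sq_abs, sq]
  have h1 : 2 / (π * h) ≤ 1 / h := by
    rw [div_le_div_iff₀ (by positivity) hh0]
    nlinarith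
  exact mul_le_mul (abs_smoothCoeff_le'' D hk hh) ((abs_smoothCoeff_le' D hk hh).trans h1)
    (abs_nonneg _) (by positivity)

lemma smoothCoeff_sq_mul_sq_le (D : ℝ) {k : ℝ} (hk : 0 < k) {h : ℕ} (hh : 1 ≤ h) :
    smoothCoeff D k h ^ 2 * (h : ℝ) ^ 2 ≤ 1 / k * (1 / h) := by
  have hh0 : (0 : ℝ) < h := by exact_mod_cast hh
  have hpi := Real.pi_gt_three
  rw [← sq_abs, sq]
  calc |smoothCoeff D k h| * |smoothCoeff D k h| * (h : ℝ) ^ 2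
      ≤ (2 / (π ^ 2 * (h : ℝ) ^ 2 * k)) * (2 / (π * h)) * (h : ℝ) ^ 2 := by
        gcongr
        · exact abs_smoothCoeff_le D hk hh
        · exact abs_smoothCoeff_le' D hk hh
    _ = 4 / π ^ 3 * (1 / k * (1 / h)) := by field_simp; norm_num
    _ ≤ 1 * (1 / k * (1 / h)) := by
        gcongr
        rw [div_le_one (by positivity)]
        have : (3 : ℝ) ^ 3 ≤ π ^ 3 := by gcongr
        linarith
    _ = _ := one_mul _

/-- A trigonometric polynomial that bounds `ψ (t - D) - ψ (t + D)` up to `O(k)` from above,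
uniformly for `t ∈ [y, y + k]`. -/
lemma psiSaw_sub_psiSaw_le (D y : ℝ) {k e : ℝ} {K : ℕ} (hk : 0 < k) (he : 0 ≤ e) (hek : e ≤ k)
    (hK1 : 1 ≤ K) (hK : 1 / k ^ 2 ≤ K) :
    psiSaw (y + e - D) - psiSaw (y + e + D)
      ≤ ∑ h ∈ Finset.Icc 1 K, smoothCoeff D k h * Real.cos (2 * π * h * (y + k / 2)) + 5 * k := by
  have hK0 : (0 : ℝ) < K := by exact_mod_cast hK1
  have hA := psiSaw_add_le (y - D) he
  have hA' := psiSaw_le_average (y - D) hk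
  have hB := psiSaw_add_le (y + e + D) (sub_nonneg.mpr hek)
  have hB' := average_le_psiSaw (y + D + k) hk
  rw [show y - D + e = y + e - D by ring] at hA
  rw [show y + e + D + (k - e) = y + D + k by ring] at hB
  set G : ℝ → ℝ := fun t =>
    ∑ h ∈ Finset.Icc 1 K, Real.cos (2 * π * h * t) / (2 * π ^ 2 * (h : ℝ) ^ 2) with hG
  have e1 := (abs_le.mp (abs_psiSaw_sq_sub_fourier_le (y - D) hK1)).2
  have e2 := (abs_le.mp (abs_psiSaw_sq_sub_fourier_le (y - D - k) hK1)).1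
  have e3 := (abs_le.mp (abs_psiSaw_sq_sub_fourier_le (y + D + k + k) hK1)).1
  have e4 := (abs_le.mp (abs_psiSaw_sq_sub_fourier_le (y + D + k) hK1)).2
  have hcomb : (G (y - D) - G (y - D - k) - G (y + D + k + k) + G (y + D + k)) / k
      = ∑ h ∈ Finset.Icc 1 K, smoothCoeff D k h * Real.cos (2 * π * h * (y + k / 2)) := by
    rw [hG]
    simp only
    rw [← Finset.sum_sub_distrib, ← Finset.sum_sub_distrib, ← Finset.sum_add_distrib,
      Finset.sum_div]
    refine Finset.sum_congr rfl fun h hh => ?_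
    have hh0 : (h : ℝ) ≠ 0 := by
      have := (Finset.mem_Icc.mp hh).1
      positivity
    have c1 : Real.cos (2 * π * h * (y - D)) + Real.cos (2 * π * h * (y + D + k))
        = 2 * Real.cos (2 * π * h * (y + k / 2)) * Real.cos (2 * π * h * (D + k / 2)) := by
      rw [Real.cos_add_cos, ← Real.cos_neg ((_ - _) / 2)]
      ring_nf
    have c2 : Real.cos (2 * π * h * (y - D - k)) + Real.cos (2 * π * h * (y + D + k + k))
        = 2 * Real.cos (2 * π * h * (y + k / 2)) * Real.cos (2 * π * h * (D + 3 * k / 2)) := by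
      rw [Real.cos_add_cos, ← Real.cos_neg ((_ - _) / 2)]
      ring_nf
    rw [smoothCoeff]
    generalize Real.cos (2 * π * h * (y + k / 2)) = x₀ at *
    generalize Real.cos (2 * π * h * (D + k / 2)) = x₁ at *
    generalize Real.cos (2 * π * h * (D + 3 * k / 2)) = x₂ at *
    generalize Real.cos (2 * π * h * (y - D)) = x₃ at *
    generalize Real.cos (2 * π * h * (y - D - k)) = x₄ at *
    generalize Real.cos (2 * π * h * (y + D + k + k)) = x₅ at *
    generalize Real.cos (2 * π * h * (y + D + k)) = x₆ at *
    field_simp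
    linear_combination c1 - c2
  have htrunc : 4 * (1 / (4 * (K : ℝ))) / k ≤ k := by
    rw [div_le_iff₀ hk]
    rw [div_le_iff₀ (by positivity)] at hK
    rw [show 4 * (1 / (4 * (K : ℝ))) = 1 / K by field_simp, div_le_iff₀ hK0]
    nlinarith
  have hsplit : (psiSaw (y - D) ^ 2 / 2 - psiSaw (y - D - k) ^ 2 / 2) / k
      - (psiSaw (y + D + k + k) ^ 2 / 2 - psiSaw (y + D + k) ^ 2 / 2) / k
      ≤ (G (y - D) - G (y - D - k) - G (y + D + k + k) + G (y + D + k)) / k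
        + 4 * (1 / (4 * (K : ℝ))) / k := by
    rw [← sub_div, ← add_div]
    gcongr
    simp only [hG]
    linarith
  rw [hcomb] at hsplit
  linarith

/-- The Fourier transform of a Gaussian, in real form. -/
lemma integral_cos_mul_exp_neg_sq {N : ℝ} (hN : 0 < N) (s θ : ℝ) :
    MeasureTheory.Integrable
        (fun u : ℝ => Real.cos (s * u + θ) * Real.exp (-(1 / (2 * N)) * u ^ 2)) ∧
      |∫ u : ℝ, Real.cos (s * u + θ) * Real.exp (-(1 / (2 * N)) * u ^ 2)|
        ≤ √(2 * π * N) * Real.exp (-(s ^ 2 * N / 2)) := by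
  have hb : (0 : ℝ) < 1 / (2 * N) := by positivity
  have hInt : MeasureTheory.Integrable
      (fun u : ℝ => Real.exp (-(1 / (2 * N)) * u ^ 2)) := integrable_exp_neg_mul_sq hb
  refine ⟨hInt.bdd_mul (c := 1) (by fun_prop) (by
    filter_upwards with u
    rw [Real.norm_eq_abs]
    exact Real.abs_cos_le_one _), ?_⟩
  have hg := fourierIntegral_gaussian (b := ((1 / (2 * N) : ℝ) : ℂ))
    (by rw [Complex.ofReal_re]; exact hb) (s : ℂ)
  set f : ℝ → ℂ := fun u => Complex.exp (θ * Complex.I) *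
    (Complex.exp (Complex.I * s * u) * Complex.exp (-((1 / (2 * N) : ℝ) : ℂ) * u ^ 2)) with hf
  have hre : ∀ u : ℝ, Real.cos (s * u + θ) * Real.exp (-(1 / (2 * N)) * u ^ 2) = (f u).re := by
    intro u
    have h1 : f u = Complex.exp ((s * u + θ : ℝ) * Complex.I) *
        ((Real.exp (-(1 / (2 * N)) * u ^ 2) : ℝ) : ℂ) := by
      rw [hf]
      simp only
      rw [← mul_assoc, ← Complex.exp_add, Complex.ofReal_exp]
      congr 2
      · push_cast; ring
      · push_cast; ring
    rw [h1, Complex.re_mul_ofReal, Complex.exp_ofReal_mul_I_re]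
  have hfint : MeasureTheory.Integrable f := by
    refine MeasureTheory.Integrable.mono' hInt (by fun_prop) ?_
    filter_upwards with u
    rw [hf]
    simp only
    rw [norm_mul, norm_mul, Complex.norm_exp_ofReal_mul_I, Complex.norm_exp, Complex.norm_exp]
    simp [← Complex.ofReal_pow]
  simp_rw [hre]
  have hswap : ∫ u : ℝ, (f u).re = (∫ u : ℝ, f u).re := by
    simpa using integral_re hfint
  rw [hswap]
  refine (Complex.abs_re_le_norm _).trans (le_of_eq ?_)
  rw [hf, MeasureTheory.integral_const_mul, hg, norm_mul, norm_mul,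
    Complex.norm_exp_ofReal_mul_I, one_mul]
  congr 1
  · rw [← Complex.ofReal_div, show (1 / 2 : ℂ) = ((1 / 2 : ℝ) : ℂ) by norm_num,
      ← Complex.ofReal_cpow (by positivity), Complex.norm_real, Real.norm_eq_abs,
      abs_of_nonneg (by positivity), ← Real.sqrt_eq_rpow]
    congr 1
    field_simp
  · rw [Complex.norm_exp]
    congr 1
    rw [← Complex.ofReal_pow, ← Complex.ofReal_neg, show (4 : ℂ) = ((4 : ℝ) : ℂ) by norm_num,
      ← Complex.ofReal_mul, ← Complex.ofReal_div, Complex.ofReal_re]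
    field_simp
    norm_num

/-- A mean value theorem for trigonometric sums with arbitrary nonnegative real frequencies. -/
lemma integral_sq_sum_cos_le {ι : Type*} (s : Finset ι) (c A θ : ι → ℝ) {N : ℝ} (hN : 0 < N)
    (hA : ∀ p ∈ s, 0 ≤ A p) :
    ∫ u in √N..√(2 * N), (∑ p ∈ s, c p * Real.cos (A p * u + θ p)) ^ 2
      ≤ Real.exp 1 * √(2 * π * N) *
        ∑ p ∈ s, ∑ q ∈ s, |c p| * |c q| * Real.exp (-((A p - A q) ^ 2 * N / 2)) := by
  set F : ℝ → ℝ := fun u => ∑ p ∈ s, c p * Real.cos (A p * u + θ p) with hF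
  set w : ℝ → ℝ := fun u => Real.exp (-(1 / (2 * N)) * u ^ 2) with hw
  set g : ι → ι → ℝ → ℝ := fun p q u => c p * c q / 2 *
      (Real.cos ((A p - A q) * u + (θ p - θ q)) * w u
        + Real.cos ((A p + A q) * u + (θ p + θ q)) * w u) with hg
  have hexp : ∀ u, F u ^ 2 * w u = ∑ p ∈ s, ∑ q ∈ s, g p q u := by
    intro u
    rw [sq, hF]
    simp only
    rw [Finset.sum_mul_sum, Finset.sum_mul]
    refine Finset.sum_congr rfl fun p _ => ?_
    rw [Finset.sum_mul]
    refine Finset.sum_congr rfl fun q _ => ?_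
    rw [hg]
    simp only
    rw [show (A p - A q) * u + (θ p - θ q) = (A p * u + θ p) - (A q * u + θ q) by ring,
      show (A p + A q) * u + (θ p + θ q) = (A p * u + θ p) + (A q * u + θ q) by ring,
      Real.cos_sub (A p * u + θ p), Real.cos_add (A p * u + θ p)]
    ring
  have hgint : ∀ p q, MeasureTheory.Integrable (g p q) := fun p q =>
    ((integral_cos_mul_exp_neg_sq hN _ _).1.add
      (integral_cos_mul_exp_neg_sq hN _ _).1).const_mul _
  have hgle : ∀ p ∈ s, ∀ q ∈ s, ∫ u, g p q u ≤ |c p| * |c q| *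
      (√(2 * π * N) * Real.exp (-((A p - A q) ^ 2 * N / 2))) := by
    intro p hp q hq
    rw [hg]
    simp only
    rw [MeasureTheory.integral_const_mul, MeasureTheory.integral_add
      (integral_cos_mul_exp_neg_sq hN _ _).1 (integral_cos_mul_exp_neg_sq hN _ _).1]
    refine (le_abs_self _).trans ?_
    rw [abs_mul, abs_div, abs_mul, abs_two]
    have h1 := (integral_cos_mul_exp_neg_sq hN (A p - A q) (θ p - θ q)).2
    have h2 := (integral_cos_mul_exp_neg_sq hN (A p + A q) (θ p + θ q)).2
    have h3 : Real.exp (-((A p + A q) ^ 2 * N / 2)) ≤ Real.exp (-((A p - A q) ^ 2 * N / 2)) := by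
      rw [Real.exp_le_exp]
      nlinarith [mul_nonneg (mul_nonneg (hA p hp) (hA q hq)) hN.le]
    have h4 := mul_le_mul_of_nonneg_left h3 (Real.sqrt_nonneg (2 * π * N))
    have h5 := abs_add_le
      (∫ u, Real.cos ((A p - A q) * u + (θ p - θ q)) * w u)
      (∫ u, Real.cos ((A p + A q) * u + (θ p + θ q)) * w u)
    rw [div_mul_eq_mul_div, mul_div_assoc]
    gcongr
    simp only [hw] at h5 ⊢
    linarith
  have hFcont : Continuous F := by fun_prop
  have hle : √N ≤ √(2 * N) := Real.sqrt_le_sqrt (by linarith)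
  have hInt : MeasureTheory.Integrable (fun u => F u ^ 2 * w u) := by
    simp_rw [hexp]
    exact MeasureTheory.integrable_finsetSum _ fun p _ =>
      MeasureTheory.integrable_finsetSum _ fun q _ => hgint p q
  calc ∫ u in √N..√(2 * N), F u ^ 2
      ≤ ∫ u in √N..√(2 * N), Real.exp 1 * (F u ^ 2 * w u) := by
        refine intervalIntegral.integral_mono_on hle
          (Continuous.intervalIntegrable (by fun_prop) _ _)
          ((hInt.const_mul _).intervalIntegrable) fun u hu => ?_
        have hu0 : 0 ≤ u := (Real.sqrt_nonneg N).trans hu.1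
        have hu2 : u ^ 2 ≤ 2 * N := by
          have := Real.sq_sqrt (by positivity : 0 ≤ 2 * N)
          nlinarith [hu.2]
        have hone : 1 ≤ Real.exp 1 * w u := by
          rw [hw]
          simp only
          rw [← Real.exp_add]
          apply Real.one_le_exp
          have : 1 / (2 * N) * u ^ 2 ≤ 1 := by
            rw [one_div, inv_mul_le_one₀ (by positivity)]
            exact hu2
          linarith
        nlinarith [sq_nonneg (F u)]
    _ ≤ ∫ u, Real.exp 1 * (F u ^ 2 * w u) := by
        rw [intervalIntegral.integral_of_le hle]
        refine MeasureTheory.setIntegral_le_integral (hInt.const_mul _) ?_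
        filter_upwards with u
        simp only [hw, Pi.zero_apply]
        positivity
    _ = Real.exp 1 * ∑ p ∈ s, ∑ q ∈ s, ∫ u, g p q u := by
        rw [MeasureTheory.integral_const_mul]
        simp_rw [hexp]
        rw [MeasureTheory.integral_finsetSum _ fun p _ =>
          MeasureTheory.integrable_finsetSum _ fun q _ => hgint p q]
        congr 1
        refine Finset.sum_congr rfl fun p _ => ?_
        exact MeasureTheory.integral_finsetSum _ fun q _ => hgint p q
    _ ≤ Real.exp 1 * ∑ p ∈ s, ∑ q ∈ s, |c p| * |c q| *
          (√(2 * π * N) * Real.exp (-((A p - A q) ^ 2 * N / 2))) := by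
        gcongr with p hp q hq
        exact hgle p hp q hq
    _ = _ := by
        simp_rw [Finset.mul_sum]
        refine Finset.sum_congr rfl fun p _ => Finset.sum_congr rfl fun q _ => ?_
        ring

/-- The number of pairs of integers in `(N, 2N]` whose multiples by `h²` and by the square of the
second parameter differ by at most `Q`. -/
lemma card_filter_abs_sq_mul_sub_le (N : ℕ) {h h' : ℕ} (hh : 1 ≤ h) {Q : ℝ} (hQ : 0 ≤ Q) :
    (((Finset.Icc (N + 1) (2 * N) ×ˢ Finset.Icc (N + 1) (2 * N)).filter fun x : ℕ × ℕ =>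
        |(h : ℝ) ^ 2 * x.1 - (h' : ℝ) ^ 2 * x.2| ≤ Q).card : ℝ)
      ≤ (2 * Q / (Nat.gcd h h' : ℝ) ^ 2 + 1) * (N * (Nat.gcd h h' : ℝ) ^ 2 / (h : ℝ) ^ 2 + 2) := by
  obtain ⟨g, hg⟩ : ∃ g, g = Nat.gcd h h' := ⟨_, rfl⟩
  have hg0 : 0 < g := hg ▸ Nat.gcd_pos_of_pos_left _ hh
  obtain ⟨u, v, hcop, hu, hv⟩ := Nat.exists_coprime h h'
  rw [← hg] at hu hv ⊢
  have hu0 : 0 < u := Nat.pos_of_ne_zero fun h0 => by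
    rw [h0, zero_mul] at hu
    omega
  have hcop2 : IsCoprime ((u : ℤ) ^ 2) ((v : ℤ) ^ 2) :=
    (Nat.isCoprime_iff_coprime.mpr hcop).pow
  have hgR : (0 : ℝ) < g := by exact_mod_cast hg0
  have huR : (0 : ℝ) < u := by exact_mod_cast hu0
  set R : ℕ := ⌊Q / (g : ℝ) ^ 2⌋₊ with hR
  set S := (Finset.Icc (N + 1) (2 * N) ×ˢ Finset.Icc (N + 1) (2 * N)).filter fun x : ℕ × ℕ =>
        |(h : ℝ) ^ 2 * x.1 - (h' : ℝ) ^ 2 * x.2| ≤ Q with hS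
  have hcard : S.card ≤
      (Finset.Icc (-(R : ℤ)) R ×ˢ Finset.Icc (N / u ^ 2) (2 * N / u ^ 2)).card := by
    refine Finset.card_le_card_of_injOn
      (fun x : ℕ × ℕ => ((u : ℤ) ^ 2 * x.1 - (v : ℤ) ^ 2 * x.2, x.2 / u ^ 2)) ?_ ?_
    · rintro ⟨a, a'⟩ hx
      have hx' := Finset.mem_filter.mp (Finset.mem_coe.mp hx)
      simp only [Finset.mem_product, Finset.mem_Icc] at hx'
      obtain ⟨⟨-, ha1, ha2⟩, hab⟩ := hx'
      simp only [Finset.coe_product, Finset.coe_Icc, Set.mem_prod, Set.mem_Icc]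
      refine ⟨abs_le.mp ?_, Nat.div_le_div_right (by omega), Nat.div_le_div_right ha2⟩
      rw [hu, hv] at hab
      push_cast at hab
      have habs : |(u : ℝ) ^ 2 * a - (v : ℝ) ^ 2 * a'| ≤ Q / (g : ℝ) ^ 2 := by
        rw [le_div_iff₀ (by positivity), ← abs_of_pos (by positivity : 0 < (g : ℝ) ^ 2), ← abs_mul]
        refine le_trans (le_of_eq ?_) hab
        congr 1
        ring
      have hcast : (((|(u : ℤ) ^ 2 * a - (v : ℤ) ^ 2 * a'|).toNat : ℕ) : ℝ)
          = |(u : ℝ) ^ 2 * a - (v : ℝ) ^ 2 * a'| := by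
        have h1 : (((|(u : ℤ) ^ 2 * a - (v : ℤ) ^ 2 * a'|).toNat : ℤ) : ℝ)
            = ((|(u : ℤ) ^ 2 * a - (v : ℤ) ^ 2 * a'| : ℤ) : ℝ) := by
          rw [Int.toNat_of_nonneg (abs_nonneg _)]
        push_cast at h1 ⊢
        exact h1
      have hle : (|(u : ℤ) ^ 2 * a - (v : ℤ) ^ 2 * a'|).toNat ≤ R :=
        Nat.le_floor (hcast.trans_le habs)
      have := Int.self_le_toNat |(u : ℤ) ^ 2 * a - (v : ℤ) ^ 2 * a'|
      omega
    · rintro ⟨a, a'⟩ - ⟨b, b'⟩ - hxy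
      simp only [Prod.mk.injEq] at hxy
      obtain ⟨h1, h2⟩ := hxy
      have hdvd : (u : ℤ) ^ 2 ∣ (a' : ℤ) - b' := by
        refine hcop2.dvd_of_dvd_mul_left ⟨(a : ℤ) - b, ?_⟩
        linear_combination -h1
      have hmod : a' % u ^ 2 = b' % u ^ 2 := by
        have : (b' : ℤ) ≡ a' [ZMOD ((u ^ 2 : ℕ) : ℤ)] :=
          (Int.modEq_iff_dvd).mpr (by exact_mod_cast hdvd)
        exact ((Int.natCast_modEq_iff.mp this).symm)
      have hab' : a' = b' := by
        rw [← Nat.div_add_mod a' (u ^ 2), ← Nat.div_add_mod b' (u ^ 2), h2, hmod]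
      subst hab'
      have hab : (u : ℤ) ^ 2 * a = (u : ℤ) ^ 2 * b := by linarith
      have : (a : ℤ) = b := mul_left_cancel₀ (pow_ne_zero 2 (by exact_mod_cast hu0.ne')) hab
      simp only [Prod.mk.injEq, and_true]
      exact_mod_cast this
  have hc1 : ((Finset.Icc (-(R : ℤ)) R).card : ℝ) ≤ 2 * Q / (g : ℝ) ^ 2 + 1 := by
    rw [Int.card_Icc, show ((R : ℤ) + 1 - -(R : ℤ)).toNat = 2 * R + 1 by omega]
    have := Nat.floor_le (by positivity : 0 ≤ Q / (g : ℝ) ^ 2)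
    push_cast
    rw [mul_div_assoc]
    linarith
  have hc2 : ((Finset.Icc (N / u ^ 2) (2 * N / u ^ 2)).card : ℝ)
      ≤ N * (g : ℝ) ^ 2 / (h : ℝ) ^ 2 + 2 := by
    have hle : N / u ^ 2 ≤ 2 * N / u ^ 2 := Nat.div_le_div_right (by omega)
    rw [Nat.card_Icc, Nat.cast_sub (by omega)]
    have h1 : ((2 * N / u ^ 2 : ℕ) : ℝ) ≤ 2 * N / (u : ℝ) ^ 2 := by
      have := Nat.cast_div_le (α := ℝ) (m := 2 * N) (n := u ^ 2)
      push_cast at this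
      exact this
    have h2 : (N : ℝ) / (u : ℝ) ^ 2 < (N / u ^ 2 : ℕ) + 1 := by
      rw [div_lt_iff₀ (by positivity)]
      have := Nat.lt_div_mul_add (a := N) (b := u ^ 2) (by positivity)
      have h3 : N < (N / u ^ 2 + 1) * u ^ 2 := by linarith
      exact_mod_cast h3
    have h3 : (N : ℝ) * (g : ℝ) ^ 2 / (h : ℝ) ^ 2 = N / (u : ℝ) ^ 2 := by
      rw [hu]
      push_cast
      field_simp
    rw [h3]
    push_cast
    have h4 : 2 * (N : ℝ) / (u : ℝ) ^ 2 = 2 * (N / (u : ℝ) ^ 2) := by ring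
    linarith
  calc (S.card : ℝ) ≤ ((Finset.Icc (-(R : ℤ)) R).card : ℝ) *
        ((Finset.Icc (N / u ^ 2) (2 * N / u ^ 2)).card : ℝ) := by
        rw [Finset.card_product] at hcard
        exact_mod_cast hcard
    _ ≤ _ := mul_le_mul hc1 hc2 (Nat.cast_nonneg _) (by positivity)

lemma sum_Icc_one_div_le (n : ℕ) : ∑ i ∈ Finset.Icc 1 n, (1 : ℝ) / i ≤ 1 + Real.log n := by
  have := harmonic_le_one_add_log n
  rw [harmonic_eq_sum_Icc] at this
  push_cast at this
  simpa only [one_div] using this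

lemma sum_divisors_le (h : ℕ) : ∑ g ∈ h.divisors, (g : ℝ) ≤ h * (1 + Real.log h) := by
  calc ∑ g ∈ h.divisors, (g : ℝ) = ∑ g ∈ h.divisors, ((h / g : ℕ) : ℝ) :=
        (Nat.sum_div_divisors h fun g => (g : ℝ)).symm
    _ ≤ ∑ g ∈ h.divisors, (h : ℝ) * (1 / g) := by
        refine Finset.sum_le_sum fun g _ => ?_
        rw [mul_one_div]
        exact Nat.cast_div_le
    _ = h * ∑ g ∈ h.divisors, (1 : ℝ) / g := by rw [Finset.mul_sum]
    _ ≤ h * ∑ g ∈ Finset.Icc 1 h, (1 : ℝ) / g := by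
        gcongr
        intro g hg
        exact Finset.mem_Icc.mpr ⟨Nat.pos_of_mem_divisors hg, Nat.divisor_le hg⟩
    _ ≤ _ := by
        gcongr
        exact sum_Icc_one_div_le h

lemma sum_gcd_sq_le {h : ℕ} (hh : 1 ≤ h) (c : ℕ) :
    ∑ h' ∈ Finset.Icc 1 (c * h), (Nat.gcd h h' : ℝ) ^ 2
      ≤ c * (h : ℝ) ^ 2 * (1 + Real.log h) := by
  calc ∑ h' ∈ Finset.Icc 1 (c * h), (Nat.gcd h h' : ℝ) ^ 2
      ≤ ∑ h' ∈ Finset.Icc 1 (c * h), ∑ g ∈ h.divisors, if g ∣ h' then (g : ℝ) ^ 2 else 0 := by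
        refine Finset.sum_le_sum fun h' _ => ?_
        have hmem : Nat.gcd h h' ∈ h.divisors :=
          Nat.mem_divisors.mpr ⟨Nat.gcd_dvd_left _ _, by omega⟩
        refine le_trans (le_of_eq ?_) (Finset.single_le_sum
          (f := fun g : ℕ => if g ∣ h' then (g : ℝ) ^ 2 else 0) (fun g _ => ?_) hmem)
        · simp only [Nat.gcd_dvd_right, if_true]
        · split_ifs <;> positivity
    _ = ∑ g ∈ h.divisors, ∑ h' ∈ Finset.Icc 1 (c * h), if g ∣ h' then (g : ℝ) ^ 2 else 0 :=
        Finset.sum_comm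
    _ ≤ ∑ g ∈ h.divisors, c * (h : ℝ) * g := by
        refine Finset.sum_le_sum fun g hg => ?_
        have hg0 : (0 : ℝ) < g := by exact_mod_cast Nat.pos_of_mem_divisors hg
        rw [← Finset.sum_filter, Finset.sum_const, nsmul_eq_mul,
          show Finset.Icc 1 (c * h) = Finset.Ioc 0 (c * h) from rfl,
          Nat.Ioc_filter_dvd_card_eq_div]
        have h1 : ((c * h / g : ℕ) : ℝ) ≤ c * h / g := by
          have := Nat.cast_div_le (α := ℝ) (m := c * h) (n := g)
          push_cast at this
          exact this
        calc ((c * h / g : ℕ) : ℝ) * (g : ℝ) ^ 2 ≤ c * h / g * (g : ℝ) ^ 2 := by gcongr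
          _ = c * (h : ℝ) * g := by field_simp
    _ = c * (h : ℝ) * ∑ g ∈ h.divisors, (g : ℝ) := by rw [Finset.mul_sum]
    _ ≤ c * (h : ℝ) * (h * (1 + Real.log h)) := by
        gcongr
        exact sum_divisors_le h
    _ = _ := by ring

lemma near_of_abs_sqrt_sub_le {N a a' h h' : ℕ} {T : ℝ} (hN : 1 ≤ N) (hh : 1 ≤ h)
    (ha : a ∈ Finset.Icc (N + 1) (2 * N)) (ha' : a' ∈ Finset.Icc (N + 1) (2 * N)) (hTN : T ≤ N)
    (hnear : |h * √(a : ℝ) - h' * √(a' : ℝ)| * √(N : ℝ) ≤ T) :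
    h' ≤ 3 * h ∧ |(h : ℝ) ^ 2 * a - (h' : ℝ) ^ 2 * a'| ≤ 4 * T * h := by
  rw [Finset.mem_Icc] at ha ha'
  have hNR : (0 : ℝ) < N := by exact_mod_cast hN
  have hhR : (1 : ℝ) ≤ h := by exact_mod_cast hh
  have haR : (a : ℝ) ≤ 2 * N := by exact_mod_cast ha.2
  have haR' : (N : ℝ) ≤ a' := by exact_mod_cast (by omega : N ≤ a')
  set r := √(N : ℝ) with hr
  set s := √(a : ℝ) with hs
  set s' := √(a' : ℝ) with hs'
  have hr0 : 0 < r := Real.sqrt_pos.mpr hNR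
  have hs0 : 0 ≤ s := Real.sqrt_nonneg _
  have hrr : r * r = N := Real.mul_self_sqrt hNR.le
  have hss : s * s = a := Real.mul_self_sqrt (Nat.cast_nonneg _)
  have hss' : s' * s' = a' := Real.mul_self_sqrt (Nat.cast_nonneg _)
  have hsr : s ≤ 3 / 2 * r := by nlinarith
  have hsr' : r ≤ s' := Real.sqrt_le_sqrt haR'
  set x := h * s - h' * s' with hx
  have hxr : |x| ≤ r := by
    have : |x| * r ≤ r * r := by linarith
    exact le_of_mul_le_mul_right this hr0
  have hh's : h' * s' ≤ h * s + |x| := by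
    have := neg_abs_le x
    linarith
  have hh's0 : 0 ≤ h' * s' := mul_nonneg (Nat.cast_nonneg _) (Real.sqrt_nonneg _)
  have hhs : h * s ≤ 3 / 2 * h * r := by nlinarith
  constructor
  · have h1 : (h' : ℝ) * r ≤ (3 / 2 * h + 1) * r := by
      have : (h' : ℝ) * r ≤ h' * s' := by gcongr
      linarith
    have h2 : (h' : ℝ) ≤ 3 * h := by
      have := le_of_mul_le_mul_right h1 hr0
      linarith
    exact_mod_cast h2
  · have hfac : (h : ℝ) ^ 2 * a - (h' : ℝ) ^ 2 * a' = x * (h * s + h' * s') := by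
      rw [hx]
      linear_combination (-(h : ℝ) ^ 2) * hss + (h' : ℝ) ^ 2 * hss'
    have hsum : h * s + h' * s' ≤ 4 * h * r := by nlinarith
    have hsum0 : 0 ≤ h * s + h' * s' := by positivity
    rw [hfac, abs_mul, abs_of_nonneg hsum0]
    calc |x| * (h * s + h' * s') ≤ |x| * (4 * h * r) := by gcongr
      _ = 4 * h * (|x| * r) := by ring
      _ ≤ 4 * h * T := by gcongr
      _ = _ := by ring

/-- The frequencies `h √a / d` are well spaced on average at the scale `1 / √N`. -/
lemma sum_exp_neg_sq_sub_le {N d K h : ℕ} {M : ℝ} (hN : 1 ≤ N) (hd : 1 ≤ d) (hh : 1 ≤ h)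
    (hhK : h ≤ K) (hM : 1 + Real.log (N * K) ≤ M) (hdM : d * M ≤ N) :
    ∑ h' ∈ Finset.Icc 1 K, ∑ a ∈ Finset.Icc (N + 1) (2 * N), ∑ a' ∈ Finset.Icc (N + 1) (2 * N),
        Real.exp (-((2 * π * h * √(a : ℝ) / d - 2 * π * h' * √(a' : ℝ) / d) ^ 2 * N / 2))
      ≤ 60 * (d * M) * (N + (h : ℝ) ^ 2) := by
  have hNR : (1 : ℝ) ≤ N := by exact_mod_cast hN
  have hdR : (1 : ℝ) ≤ d := by exact_mod_cast hd
  have hhR : (1 : ℝ) ≤ h := by exact_mod_cast hh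
  have hhKR : (h : ℝ) ≤ K := by exact_mod_cast hhK
  have hKR : (1 : ℝ) ≤ K := hhR.trans hhKR
  have hpi := Real.pi_gt_three
  have hNK : (1 : ℝ) ≤ N * K := by nlinarith
  have hlogNK := Real.log_nonneg hNK
  have hM1 : 1 ≤ M := by linarith
  have hlogh : 1 + Real.log h ≤ M := by
    have : Real.log h ≤ Real.log (N * K) := Real.log_le_log (by linarith) (by nlinarith)
    linarith
  set T := d * M with hT
  have hT1 : 1 ≤ T := by nlinarith
  have hMT : M ≤ T := by nlinarith
  set I := Finset.Icc (N + 1) (2 * N) with hI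
  have hIcard : I.card = N := by
    rw [hI, Nat.card_Icc]
    omega
  set S : ℕ → Finset (ℕ × ℕ) := fun h' => (I ×ˢ I).filter fun x : ℕ × ℕ =>
        |(h : ℝ) ^ 2 * x.1 - (h' : ℝ) ^ 2 * x.2| ≤ 4 * T * h with hS
  have hpoint : ∀ h' : ℕ, ∀ a ∈ I, ∀ a' ∈ I,
      Real.exp (-((2 * π * h * √(a : ℝ) / d - 2 * π * h' * √(a' : ℝ) / d) ^ 2 * N / 2))
        ≤ (if h' ≤ 3 * h then
            (if |(h : ℝ) ^ 2 * a - (h' : ℝ) ^ 2 * a'| ≤ 4 * T * h then 1 else 0) else 0)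
          + 1 / ((N : ℝ) ^ 2 * K) := by
    intro h' a ha a' ha'
    by_cases hnear : |h * √(a : ℝ) - h' * √(a' : ℝ)| * √(N : ℝ) ≤ T
    · obtain ⟨h1, h2⟩ := near_of_abs_sqrt_sub_le hN hh ha ha' hdM hnear
      rw [if_pos h1, if_pos h2]
      have h3 : Real.exp
          (-((2 * π * h * √(a : ℝ) / d - 2 * π * h' * √(a' : ℝ) / d) ^ 2 * N / 2)) ≤ 1 := by
        rw [Real.exp_le_one_iff]
        have : 0 ≤ (2 * π * h * √(a : ℝ) / d - 2 * π * h' * √(a' : ℝ) / d) ^ 2 * N / 2 := by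
          positivity
        linarith
      have : 0 ≤ 1 / ((N : ℝ) ^ 2 * K) := by positivity
      linarith
    · push Not at hnear
      have hnn : (0 : ℝ) ≤ if h' ≤ 3 * h then
            (if |(h : ℝ) ^ 2 * a - (h' : ℝ) ^ 2 * a'| ≤ 4 * T * h then 1 else 0) else 0 := by
        split_ifs <;> norm_num
      refine le_trans ?_ (le_add_of_nonneg_left hnn)
      rw [one_div, ← Real.exp_log (by positivity : 0 < ((N : ℝ) ^ 2 * K)⁻¹), Real.exp_le_exp,
        Real.log_inv, neg_le_neg_iff]
      have hlog : Real.log ((N : ℝ) ^ 2 * K) ≤ 2 * M := by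
        have : Real.log ((N : ℝ) ^ 2 * K) ≤ Real.log (((N : ℝ) * K) ^ 2) := by
          refine Real.log_le_log (by positivity) ?_
          rw [mul_pow]
          gcongr
          nlinarith
        rw [Real.log_pow] at this
        push_cast at this
        linarith
      have hsq : T ^ 2 ≤ (h * √(a : ℝ) - h' * √(a' : ℝ)) ^ 2 * N := by
        have h1 : T ^ 2 ≤ (|h * √(a : ℝ) - h' * √(a' : ℝ)| * √(N : ℝ)) ^ 2 :=
          pow_le_pow_left₀ (by linarith) hnear.le 2
        rwa [mul_pow |_|, sq_abs, Real.sq_sqrt (Nat.cast_nonneg _)] at h1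
      have hsq' : M ^ 2 ≤ (h * √(a : ℝ) - h' * √(a' : ℝ)) ^ 2 * N / (d : ℝ) ^ 2 := by
        rw [le_div_iff₀ (by positivity)]
        calc M ^ 2 * (d : ℝ) ^ 2 = T ^ 2 := by rw [hT]; ring
          _ ≤ _ := hsq
      have heq : (2 * π * h * √(a : ℝ) / d - 2 * π * h' * √(a' : ℝ) / d) ^ 2 * N / 2
          = 2 * π ^ 2 * ((h * √(a : ℝ) - h' * √(a' : ℝ)) ^ 2 * N / (d : ℝ) ^ 2) := by
        field_simp
      rw [heq]
      have hX : 2 * M ≤ 2 * M ^ 2 := by nlinarith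
      have hX' := mul_le_mul_of_nonneg_left hsq' (by positivity : 0 ≤ 2 * π ^ 2)
      have hpi2 : 2 * M ^ 2 ≤ 2 * π ^ 2 * M ^ 2 := by
        gcongr
        nlinarith
      linarith
  have hsum : ∀ h' : ℕ, ∑ a ∈ I, ∑ a' ∈ I,
      Real.exp (-((2 * π * h * √(a : ℝ) / d - 2 * π * h' * √(a' : ℝ) / d) ^ 2 * N / 2))
        ≤ (if h' ≤ 3 * h then ((S h').card : ℝ) else 0) + 1 / K := by
    intro h'
    refine (Finset.sum_le_sum fun a ha => Finset.sum_le_sum fun a' ha' =>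
      hpoint h' a ha a' ha').trans (le_of_eq ?_)
    simp_rw [Finset.sum_add_distrib, Finset.sum_const, hIcard, nsmul_eq_mul]
    congr 1
    · split_ifs
      · rw [hS]
        simp only
        rw [Finset.card_filter, Finset.sum_product]
        push_cast
        rfl
      · simp
    · field_simp
  have hcount : ∀ h' ∈ Finset.Icc 1 (3 * h), ((S h').card : ℝ) ≤
      16 * T * N / h + 20 * T * h + N * (Nat.gcd h h' : ℝ) ^ 2 / (h : ℝ) ^ 2 := by
    intro h' hh'
    refine (card_filter_abs_sq_mul_sub_le N hh (by positivity)).trans ?_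
    have hg1 : (1 : ℝ) ≤ Nat.gcd h h' := by
      exact_mod_cast Nat.gcd_pos_of_pos_left _ hh
    set g : ℝ := (Nat.gcd h h' : ℝ) with hg
    have h1 : 1 / g ^ 2 ≤ 1 := by
      rw [div_le_one (by positivity)]
      nlinarith
    calc (2 * (4 * T * h) / g ^ 2 + 1) * (N * g ^ 2 / (h : ℝ) ^ 2 + 2)
        = 8 * T * N / h + 16 * T * h * (1 / g ^ 2) + 2 + N * g ^ 2 / (h : ℝ) ^ 2 := by
          field_simp
          ring
      _ ≤ 8 * T * N / h + 16 * T * h * 1 + 2 + N * g ^ 2 / (h : ℝ) ^ 2 := by gcongr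
      _ ≤ _ := by
          have h2 : 0 ≤ T * N / h := by positivity
          have h3 : 1 ≤ T * h := by nlinarith
          have h4 : 8 * T * N / h = 8 * (T * N / h) := by ring
          have h5 : 16 * T * N / h = 16 * (T * N / h) := by ring
          rw [h4, h5]
          linarith
  calc _ ≤ ∑ h' ∈ Finset.Icc 1 K, ((if h' ≤ 3 * h then ((S h').card : ℝ) else 0) + 1 / K) :=
        Finset.sum_le_sum fun h' _ => hsum h'
    _ = ∑ h' ∈ (Finset.Icc 1 K).filter (· ≤ 3 * h), ((S h').card : ℝ) + 1 := by
        rw [Finset.sum_add_distrib, Finset.sum_filter, Finset.sum_const, Nat.card_Icc,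
          nsmul_eq_mul, Nat.add_sub_cancel, mul_one_div_cancel (by positivity)]
    _ ≤ ∑ h' ∈ Finset.Icc 1 (3 * h), ((S h').card : ℝ) + 1 := by
        gcongr
        intro h' hh'
        rw [Finset.mem_filter, Finset.mem_Icc] at hh'
        exact Finset.mem_Icc.mpr ⟨hh'.1.1, hh'.2⟩
    _ ≤ ∑ h' ∈ Finset.Icc 1 (3 * h),
          (16 * T * N / h + 20 * T * h + N * (Nat.gcd h h' : ℝ) ^ 2 / (h : ℝ) ^ 2) + 1 := by
        gcongr with h' hh'
        exact hcount h' hh'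
    _ = 3 * h * (16 * T * N / h + 20 * T * h)
          + N / (h : ℝ) ^ 2 * ∑ h' ∈ Finset.Icc 1 (3 * h), (Nat.gcd h h' : ℝ) ^ 2 + 1 := by
        rw [Finset.sum_add_distrib, Finset.sum_const, Nat.card_Icc, nsmul_eq_mul,
          Nat.add_sub_cancel, Finset.mul_sum]
        push_cast
        congr 2
        refine Finset.sum_congr rfl fun h' _ => ?_
        ring
    _ ≤ 3 * h * (16 * T * N / h + 20 * T * h)
          + N / (h : ℝ) ^ 2 * (3 * (h : ℝ) ^ 2 * (1 + Real.log h)) + 1 := by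
        gcongr
        exact_mod_cast sum_gcd_sq_le hh 3
    _ = 48 * T * N + 60 * T * (h : ℝ) ^ 2 + 3 * N * (1 + Real.log h) + 1 := by
        field_simp
        ring
    _ ≤ 60 * T * (N + (h : ℝ) ^ 2) := by
        have h1 : (N : ℝ) * (1 + Real.log h) ≤ N * T := by
          gcongr
          linarith
        have h2 : 1 ≤ T * N := by nlinarith
        nlinarith

lemma sum_abs_mul_abs_mul_le {ι : Type*} (s : Finset ι) (c : ι → ℝ) (E : ι → ι → ℝ)
    (hE : ∀ p q, 0 ≤ E p q) (hsymm : ∀ p q, E p q = E q p) :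
    ∑ p ∈ s, ∑ q ∈ s, |c p| * |c q| * E p q ≤ ∑ p ∈ s, c p ^ 2 * ∑ q ∈ s, E p q := by
  have h1 : ∑ p ∈ s, ∑ q ∈ s, |c p| * |c q| * E p q
      ≤ ∑ p ∈ s, ∑ q ∈ s, (c p ^ 2 * E p q / 2 + c q ^ 2 * E p q / 2) := by
    refine Finset.sum_le_sum fun p _ => Finset.sum_le_sum fun q _ => ?_
    have h2 : |c p| * |c q| ≤ (c p ^ 2 + c q ^ 2) / 2 := by
      rw [← sq_abs (c p), ← sq_abs (c q)]
      nlinarith [sq_nonneg (|c p| - |c q|)]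
    calc |c p| * |c q| * E p q ≤ (c p ^ 2 + c q ^ 2) / 2 * E p q :=
          mul_le_mul_of_nonneg_right h2 (hE p q)
      _ = _ := by ring
  have h3 : ∑ p ∈ s, ∑ q ∈ s, c q ^ 2 * E p q / 2 = ∑ p ∈ s, ∑ q ∈ s, c p ^ 2 * E p q / 2 := by
    rw [Finset.sum_comm]
    refine Finset.sum_congr rfl fun p _ => Finset.sum_congr rfl fun q _ => ?_
    rw [hsymm]
  refine h1.trans (le_of_eq ?_)
  simp_rw [Finset.sum_add_distrib]
  rw [h3, ← Finset.sum_add_distrib]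
  refine Finset.sum_congr rfl fun p _ => ?_
  rw [← Finset.sum_add_distrib, Finset.mul_sum]
  refine Finset.sum_congr rfl fun q _ => ?_
  ring

/-- The trigonometric polynomial in `u` that bounds the contribution of `b = u²` to
`remTerm A B Δ d`, where `D = Δ / d` and `k` is the smoothing length divided by `d`. -/
noncomputable def smoothSum (A : Finset ℕ) (D k : ℝ) (d K : ℕ) (u : ℝ) : ℝ :=
  ∑ p ∈ Finset.Icc 1 K ×ˢ A, smoothCoeff D k p.1 *
    Real.cos (2 * π * p.1 * √(p.2 : ℝ) / d * u + π * p.1 * k)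

lemma sum_smoothCoeff_sq_mul_le {N d K : ℕ} {A : Finset ℕ} {D k M : ℝ} (hN : 1 ≤ N) (hd : 1 ≤ d)
    (hk : 0 < k) (hK : 1 ≤ K) (hM : 1 + Real.log (N * K) ≤ M) (hdM : d * M ≤ N)
    (hA : A ⊆ Finset.Icc (N + 1) (2 * N)) :
    ∑ p ∈ Finset.Icc 1 K ×ˢ A, smoothCoeff D k p.1 ^ 2 * ∑ q ∈ Finset.Icc 1 K ×ˢ A,
        Real.exp (-((2 * π * p.1 * √(p.2 : ℝ) / d - 2 * π * q.1 * √(q.2 : ℝ) / d) ^ 2 * N / 2))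
      ≤ 60 * (d * M) * (N * (4 * (|D| + k)) + 1 / k) * M := by
  have hNR : (1 : ℝ) ≤ N := by exact_mod_cast hN
  have hKR : (1 : ℝ) ≤ K := by exact_mod_cast hK
  have hlogK : Real.log K ≤ Real.log (N * K) := Real.log_le_log (by linarith) (by nlinarith)
  have hlogK0 := Real.log_nonneg hKR
  have hM0 : 0 ≤ M := by linarith
  set I := Finset.Icc (N + 1) (2 * N) with hI
  set E : ℕ × ℕ → ℕ × ℕ → ℝ := fun p q => Real.exp (-((2 * π * p.1 * √(p.2 : ℝ) / d
    - 2 * π * q.1 * √(q.2 : ℝ) / d) ^ 2 * N / 2)) with hE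
  have hE0 : ∀ p q, 0 ≤ E p q := fun p q => (Real.exp_pos _).le
  calc ∑ p ∈ Finset.Icc 1 K ×ˢ A, smoothCoeff D k p.1 ^ 2 * ∑ q ∈ Finset.Icc 1 K ×ˢ A, E p q
      ≤ ∑ p ∈ Finset.Icc 1 K ×ˢ I, smoothCoeff D k p.1 ^ 2 *
          ∑ q ∈ Finset.Icc 1 K ×ˢ I, E p q := by
        have hsub : Finset.Icc 1 K ×ˢ A ⊆ Finset.Icc 1 K ×ˢ I :=
          Finset.product_subset_product_right hA
        refine (Finset.sum_le_sum fun p _ => mul_le_mul_of_nonneg_left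
          (Finset.sum_le_sum_of_subset_of_nonneg hsub fun q _ _ => hE0 p q)
          (sq_nonneg _)).trans ?_
        exact Finset.sum_le_sum_of_subset_of_nonneg hsub fun p _ _ =>
          mul_nonneg (sq_nonneg _) (Finset.sum_nonneg fun q _ => hE0 p q)
    _ = ∑ h ∈ Finset.Icc 1 K, smoothCoeff D k h ^ 2 *
          ∑ h' ∈ Finset.Icc 1 K, ∑ a ∈ I, ∑ a' ∈ I, E (h, a) (h', a') := by
        rw [Finset.sum_product]
        refine Finset.sum_congr rfl fun h _ => ?_
        dsimp only
        rw [← Finset.mul_sum]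
        simp_rw [Finset.sum_product]
        rw [Finset.sum_comm]
    _ ≤ ∑ h ∈ Finset.Icc 1 K, 60 * (d * M) * ((N * (4 * (|D| + k)) + 1 / k) * (1 / h)) := by
        refine Finset.sum_le_sum fun h hh => ?_
        obtain ⟨hh1, hhK⟩ := Finset.mem_Icc.mp hh
        refine (mul_le_mul_of_nonneg_left
          (sum_exp_neg_sq_sub_le hN hd hh1 hhK hM hdM) (sq_nonneg _)).trans ?_
        have h1 := smoothCoeff_sq_le D hk hh1
        have h2 := smoothCoeff_sq_mul_sq_le D hk hh1
        have h3 : smoothCoeff D k h ^ 2 * (N + (h : ℝ) ^ 2)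
            ≤ (N * (4 * (|D| + k)) + 1 / k) * (1 / h) := by
          have := mul_le_mul_of_nonneg_left h1 (by linarith : 0 ≤ (N : ℝ))
          linarith
        calc smoothCoeff D k h ^ 2 * (60 * (d * M) * (N + (h : ℝ) ^ 2))
            = 60 * (d * M) * (smoothCoeff D k h ^ 2 * (N + (h : ℝ) ^ 2)) := by ring
          _ ≤ _ := mul_le_mul_of_nonneg_left h3 (by positivity)
    _ = 60 * (d * M) * (N * (4 * (|D| + k)) + 1 / k) * ∑ h ∈ Finset.Icc 1 K, (1 : ℝ) / h := by
        rw [Finset.mul_sum]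
        refine Finset.sum_congr rfl fun h _ => ?_
        ring
    _ ≤ 60 * (d * M) * (N * (4 * (|D| + k)) + 1 / k) * M := by
        have := sum_Icc_one_div_le K
        gcongr
        linarith

lemma exp_one_mul_sqrt_two_pi_mul_le (N : ℕ) :
    Real.exp 1 * √(2 * π * N) ≤ 7 * √(N : ℝ) := by
  have h1 : √(2 * π * N) ≤ 2.56 * √(N : ℝ) := by
    rw [Real.sqrt_le_left (by positivity), mul_pow, Real.sq_sqrt (Nat.cast_nonneg _)]
    have := Real.pi_lt_d2
    gcongr
    linarith
  have h2 := Real.exp_one_lt_d9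
  calc Real.exp 1 * √(2 * π * N) ≤ 2.73 * (2.56 * √(N : ℝ)) := by
        gcongr
        linarith
    _ ≤ _ := by
        have := Real.sqrt_nonneg (N : ℝ)
        linarith

lemma integral_smoothSum_sq_le {N d K : ℕ} {A : Finset ℕ} {D k M : ℝ} (hN : 1 ≤ N) (hd : 1 ≤ d)
    (hk : 0 < k) (hK : 1 ≤ K) (hM : 1 + Real.log (N * K) ≤ M) (hdM : d * M ≤ N)
    (hA : A ⊆ Finset.Icc (N + 1) (2 * N)) :
    ∫ u in √(N : ℝ)..√(2 * N : ℝ), smoothSum A D k d K u ^ 2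
      ≤ 7 * √(N : ℝ) * (60 * (d * M) * (N * (4 * (|D| + k)) + 1 / k) * M) := by
  have hNR : (1 : ℝ) ≤ N := by exact_mod_cast hN
  have hmv := integral_sq_sum_cos_le (Finset.Icc 1 K ×ˢ A) (fun p => smoothCoeff D k p.1)
    (fun p => 2 * π * p.1 * √(p.2 : ℝ) / d) (fun p => π * p.1 * k) (by linarith : 0 < (N : ℝ))
    (fun p _ => by positivity)
  have hsum := sum_abs_mul_abs_mul_le (Finset.Icc 1 K ×ˢ A) (fun p => smoothCoeff D k p.1)
    (fun p q => Real.exp (-((2 * π * p.1 * √(p.2 : ℝ) / d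
      - 2 * π * q.1 * √(q.2 : ℝ) / d) ^ 2 * N / 2))) (fun p q => (Real.exp_pos _).le)
    (fun p q => by rw [← neg_sub, neg_sq])
  refine hmv.trans (mul_le_mul (exp_one_mul_sqrt_two_pi_mul_le N)
    (hsum.trans (sum_smoothCoeff_sq_mul_le hN hd hk hK hM hdM hA)) ?_ (by positivity))
  exact Finset.sum_nonneg fun p _ => Finset.sum_nonneg fun q _ => by positivity

lemma remTerm_le_sum_smoothSum {N d K : ℕ} {A B : Finset ℕ} {Δ κ σ : ℝ} (hN : 1 ≤ N) (hd : 1 ≤ d)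
    (hκ : 0 < κ) (hK1 : 1 ≤ K) (hK : (d : ℝ) ^ 2 / κ ^ 2 ≤ K)
    (hA : A ⊆ Finset.Icc (N + 1) (2 * N)) (hσ0 : 0 ≤ σ) (hσ : σ ≤ κ / √(2 * N : ℝ)) :
    remTerm A B Δ d ≤ ∑ b ∈ B, smoothSum A (Δ / d) (κ / d) d K (√(b : ℝ) - σ)
      + 5 * κ * A.card * B.card / d := by
  have hNR : (1 : ℝ) ≤ N := by exact_mod_cast hN
  have hdR : (1 : ℝ) ≤ d := by exact_mod_cast hd
  have hd0 : (0 : ℝ) < d := by linarith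
  have hpt : ∀ a ∈ A, ∀ b ∈ B,
      psiSaw ((√((a : ℝ) * b) - Δ) / d) - psiSaw ((√((a : ℝ) * b) + Δ) / d)
        ≤ ∑ h ∈ Finset.Icc 1 K, smoothCoeff (Δ / d) (κ / d) h *
            Real.cos (2 * π * h * √(a : ℝ) / d * (√(b : ℝ) - σ) + π * h * (κ / d))
          + 5 * (κ / d) := by
    intro a ha b _
    have haN := (Finset.mem_Icc.mp (hA ha)).2
    have hsa : √(a : ℝ) ≤ √(2 * N : ℝ) := Real.sqrt_le_sqrt (by exact_mod_cast haN)
    have hr : 0 < √(2 * N : ℝ) := Real.sqrt_pos.mpr (by linarith)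
    have hek : √(a : ℝ) * σ / d ≤ κ / d := by
      gcongr
      calc √(a : ℝ) * σ ≤ √(2 * N : ℝ) * (κ / √(2 * N : ℝ)) := by gcongr
        _ = κ := by field_simp
    have hmain := psiSaw_sub_psiSaw_le (Δ / d) (√(a : ℝ) * (√(b : ℝ) - σ) / d)
      (k := κ / d) (e := √(a : ℝ) * σ / d) (K := K) (by positivity) (by positivity) hek hK1
      (by rw [div_pow, one_div_div]; exact hK)
    rw [Real.sqrt_mul (Nat.cast_nonneg _)]
    convert hmain using 2
    · congr 1; ring
    · congr 1; ring
    · refine Finset.sum_congr rfl fun h _ => ?_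
      congr 2
      ring
  calc remTerm A B Δ d
      ≤ ∑ a ∈ A, ∑ b ∈ B, (∑ h ∈ Finset.Icc 1 K, smoothCoeff (Δ / d) (κ / d) h *
            Real.cos (2 * π * h * √(a : ℝ) / d * (√(b : ℝ) - σ) + π * h * (κ / d))
          + 5 * (κ / d)) :=
        Finset.sum_le_sum fun a ha => Finset.sum_le_sum fun b hb => hpt a ha b hb
    _ = _ := by
        simp_rw [Finset.sum_add_distrib, Finset.sum_const, nsmul_eq_mul]
        congr 1
        · rw [Finset.sum_comm]
          refine Finset.sum_congr rfl fun b _ => ?_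
          rw [smoothSum, Finset.sum_product, Finset.sum_comm]
        · ring

/-- The explicit upper bound for the remainder term, valid for `Δ` of either sign. -/
lemma remTerm_le {N d K : ℕ} {A B : Finset ℕ} {Δ κ M : ℝ} (hN : 1 ≤ N) (hd : 1 ≤ d)
    (hκ : 0 < κ) (hκ2 : κ ≤ 1 / 2) (hK : (d : ℝ) ^ 2 / κ ^ 2 ≤ K)
    (hM : 1 + Real.log (N * K) ≤ M) (hdM : d * M ≤ N)
    (hA : A ⊆ Finset.Icc (N + 1) (2 * N)) (hB : B ⊆ Finset.Icc (N + 1) (2 * N)) :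
    remTerm A B Δ d ≤ 5 * κ * A.card * B.card / d
      + √(600 * B.card * N * M ^ 2 * (4 * N * (|Δ| + κ) + (d : ℝ) ^ 2 / κ) / κ) := by
  have hNR : (1 : ℝ) ≤ N := by exact_mod_cast hN
  have hdR : (1 : ℝ) ≤ d := by exact_mod_cast hd
  have hd0 : (0 : ℝ) < d := by linarith
  have hK1 : 1 ≤ K := by
    have h1 : (0 : ℝ) < K := lt_of_lt_of_le (by positivity) hK
    exact_mod_cast h1
  set r := √(N : ℝ) with hr
  set r2 := √(2 * N : ℝ) with hr2
  have hr0 : 0 < r := Real.sqrt_pos.mpr (by linarith)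
  have hr20 : 0 < r2 := Real.sqrt_pos.mpr (by linarith)
  have hrr2 : r2 ≤ √2 * r := by rw [hr2, Real.sqrt_mul (by norm_num)]
  set F := smoothSum A (Δ / d) (κ / d) d K with hF
  have hFcont : Continuous F := by
    have : F = fun u => ∑ p ∈ Finset.Icc 1 K ×ˢ A, smoothCoeff (Δ / d) (κ / d) p.1 *
      Real.cos (2 * π * p.1 * √(p.2 : ℝ) / d * u + π * p.1 * (κ / d)) := rfl
    rw [this]
    fun_prop
  set R := remTerm A B Δ d - 5 * κ * A.card * B.card / d with hR
  suffices hmain : R ≤ √(600 * B.card * N * M ^ 2 * (4 * N * (|Δ| + κ) + (d : ℝ) ^ 2 / κ) / κ) by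
    linarith
  rcases le_or_gt R 0 with hRneg | hRpos
  · exact hRneg.trans (Real.sqrt_nonneg _)
  apply Real.le_sqrt_of_sq_le
  set κ' := κ / r2 with hκ'
  have hκ'0 : 0 < κ' := by positivity
  have hpt : ∀ σ ∈ Set.Icc 0 κ', R ^ 2 ≤ B.card *
      ∑ b ∈ Finset.Icc (N + 1) (2 * N), F (√(b : ℝ) - σ) ^ 2 := by
    intro σ hσ
    have h1 : R ≤ ∑ b ∈ B, F (√(b : ℝ) - σ) := by
      have := remTerm_le_sum_smoothSum (B := B) (Δ := Δ) hN hd hκ hK1 hK hA hσ.1 hσ.2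
      linarith
    calc R ^ 2 ≤ (∑ b ∈ B, F (√(b : ℝ) - σ)) ^ 2 := by gcongr
      _ ≤ B.card * ∑ b ∈ B, F (√(b : ℝ) - σ) ^ 2 := sq_sum_le_card_mul_sum_sq
      _ ≤ _ := by
          gcongr
  have hInt : κ' * R ^ 2 ≤ B.card * ∫ u in r..r2, F u ^ 2 := by
    calc κ' * R ^ 2 = ∫ _ in (0 : ℝ)..κ', R ^ 2 := by simp
      _ ≤ ∫ σ in (0 : ℝ)..κ', (B.card : ℝ) *
            ∑ b ∈ Finset.Icc (N + 1) (2 * N), F (√(b : ℝ) - σ) ^ 2 :=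
          intervalIntegral.integral_mono_on hκ'0.le (by simp)
            (Continuous.intervalIntegrable (by fun_prop) _ _) hpt
      _ = B.card * ∑ b ∈ Finset.Icc (N + 1) (2 * N), ∫ σ in (0 : ℝ)..κ', F (√(b : ℝ) - σ) ^ 2 := by
          rw [intervalIntegral.integral_const_mul, intervalIntegral.integral_finsetSum]
          exact fun b _ => Continuous.intervalIntegrable (by fun_prop) _ _
      _ ≤ B.card * ∑ i ∈ Finset.Ico N (2 * N),
            ∫ u in √(i : ℝ)..√((i + 1 : ℕ) : ℝ), F u ^ 2 := by
          gcongr ?_ * ?_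
          rw [show Finset.Icc (N + 1) (2 * N) = Finset.Ico (N + 1) (2 * N + 1) from rfl,
            ← Finset.sum_Ico_add']
          refine Finset.sum_le_sum fun i hi => ?_
          rw [intervalIntegral.integral_comp_sub_left (fun u => F u ^ 2), sub_zero]
          have hi2 : i + 1 ≤ 2 * N := by
            have := (Finset.mem_Ico.mp hi).2
            omega
          set x := √(i : ℝ) with hx
          set y := √((i + 1 : ℕ) : ℝ) with hy
          have hx0 : 0 ≤ x := Real.sqrt_nonneg _
          have hxx : x * x = i := Real.mul_self_sqrt (Nat.cast_nonneg _)
          have hyy : y * y = i + 1 := by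
            rw [hy, Real.mul_self_sqrt (Nat.cast_nonneg _)]
            push_cast
            rfl
          have hyr : y ≤ r2 := Real.sqrt_le_sqrt (by exact_mod_cast hi2)
          have hxy : x ≤ y := Real.sqrt_le_sqrt (by push_cast; linarith)
          have hgap : κ' ≤ y - x := by
            rw [hκ', div_le_iff₀ hr20]
            have h1 : (y - x) * (y + x) = 1 := by linear_combination hyy - hxx
            have h2 : (y - x) * (y + x) ≤ (y - x) * (2 * r2) :=
              mul_le_mul_of_nonneg_left (by linarith) (by linarith)
            linarith
          refine intervalIntegral.integral_mono_interval (by linarith) (by linarith) le_rfl ?_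
            (Continuous.intervalIntegrable (by fun_prop) _ _)
          exact Filter.Eventually.of_forall fun u => sq_nonneg _
      _ = B.card * ∫ u in r..r2, F u ^ 2 := by
          rw [intervalIntegral.sum_integral_adjacent_intervals_Ico
            (a := fun i : ℕ => √(i : ℝ)) (by omega)
            fun i _ => Continuous.intervalIntegrable (by fun_prop) _ _]
          push_cast
          rfl
  have hmv := integral_smoothSum_sq_le (D := Δ / d) (k := κ / d) hN hd (by positivity) hK1 hM hdM hA
  rw [← hF, ← hr, ← hr2] at hmv
  have hW : 60 * (d * M) * (N * (4 * (|Δ / d| + κ / d)) + 1 / (κ / d)) * M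
      = 60 * M ^ 2 * (4 * N * (|Δ| + κ) + (d : ℝ) ^ 2 / κ) := by
    rw [abs_div, abs_of_pos hd0]
    field_simp
  rw [hW] at hmv
  set W := 4 * N * (|Δ| + κ) + (d : ℝ) ^ 2 / κ with hWdef
  have hW0 : 0 ≤ W := by positivity
  rw [le_div_iff₀ hκ]
  have h1 : κ * R ^ 2 ≤ r2 * (B.card * (7 * r * (60 * M ^ 2 * W))) := by
    have h2 : κ' * R ^ 2 ≤ B.card * (7 * r * (60 * M ^ 2 * W)) :=
      hInt.trans (mul_le_mul_of_nonneg_left hmv (Nat.cast_nonneg _))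
    calc κ * R ^ 2 = r2 * (κ' * R ^ 2) := by rw [hκ']; field_simp
      _ ≤ _ := mul_le_mul_of_nonneg_left h2 hr20.le
  have hrr : r * r = N := Real.mul_self_sqrt (by linarith)
  have hs2 : √2 ≤ (1.42 : ℝ) := by
    rw [Real.sqrt_le_left (by norm_num)]
    norm_num
  calc R ^ 2 * κ = κ * R ^ 2 := mul_comm _ _
    _ ≤ r2 * (B.card * (7 * r * (60 * M ^ 2 * W))) := h1
    _ ≤ 1.42 * r * (B.card * (7 * r * (60 * M ^ 2 * W))) := by
        gcongr
        exact hrr2.trans (by gcongr)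
    _ = 596.4 * (B.card * (r * r) * M ^ 2 * W) := by ring
    _ ≤ 600 * (B.card * (r * r) * M ^ 2 * W) := by
        gcongr
        norm_num
    _ = _ := by rw [hrr]; ring

lemma remTerm_neg (A B : Finset ℕ) (Δ : ℝ) (d : ℕ) : remTerm A B (-Δ) d = -remTerm A B Δ d := by
  simp_rw [remTerm, ← Finset.sum_neg_distrib]
  refine Finset.sum_congr rfl fun a _ => Finset.sum_congr rfl fun b _ => ?_
  rw [sub_neg_eq_add, ← sub_eq_add_neg]
  ring

lemma remTerm_comm (A B : Finset ℕ) (Δ : ℝ) (d : ℕ) : remTerm A B Δ d = remTerm B A Δ d := by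
  simp_rw [remTerm]
  rw [Finset.sum_comm]
  simp_rw [mul_comm]

lemma abs_remTerm_le {N d K : ℕ} {A B : Finset ℕ} {Δ κ M : ℝ} (hN : 1 ≤ N) (hd : 1 ≤ d)
    (hκ : 0 < κ) (hκ2 : κ ≤ 1 / 2) (hK : (d : ℝ) ^ 2 / κ ^ 2 ≤ K)
    (hM : 1 + Real.log (N * K) ≤ M) (hdM : d * M ≤ N)
    (hA : A ⊆ Finset.Icc (N + 1) (2 * N)) (hB : B ⊆ Finset.Icc (N + 1) (2 * N)) :
    |remTerm A B Δ d| ≤ 5 * κ * A.card * B.card / d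
      + √(600 * B.card * N * M ^ 2 * (4 * N * (|Δ| + κ) + (d : ℝ) ^ 2 / κ) / κ) := by
  have h1 := remTerm_le (Δ := Δ) hN hd hκ hκ2 hK hM hdM hA hB
  have h2 := remTerm_le (Δ := -Δ) hN hd hκ hκ2 hK hM hdM hA hB
  rw [remTerm_neg, abs_neg] at h2
  exact abs_le.mpr ⟨by linarith, h1⟩

lemma eventually_le_natCast_rpow (c : ℝ) {p : ℝ} (hp : 0 < p) :
    ∀ᶠ N : ℕ in Filter.atTop, c ≤ (N : ℝ) ^ p :=
  ((tendsto_rpow_atTop hp).comp tendsto_natCast_atTop_atTop).eventually_ge_atTop c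

lemma eventually_one_add_log_le_natCast_rpow (c : ℝ) {p : ℝ} (hp : 0 < p) :
    ∀ᶠ N : ℕ in Filter.atTop, 1 + c * Real.log N ≤ (N : ℝ) ^ p := by
  have h1 : (fun x : ℝ => c * Real.log x) =o[Filter.atTop] fun x : ℝ => x ^ p :=
    (isLittleO_log_rpow_atTop hp).const_mul_left c
  have h2 := tendsto_natCast_atTop_atTop (R := ℝ) |>.eventually
    (h1.bound (by norm_num : (0 : ℝ) < 1 / 2))
  filter_upwards [h2, eventually_le_natCast_rpow 2 hp] with N hN1 hN2
  rw [Real.norm_eq_abs, Real.norm_eq_abs, abs_of_nonneg (by linarith : (0 : ℝ) ≤ (N : ℝ) ^ p)]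
    at hN1
  have := le_abs_self (c * Real.log N)
  linarith

lemma log_mul_ceil_sq_div_sq_le {N d : ℕ} {κ : ℝ} (hN : 5 ≤ N) (hdN : d ≤ N) (hκ0 : 0 < κ)
    (hκ : 1 / κ ≤ 2 * (N : ℝ) ^ 2) :
    Real.log (N * ⌈(d : ℝ) ^ 2 / κ ^ 2⌉₊) ≤ 8 * Real.log N := by
  have hNR : (5 : ℝ) ≤ N := by exact_mod_cast hN
  have hdR : (d : ℝ) ≤ N := by exact_mod_cast hdN
  rcases Nat.eq_zero_or_pos ⌈(d : ℝ) ^ 2 / κ ^ 2⌉₊ with h0 | hpos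
  · rw [h0, Nat.cast_zero, mul_zero, Real.log_zero]
    exact mul_nonneg (by norm_num) (Real.log_nonneg (by linarith))
  have h1 : (d : ℝ) ^ 2 / κ ^ 2 ≤ 4 * (N : ℝ) ^ 6 := by
    calc (d : ℝ) ^ 2 / κ ^ 2 = (d : ℝ) ^ 2 * (1 / κ) ^ 2 := by ring
      _ ≤ (N : ℝ) ^ 2 * (2 * (N : ℝ) ^ 2) ^ 2 := by gcongr
      _ = _ := by ring
  have h2 : (⌈(d : ℝ) ^ 2 / κ ^ 2⌉₊ : ℝ) ≤ (N : ℝ) ^ 7 := by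
    have h3 := (Nat.ceil_lt_add_one (by positivity : (0 : ℝ) ≤ (d : ℝ) ^ 2 / κ ^ 2)).le
    have h4 : (1 : ℝ) ≤ (N : ℝ) ^ 6 := one_le_pow₀ (by linarith)
    have h5 : 5 * (N : ℝ) ^ 6 ≤ (N : ℝ) ^ 7 := by
      rw [pow_succ (N : ℝ) 6, mul_comm]
      gcongr
    linarith
  have hpos' : (0 : ℝ) < ⌈(d : ℝ) ^ 2 / κ ^ 2⌉₊ := by exact_mod_cast hpos
  calc Real.log (N * ⌈(d : ℝ) ^ 2 / κ ^ 2⌉₊) ≤ Real.log ((N : ℝ) ^ 8) := by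
        apply Real.log_le_log (by positivity)
        rw [pow_succ' (N : ℝ) 7]
        gcongr
    _ = _ := by rw [Real.log_pow]; norm_num

lemma abs_remTerm_rpow_le {N d : ℕ} {A B : Finset ℕ} {δ ε τ C : ℝ} (hN : 5 ≤ N) (hd : 1 ≤ d)
    (hδ0 : 0 < δ) (hδ : δ < 1 / 2) (hε0 : 0 < ε) (hε : ε ≤ 1)
    (hlog : 1 + 8 * Real.log N ≤ (N : ℝ) ^ (ε / 4)) (hdτ : d ≤ C * (N : ℝ) ^ τ)
    (hC1 : C ≤ (N : ℝ) ^ (1 - τ - ε / 4))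
    (hC2 : 2 * C ^ 2 ≤ (N : ℝ) ^ (1 - 2 * δ - ε - 2 * τ))
    (hA : A ⊆ Finset.Icc (N + 1) (2 * N)) (hB : B ⊆ Finset.Icc (N + 1) (2 * N)) :
    |remTerm A B ((N : ℝ) ^ (-δ)) d| ≤ 5 / 2 * (N : ℝ) ^ (-δ - ε) * A.card * B.card / d
      + 104 * √(B.card : ℝ) * (N : ℝ) ^ (1 + 3 * ε / 4) := by
  have hNR : (5 : ℝ) ≤ N := by exact_mod_cast hN
  have hN0 : (0 : ℝ) < N := by linarith
  have hN1 : (1 : ℝ) ≤ N := by linarith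
  have hd0 : (0 : ℝ) < d := by exact_mod_cast hd
  set κ := (N : ℝ) ^ (-δ - ε) / 2 with hκdef
  have hκ0 : 0 < κ := by positivity
  have hκ1 : (N : ℝ) ^ (-δ - ε) ≤ 1 := Real.rpow_le_one_of_one_le_of_nonpos hN1 (by linarith)
  have hκinv : 1 / κ = 2 * (N : ℝ) ^ (δ + ε) := by
    rw [hκdef, one_div_div, div_eq_mul_inv, ← Real.rpow_neg hN0.le]
    congr 2
    ring
  have hdM : d * (N : ℝ) ^ (ε / 4) ≤ N := by
    calc d * (N : ℝ) ^ (ε / 4)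
        ≤ (N : ℝ) ^ (1 - τ - ε / 4) * (N : ℝ) ^ τ * (N : ℝ) ^ (ε / 4) := by
          gcongr
          exact hdτ.trans (by gcongr)
      _ = N := by
          rw [← Real.rpow_add hN0, ← Real.rpow_add hN0]
          ring_nf
          exact Real.rpow_one _
  have hM1 : 1 ≤ (N : ℝ) ^ (ε / 4) := Real.one_le_rpow hN1 (by linarith)
  have hdN : d ≤ N := by
    have : (d : ℝ) ≤ N := by nlinarith
    exact_mod_cast this
  have hlogK : 1 + Real.log (N * ⌈(d : ℝ) ^ 2 / κ ^ 2⌉₊) ≤ (N : ℝ) ^ (ε / 4) := by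
    have h1 : 1 / κ ≤ 2 * (N : ℝ) ^ 2 := by
      rw [hκinv, ← Real.rpow_natCast]
      gcongr 2 * ?_
      refine Real.rpow_le_rpow_of_exponent_le hN1 ?_
      push_cast
      linarith
    have := log_mul_ceil_sq_div_sq_le hN hdN hκ0 h1
    linarith
  have hdκ : (d : ℝ) ^ 2 / κ ≤ N * (N : ℝ) ^ (-δ) := by
    calc (d : ℝ) ^ 2 / κ = (d : ℝ) ^ 2 * (1 / κ) := by ring
      _ ≤ (C * (N : ℝ) ^ τ) ^ 2 * (2 * (N : ℝ) ^ (δ + ε)) := by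
          rw [hκinv]
          gcongr
      _ = 2 * C ^ 2 * ((N : ℝ) ^ τ * (N : ℝ) ^ τ * (N : ℝ) ^ (δ + ε)) := by ring
      _ ≤ (N : ℝ) ^ (1 - 2 * δ - ε - 2 * τ)
            * ((N : ℝ) ^ τ * (N : ℝ) ^ τ * (N : ℝ) ^ (δ + ε)) := by gcongr
      _ = (N : ℝ) ^ (1 + -δ) := by
          rw [← Real.rpow_add hN0, ← Real.rpow_add hN0, ← Real.rpow_add hN0]
          ring_nf
      _ = _ := by rw [Real.rpow_add hN0, Real.rpow_one]
  have hκΔ : κ ≤ (N : ℝ) ^ (-δ) := by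
    have : (N : ℝ) ^ (-δ - ε) ≤ (N : ℝ) ^ (-δ) :=
      Real.rpow_le_rpow_of_exponent_le hN1 (by linarith)
    linarith
  have hmain := abs_remTerm_le (Δ := (N : ℝ) ^ (-δ)) (by omega) hd hκ0 (by linarith)
    (Nat.le_ceil _) hlogK hdM hA hB
  rw [abs_of_pos (by positivity : 0 < (N : ℝ) ^ (-δ))] at hmain
  refine hmain.trans (add_le_add (le_of_eq ?_) ?_)
  · rw [hκdef]
    ring
  rw [Real.sqrt_le_left (by positivity), mul_pow, mul_pow, Real.sq_sqrt (Nat.cast_nonneg _)]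
  calc 600 * (B.card : ℝ) * N * ((N : ℝ) ^ (ε / 4)) ^ 2
        * (4 * N * ((N : ℝ) ^ (-δ) + κ) + (d : ℝ) ^ 2 / κ) / κ
      ≤ 600 * (B.card : ℝ) * N * ((N : ℝ) ^ (ε / 4)) ^ 2
        * (4 * N * ((N : ℝ) ^ (-δ) + (N : ℝ) ^ (-δ)) + N * (N : ℝ) ^ (-δ)) / κ := by gcongr
    _ = 5400 * (B.card : ℝ) * (N * N * ((N : ℝ) ^ (ε / 4)) ^ 2 * (N : ℝ) ^ (-δ)) * (1 / κ) := by
        ring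
    _ = 10800 * (B.card : ℝ) * (N * N * ((N : ℝ) ^ (ε / 4) * (N : ℝ) ^ (ε / 4)) * (N : ℝ) ^ (-δ)
          * (N : ℝ) ^ (δ + ε)) := by
        rw [hκinv]
        ring
    _ = 10800 * (B.card : ℝ) * ((N : ℝ) ^ (1 + 3 * ε / 4)) ^ 2 := by
        congr 1
        nth_rewrite 1 [← Real.rpow_one (N : ℝ)]
        nth_rewrite 2 [← Real.rpow_one (N : ℝ)]
        rw [sq]
        simp_rw [← Real.rpow_add hN0]
        ring_nf
    _ ≤ _ := by
        gcongr
        norm_num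

lemma remTerm_bound_of_le {η β δ ε c₁ c₂ : ℝ} (hη : η ≤ 1) (hβ : β ≤ 1) (hβη : β ≤ η)
    (hδ0 : 0 < δ) (hδ : δ < 1 / 2) (hε0 : 0 < ε) (hε : ε ≤ 1)
    (hηβ : 4 * (1 + δ) / 3 + ε ≤ η + β) (hc₁ : 0 < c₁) :
    ∃ C : ℝ, 0 < C ∧ ∃ N₀ : ℕ, ∀ N : ℕ, N₀ ≤ N →
      ∀ A B : Finset ℕ, A ⊆ Finset.Icc (N + 1) (2 * N) → B ⊆ Finset.Icc (N + 1) (2 * N) →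
        c₁ * (N : ℝ) ^ η ≤ A.card → (A.card : ℝ) ≤ c₂ * (N : ℝ) ^ η →
        c₁ * (N : ℝ) ^ β ≤ B.card → (B.card : ℝ) ≤ c₂ * (N : ℝ) ^ β →
          ∀ d : ℕ, 1 ≤ d →
            (d : ℝ) ≤ (2 * (N : ℝ) ^ (-δ) * A.card * B.card) ^
                (((η + β) / 2 - 2 / 3 - 2 * δ / 3) / (η + β - δ) - ε) →
            |remTerm A B ((N : ℝ) ^ (-δ)) d| ≤
              C * (2 * (N : ℝ) ^ (-δ) * A.card * B.card) * (N : ℝ) ^ (-ε) / d := by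
  set s := η + β - δ with hs
  set α := ((η + β) / 2 - 2 / 3 - 2 * δ / 3) / s - ε with hα
  have hs43 : 4 / 3 ≤ s := by linarith
  have hs0 : 0 < s := by linarith
  have hεs : 4 / 3 * ε ≤ ε * s := by nlinarith
  have hsα : s * α = (η + β) / 2 - 2 / 3 - 2 * δ / 3 - ε * s := by
    rw [hα]
    field_simp
  set τ := s * α with hτ
  set C₀ := (2 * c₂ ^ 2) ^ α with hC₀
  have hC₀0 : 0 ≤ C₀ := by positivity
  have hc1s : 0 < √c₁ := Real.sqrt_pos.mpr hc₁
  refine ⟨5 / 4 + 52 * C₀ / (c₁ * √c₁), by positivity, ?_⟩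
  obtain ⟨N₀, hN₀⟩ := Filter.eventually_atTop.mp
    ((Filter.eventually_ge_atTop 5).and <|
      (eventually_one_add_log_le_natCast_rpow 8 (by linarith : 0 < ε / 4)).and <|
      (eventually_le_natCast_rpow C₀ (by linarith : 0 < 1 - τ - ε / 4)).and <|
      (eventually_le_natCast_rpow (2 * C₀ ^ 2) (by linarith : 0 < 1 - 2 * δ - ε - 2 * τ)).and <|
      eventually_le_natCast_rpow (1 / c₁ ^ 2) hs0)
  refine ⟨N₀, fun N hN A B hA hB hA1 hA2 hB1 hB2 d hd hdX => ?_⟩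
  obtain ⟨hN5, hlog, hCτ, hCτ', hXN⟩ := hN₀ N hN
  have hNR : (5 : ℝ) ≤ N := by exact_mod_cast hN5
  have hN0 : (0 : ℝ) < N := by linarith
  have hN1 : (1 : ℝ) ≤ N := by linarith
  have hd0 : (0 : ℝ) < d := by exact_mod_cast hd
  have hd1 : (1 : ℝ) ≤ d := by exact_mod_cast hd
  have hNs : (N : ℝ) ^ s = (N : ℝ) ^ (-δ) * (N : ℝ) ^ η * (N : ℝ) ^ β := by
    rw [← Real.rpow_add hN0, ← Real.rpow_add hN0]
    congr 1
    rw [hs]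
    ring
  set X := 2 * (N : ℝ) ^ (-δ) * A.card * B.card with hX
  have hXge : 2 ≤ X := by
    rw [div_le_iff₀ (by positivity)] at hXN
    calc (2 : ℝ) ≤ 2 * ((N : ℝ) ^ s * c₁ ^ 2) := by linarith
      _ = 2 * (N : ℝ) ^ (-δ) * (c₁ * (N : ℝ) ^ η) * (c₁ * (N : ℝ) ^ β) := by rw [hNs]; ring
      _ ≤ X := by
          rw [hX]
          gcongr
  have hXle : X ≤ 2 * c₂ ^ 2 * (N : ℝ) ^ s := by
    calc X ≤ 2 * (N : ℝ) ^ (-δ) * (c₂ * (N : ℝ) ^ η) * (c₂ * (N : ℝ) ^ β) := by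
          have : 0 ≤ c₂ * (N : ℝ) ^ η := (Nat.cast_nonneg _).trans hA2
          rw [hX]
          gcongr
      _ = _ := by rw [hNs]; ring
  have hα0 : 0 ≤ α := by
    by_contra! hneg
    have := Real.rpow_lt_one_of_one_lt_of_neg (by linarith : 1 < X) hneg
    linarith
  have hτ0 : 0 ≤ τ := mul_nonneg hs0.le hα0
  have hdτ : (d : ℝ) ≤ C₀ * (N : ℝ) ^ τ := by
    calc (d : ℝ) ≤ X ^ α := hdX
      _ ≤ (2 * c₂ ^ 2 * (N : ℝ) ^ s) ^ α := Real.rpow_le_rpow (by linarith) hXle hα0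
      _ = _ := by rw [Real.mul_rpow (by positivity) (by positivity), ← Real.rpow_mul hN0.le]
  have hmain := abs_remTerm_rpow_le hN5 hd hδ0 hδ hε0 hε hlog hdτ hCτ hCτ' hA hB
  have hsecond : 104 * √(B.card : ℝ) * (N : ℝ) ^ (1 + 3 * ε / 4)
      ≤ 104 * C₀ / (c₁ * √c₁) * (N : ℝ) ^ (-δ - ε) * A.card * B.card / d := by
    have hsqB : √c₁ * (N : ℝ) ^ (β / 2) ≤ √(B.card : ℝ) := by
      have h1 := Real.sqrt_le_sqrt hB1
      rwa [Real.sqrt_mul hc₁.le, Real.sqrt_eq_rpow ((N : ℝ) ^ β), ← Real.rpow_mul hN0.le,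
        mul_one_div] at h1
    rw [le_div_iff₀ hd0]
    calc 104 * √(B.card : ℝ) * (N : ℝ) ^ (1 + 3 * ε / 4) * d
        ≤ 104 * √(B.card : ℝ) * (N : ℝ) ^ (1 + 3 * ε / 4) * (C₀ * (N : ℝ) ^ τ) := by gcongr
      _ = 104 * C₀ * √(B.card : ℝ) * (N : ℝ) ^ (1 + 3 * ε / 4 + τ) := by
          rw [Real.rpow_add hN0 (1 + 3 * ε / 4)]
          ring
      _ ≤ 104 * C₀ * √(B.card : ℝ) * (N : ℝ) ^ (-δ - ε + η + β / 2) := by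
          refine mul_le_mul_of_nonneg_left
            (Real.rpow_le_rpow_of_exponent_le hN1 ?_) (by positivity)
          linarith
      _ = 104 * C₀ / (c₁ * √c₁) * (N : ℝ) ^ (-δ - ε) * (c₁ * (N : ℝ) ^ η)
            * (√(B.card : ℝ) * (√c₁ * (N : ℝ) ^ (β / 2))) := by
          rw [Real.rpow_add hN0 (-δ - ε + η), Real.rpow_add hN0 (-δ - ε)]
          field_simp
      _ ≤ 104 * C₀ / (c₁ * √c₁) * (N : ℝ) ^ (-δ - ε) * A.card
            * (√(B.card : ℝ) * √(B.card : ℝ)) := by gcongr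
      _ = _ := by rw [Real.mul_self_sqrt (Nat.cast_nonneg _)]
  refine (hmain.trans (add_le_add_right hsecond _)).trans (le_of_eq ?_)
  rw [hX, sub_eq_add_neg (-δ) ε, Real.rpow_add hN0]
  ring

end

/-- **Lemma 3.1.** For `1 ≤ d ≤ X^α` one has `r(𝒜,d) ≪ X N^{−ε} / d`. -/
theorem remainder_term_bound :
    ∀ η β δ : ℝ, 0 < η → η ≤ 1 → 0 < β → β ≤ 1 → 0 < δ → δ < 1 / 2 →
      ∃ ε₀ : ℝ, 0 < ε₀ ∧ ∀ ε : ℝ, 0 < ε → ε ≤ ε₀ →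
        4 * (1 + δ) / 3 + ε ≤ η + β →
        ∀ c₁ c₂ : ℝ, 0 < c₁ → c₁ ≤ c₂ →
          ∃ C : ℝ, 0 < C ∧ ∃ N₀ : ℕ, ∀ N : ℕ, N₀ ≤ N →
            ∀ A B : Finset ℕ, A ⊆ Finset.Icc (N + 1) (2 * N) → B ⊆ Finset.Icc (N + 1) (2 * N) →
              c₁ * (N : ℝ) ^ η ≤ A.card → (A.card : ℝ) ≤ c₂ * (N : ℝ) ^ η →
              c₁ * (N : ℝ) ^ β ≤ B.card → (B.card : ℝ) ≤ c₂ * (N : ℝ) ^ β →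
                ∀ d : ℕ, 1 ≤ d →
                  (d : ℝ) ≤ (2 * (N : ℝ) ^ (-δ) * A.card * B.card) ^
                      (((η + β) / 2 - 2 / 3 - 2 * δ / 3) / (η + β - δ) - ε) →
                  |remTerm A B ((N : ℝ) ^ (-δ)) d| ≤
                    C * (2 * (N : ℝ) ^ (-δ) * A.card * B.card) * (N : ℝ) ^ (-ε) / d := by
  intro η β δ _ hη1 _ hβ1 hδ0 hδ
  refine ⟨1, one_pos, fun ε hε0 hε hηβ c₁ c₂ hc₁ _ => ?_⟩
  rcases le_total β η with hle | hle
  · exact remTerm_bound_of_le hη1 hβ1 hle hδ0 hδ hε0 hε hηβ hc₁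
  · obtain ⟨C, hC, N₀, hN₀⟩ := remTerm_bound_of_le (c₂ := c₂) hβ1 hη1 hle hδ0 hδ hε0 hε
      (add_comm η β ▸ hηβ) hc₁
    refine ⟨C, hC, N₀, fun N hN A B hA hB hA1 hA2 hB1 hB2 d hd hdX => ?_⟩
    rw [mul_right_comm, add_comm η β] at hdX
    rw [remTerm_comm, mul_right_comm (2 * (N : ℝ) ^ (-δ))]
    exact hN₀ N hN B A hB hA hB1 hB2 hA1 hA2 d hd hdX
end

section
/- There exists a constant C > 0 such that for all natural numbers N ≥ 2, all 𝔄, 𝔅 ⊆ {N+1, …, 2N}, all reals 1 ≤ H₀ ≤ N², and all complex numbers g(h) with |g(h)| ≤ 1 for H₀ < h ≤ 2H₀, one has |Σ_{H₀ < h ≤ 2H₀} g(h) Σ_{a∈𝔄} Σ_{b∈𝔅} e(h√(ab))| ≤ C · H₀ · N · (|𝔄||𝔅|)^{1/4} · (log N)^{1/2}. -/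
/-- `e(t) = e^{2πit}`. -/
noncomputable def eTwoPi (t : ℝ) : ℂ := Complex.exp (2 * Real.pi * Complex.I * t)

/-- The natural numbers `m` with `M < m ≤ 2M`. -/
noncomputable def dyadic (M : ℝ) : Finset ℕ := Finset.Ioc ⌊M⌋₊ ⌊2 * M⌋₊

theorem mem_dyadic {M : ℝ} (hM : 0 ≤ M) {m : ℕ} :
    m ∈ dyadic M ↔ M < m ∧ (m : ℝ) ≤ 2 * M := by
  rw [dyadic, Finset.mem_Ioc, Nat.floor_lt hM, Nat.le_floor_iff (by positivity)]

theorem Finset.card_le_of_spaced {ι : Type*} (S : Finset ι) (f : ι → ℝ) {c r s : ℝ}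
    (hr : 0 ≤ r) (hs : 0 < s) (hf : ∀ x ∈ S, |f x - c| ≤ r)
    (hsp : ∀ x ∈ S, ∀ y ∈ S, x ≠ y → s ≤ |f x - f y|) :
    (S.card : ℝ) ≤ 1 + 2 * r / s := by
  have hnn : ∀ x ∈ S, 0 ≤ (f x - (c - r)) / s := fun x hx =>
    div_nonneg (by linarith [(abs_le.1 (hf x hx)).1]) hs.le
  have hcard : S.card ≤ (Finset.range (⌊2 * r / s⌋₊ + 1)).card := by
    refine Finset.card_le_card_of_injOn (fun x => ⌊(f x - (c - r)) / s⌋₊) ?_ ?_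
    · intro x hx
      have hle : (f x - (c - r)) / s ≤ 2 * r / s := by
        gcongr
        linarith [(abs_le.1 (hf x hx)).2]
      simpa [Nat.lt_succ_iff] using Nat.floor_le_floor hle
    · intro x hx y hy hxy
      by_contra hne
      have h1 := hsp x hx y hy hne
      have h2 : |(f x - (c - r)) / s - (f y - (c - r)) / s| < 1 := by
        have hx1 := Nat.floor_le (hnn x hx)
        have hx2 := Nat.lt_floor_add_one ((f x - (c - r)) / s)
        have hy1 := Nat.floor_le (hnn y hy)
        have hy2 := Nat.lt_floor_add_one ((f y - (c - r)) / s)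
        simp only at hxy
        rw [hxy] at hx1 hx2
        rw [abs_lt]
        constructor <;> linarith
      have h3 : (f x - (c - r)) / s - (f y - (c - r)) / s = (f x - f y) / s := by ring
      rw [h3, abs_div, abs_of_pos hs, div_lt_one hs] at h2
      linarith
  rw [Finset.card_range] at hcard
  calc (S.card : ℝ) ≤ ((⌊2 * r / s⌋₊ + 1 : ℕ) : ℝ) := by exact_mod_cast hcard
    _ = 1 + (⌊2 * r / s⌋₊ : ℝ) := by push_cast; ring
    _ ≤ 1 + 2 * r / s := by gcongr; exact Nat.floor_le (by positivity)

/-- The pairs in `(M, 2M]²` with greatest common divisor `d`. -/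
noncomputable def gcdPairs (M : ℝ) (d : ℕ) : Finset (ℕ × ℕ) :=
  (dyadic M ×ˢ dyadic M).filter fun p => p.1.gcd p.2 = d

theorem card_gcdPairs_le {M : ℝ} (hM : 0 ≤ M) {d : ℕ} :
    ((gcdPairs M d).card : ℝ) ≤ 4 * M ^ 2 / d ^ 2 := by
  set T := (Finset.Ioc 0 ⌊2 * M⌋₊).filter (d ∣ ·) with hT
  have hsub : gcdPairs M d ⊆ T ×ˢ T := by
    intro p hp
    simp only [gcdPairs, dyadic, Finset.mem_filter, Finset.mem_product, Finset.mem_Ioc] at hp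
    simp only [hT, Finset.mem_filter, Finset.mem_product, Finset.mem_Ioc]
    obtain ⟨⟨h1, h2⟩, rfl⟩ := hp
    exact ⟨⟨⟨by omega, h1.2⟩, Nat.gcd_dvd_left _ _⟩, ⟨by omega, h2.2⟩, Nat.gcd_dvd_right _ _⟩
  have hTc : (T.card : ℝ) ≤ 2 * M / d := by
    rw [hT, Nat.Ioc_filter_dvd_card_eq_div]
    refine Nat.cast_div_le.trans ?_
    gcongr
    exact Nat.floor_le (by positivity)
  calc ((gcdPairs M d).card : ℝ) ≤ (T.card * T.card : ℝ) := by
        exact_mod_cast (Finset.card_le_card hsub).trans_eq (Finset.card_product _ _)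
    _ ≤ (2 * M / d) * (2 * M / d) := by gcongr
    _ = 4 * M ^ 2 / d ^ 2 := by ring

theorem eq_of_mul_eq_mul_of_gcd_eq {p q : ℕ × ℕ} (hg : p.1.gcd p.2 = q.1.gcd q.2)
    (h0 : p.1.gcd p.2 ≠ 0) (h : p.1 * q.2 = q.1 * p.2) : p = q := by
  have h1 : p.1 * q.1.gcd q.2 = q.1 * p.1.gcd p.2 := by
    rw [← Nat.gcd_mul_left, ← Nat.gcd_mul_left, h, mul_comm p.1 q.1]
  have h2 : p.2 * q.1.gcd q.2 = q.2 * p.1.gcd p.2 := by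
    rw [← Nat.gcd_mul_left, ← Nat.gcd_mul_left, mul_comm p.2 q.1, ← h, mul_comm p.2 q.2,
      mul_comm p.1 q.2]
  rw [← hg] at h1 h2
  have hpos := Nat.pos_of_ne_zero h0
  exact Prod.ext (Nat.eq_of_mul_eq_mul_right hpos h1) (Nat.eq_of_mul_eq_mul_right hpos h2)

theorem gcdPairs_spaced {M : ℝ} (hM : 0 < M) {d : ℕ} (hd : 0 < d) {p q : ℕ × ℕ}
    (hp : p ∈ gcdPairs M d) (hq : q ∈ gcdPairs M d) (hpq : p ≠ q) :
    (d : ℝ) ^ 2 / (4 * M ^ 2) ≤ |(p.1 : ℝ) / p.2 - (q.1 : ℝ) / q.2| := by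
  simp only [gcdPairs, Finset.mem_filter, Finset.mem_product, mem_dyadic hM.le] at hp hq
  obtain ⟨⟨hp1, hp2⟩, hpd⟩ := hp
  obtain ⟨⟨hq1, hq2⟩, hqd⟩ := hq
  have hp0 : (0 : ℝ) < p.2 := hM.trans hp2.1
  have hq0 : (0 : ℝ) < q.2 := hM.trans hq2.1
  have hne : (p.1 : ℤ) * q.2 - q.1 * p.2 ≠ 0 := by
    intro h
    refine hpq (eq_of_mul_eq_mul_of_gcd_eq (hpd.trans hqd.symm) (by omega) ?_)
    exact_mod_cast sub_eq_zero.1 h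
  have hdvd : ((d : ℤ) ^ 2) ∣ (p.1 : ℤ) * q.2 - q.1 * p.2 := by
    have e1 : (d : ℤ) ∣ p.1 := by exact_mod_cast hpd ▸ Nat.gcd_dvd_left _ _
    have e2 : (d : ℤ) ∣ p.2 := by exact_mod_cast hpd ▸ Nat.gcd_dvd_right _ _
    have e3 : (d : ℤ) ∣ q.1 := by exact_mod_cast hqd ▸ Nat.gcd_dvd_left _ _
    have e4 : (d : ℤ) ∣ q.2 := by exact_mod_cast hqd ▸ Nat.gcd_dvd_right _ _
    rw [sq]
    exact dvd_sub (mul_dvd_mul e1 e4) (mul_dvd_mul e3 e2)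
  have hle : (d : ℤ) ^ 2 ≤ |(p.1 : ℤ) * q.2 - q.1 * p.2| :=
    Int.le_of_dvd (abs_pos.2 hne) ((dvd_abs _ _).2 hdvd)
  have hle' : (d : ℝ) ^ 2 ≤ |(p.1 : ℝ) * q.2 - q.1 * p.2| := by exact_mod_cast hle
  rw [div_sub_div _ _ hp0.ne' hq0.ne', abs_div, abs_of_pos (mul_pos hp0 hq0),
    mul_comm (p.2 : ℝ) (q.1 : ℝ)]
  refine div_le_div₀ (abs_nonneg _) hle' (mul_pos hp0 hq0) ?_
  calc (p.2 : ℝ) * q.2 ≤ (2 * M) * (2 * M) := by gcongr; exacts [hp2.2, hq2.2]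
    _ = 4 * M ^ 2 := by ring

theorem card_gcdPairs_close_le {M : ℝ} (hM : 0 < M) {d : ℕ} (hd : 0 < d) (c : ℝ) {r : ℝ}
    (hr : 0 ≤ r) :
    (((gcdPairs M d).filter fun p => |(p.1 : ℝ) / p.2 - c| ≤ r).card : ℝ) ≤
      1 + 8 * r * M ^ 2 / d ^ 2 := by
  have hd' : (0 : ℝ) < d := by exact_mod_cast hd
  have h := Finset.card_le_of_spaced ((gcdPairs M d).filter fun p => |(p.1 : ℝ) / p.2 - c| ≤ r)
    (fun p => (p.1 : ℝ) / p.2) (c := c) (r := r) (s := (d : ℝ) ^ 2 / (4 * M ^ 2)) hr (by positivity)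
    (fun x hx => (Finset.mem_filter.1 hx).2)
    (fun x hx y hy hxy => gcdPairs_spaced hM hd (Finset.mem_filter.1 hx).1
      (Finset.mem_filter.1 hy).1 hxy)
  refine h.trans_eq ?_
  field_simp
  ring

/-- Pairs of fractions `m/m'`, `n/n'` with prescribed gcds such that `m/m'` is close to
`√(n/n')`. -/
theorem card_close_gcdPairs_le {H N : ℝ} (hH : 0 < H) (hN : 0 < N) {d e : ℕ} (hd : 0 < d)
    (he : 0 < e) {r : ℝ} (hr : 0 ≤ r) :
    ((((gcdPairs H d) ×ˢ (gcdPairs N e)).filter fun x =>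
      |(x.1.1 : ℝ) / x.1.2 - √((x.2.1 : ℝ) / x.2.2)| ≤ r).card : ℝ) ≤
      min (4 * H ^ 2 / d ^ 2) (4 * N ^ 2 / e ^ 2) + 128 * r * (H ^ 2 * N ^ 2 / (d ^ 2 * e ^ 2)) := by
  have hd' : (0 : ℝ) < d := by exact_mod_cast hd
  have he' : (0 : ℝ) < e := by exact_mod_cast he
  have hP := card_gcdPairs_le hH.le (d := d)
  have hQ := card_gcdPairs_le hN.le (d := e)
  rw [← min_add_add_right]
  refine le_min ?_ ?_
  · rw [Finset.card_filter, Finset.sum_product, Nat.cast_sum]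
    have : ∀ p ∈ gcdPairs H d, ((∑ q ∈ gcdPairs N e,
        if |(p.1 : ℝ) / p.2 - √((q.1 : ℝ) / q.2)| ≤ r then 1 else 0 : ℕ) : ℝ) ≤
        1 + 8 * (4 * r) * N ^ 2 / e ^ 2 := by
      intro p hp
      rw [← Finset.card_filter]
      refine le_trans ?_ (card_gcdPairs_close_le hN he (((p.1 : ℝ) / p.2) ^ 2)
        (r := 4 * r) (by positivity))
      norm_cast
      refine Finset.card_le_card fun q hq => ?_
      rw [Finset.mem_filter] at hq ⊢
      refine ⟨hq.1, ?_⟩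
      have hq1 := hq.1
      simp only [gcdPairs, Finset.mem_filter, Finset.mem_product, mem_dyadic hN.le] at hq1
      simp only [gcdPairs, Finset.mem_filter, Finset.mem_product, mem_dyadic hH.le] at hp
      have hp0 : (0 : ℝ) < p.2 := hH.trans hp.1.2.1
      have hq0 : (0 : ℝ) < q.2 := hN.trans hq1.1.2.1
      have b1 : (p.1 : ℝ) / p.2 ≤ 2 := by
        rw [div_le_iff₀ hp0]; linarith [hp.1.1.2, hp.1.2.1]
      have b2 : (q.1 : ℝ) / q.2 ≤ 2 := by
        rw [div_le_iff₀ hq0]; linarith [hq1.1.1.2, hq1.1.2.1]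
      have b3 : √((q.1 : ℝ) / q.2) ≤ 2 := by
        rw [Real.sqrt_le_left (by norm_num)]; linarith
      have hsq : (q.1 : ℝ) / q.2 = √((q.1 : ℝ) / q.2) ^ 2 := (Real.sq_sqrt (by positivity)).symm
      have b4 := Real.sqrt_nonneg ((q.1 : ℝ) / q.2)
      have b5 : 0 ≤ (p.1 : ℝ) / p.2 := by positivity
      rw [hsq, abs_sub_comm, sq_sub_sq, abs_mul, abs_of_nonneg (by positivity)]
      exact mul_le_mul (by linarith) hq.2 (abs_nonneg _) (by norm_num)
    refine (Finset.sum_le_sum this).trans ?_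
    rw [Finset.sum_const, nsmul_eq_mul]
    calc _ ≤ 4 * H ^ 2 / d ^ 2 * (1 + 8 * (4 * r) * N ^ 2 / e ^ 2) := by gcongr
      _ = _ := by field_simp; ring
  · rw [Finset.card_filter, Finset.sum_product_right, Nat.cast_sum]
    have : ∀ q ∈ gcdPairs N e, ((∑ p ∈ gcdPairs H d,
        if |(p.1 : ℝ) / p.2 - √((q.1 : ℝ) / q.2)| ≤ r then 1 else 0 : ℕ) : ℝ) ≤
        1 + 8 * r * H ^ 2 / d ^ 2 := by
      intro q hq
      rw [← Finset.card_filter]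
      exact card_gcdPairs_close_le hH hd _ hr
    refine (Finset.sum_le_sum this).trans ?_
    rw [Finset.sum_const, nsmul_eq_mul]
    calc _ ≤ 4 * N ^ 2 / e ^ 2 * (1 + 8 * r * H ^ 2 / d ^ 2) := by gcongr
      _ = 4 * N ^ 2 / e ^ 2 + 32 * r * (H ^ 2 * N ^ 2 / (d ^ 2 * e ^ 2)) := by field_simp; ring
      _ ≤ _ := by gcongr; norm_num

theorem sum_inv_sq_le_two (n : ℕ) : ∑ d ∈ Finset.Ioc 0 n, (1 : ℝ) / (d : ℝ) ^ 2 ≤ 2 := by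
  have h := sum_Ioo_inv_sq_le (α := ℝ) 0 (n + 1)
  simp only [one_div]
  have e : Finset.Ioc 0 n = Finset.Ioo 0 (n + 1) := by ext; simp
  rw [e]
  simpa using h

theorem sum_inv_le_one_add_log (n : ℕ) :
    ∑ d ∈ Finset.Ioc 0 n, (1 : ℝ) / (d : ℝ) ≤ 1 + Real.log n := by
  have h := harmonic_le_one_add_log n
  rw [harmonic_eq_sum_Icc] at h
  push_cast at h
  have e : Finset.Ioc 0 n = Finset.Icc 1 n := by ext; simp; omega
  simpa [one_div, e] using h

theorem sum_min_one_div_sq_le {K : ℝ} (hK : 0 < K) (n : ℕ) :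
    ∑ d ∈ Finset.Ioc 0 n, min 1 (K ^ 2 / (d : ℝ) ^ 2) ≤ 4 * K := by
  have key : ∀ n : ℕ, ∑ d ∈ Finset.Ioc 0 n, min 1 (K ^ 2 / (d : ℝ) ^ 2) ≤
      4 * K - 4 * K ^ 2 / (K + n) := by
    intro n
    induction n with
    | zero => simp; field_simp; simp
    | succ n ih =>
      rw [← Finset.insert_Ioc_right_eq_Ioc_add_one (by omega), Finset.sum_insert (by simp)]
      have hn : (0 : ℝ) ≤ n := by positivity
      have : min 1 (K ^ 2 / ((n + 1 : ℕ) : ℝ) ^ 2) ≤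
          4 * K ^ 2 / (K + n) - 4 * K ^ 2 / (K + (n + 1 : ℕ)) := by
        have e : 4 * K ^ 2 / (K + n) - 4 * K ^ 2 / (K + (n + 1 : ℕ)) =
            4 * K ^ 2 / ((K + n) * (K + n + 1)) := by push_cast; field_simp; ring
        rw [e]
        push_cast
        rcases le_total ((n : ℝ) + 1) K with h | h
        · refine (min_le_left _ _).trans ?_
          rw [le_div_iff₀ (by positivity)]
          nlinarith
        · refine (min_le_right _ _).trans ?_
          rw [div_le_div_iff₀ (by positivity) (by positivity)]
          have : (K + n) * (K + n + 1) ≤ 4 * (n + 1) ^ 2 := by nlinarith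
          nlinarith [mul_le_mul_of_nonneg_left this (sq_nonneg K)]
      linarith
  refine (key n).trans ?_
  have : 0 ≤ 4 * K ^ 2 / (K + n) := by positivity
  linarith

/-- The number of quadruples `(m, m', n, n')` with `m/m'` within `r` of `√(n/n')`. -/
theorem card_close_quadruples_le {H N : ℝ} (hH : 0 < H) (hN : 1 ≤ N) {r : ℝ} (hr : 0 ≤ r) :
    ((((dyadic H ×ˢ dyadic H) ×ˢ (dyadic N ×ˢ dyadic N)).filter fun x =>
      |(x.1.1 : ℝ) / x.1.2 - √((x.2.1 : ℝ) / x.2.2)| ≤ r).card : ℝ) ≤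
      16 * (H * N) * (1 + Real.log (2 * N)) + 512 * r * (H * N) ^ 2 := by
  have hN0 : 0 < N := by linarith
  set D := Finset.Ioc 0 ⌊2 * H⌋₊ with hD
  set E := Finset.Ioc 0 ⌊2 * N⌋₊ with hE
  have hlog : ∑ e ∈ E, (1 : ℝ) / (e : ℝ) ≤ 1 + Real.log (2 * N) := by
    refine (sum_inv_le_one_add_log _).trans ?_
    gcongr
    · have : 0 < ⌊2 * N⌋₊ := Nat.floor_pos.2 (by linarith)
      exact_mod_cast this
    · exact Nat.floor_le (by positivity)
  have hmaps : ∀ {M : ℝ} {p : ℕ × ℕ}, p ∈ dyadic M ×ˢ dyadic M →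
      p.1.gcd p.2 ∈ Finset.Ioc 0 ⌊2 * M⌋₊ := by
    intro M p hp
    simp only [dyadic, Finset.mem_product, Finset.mem_Ioc] at hp ⊢
    have h0 : 0 < p.1 := by omega
    exact ⟨Nat.gcd_pos_of_pos_left _ h0, (Nat.gcd_le_left _ h0).trans hp.1.2⟩
  rw [Finset.card_eq_sum_card_fiberwise (f := fun x => (x.1.1.gcd x.1.2, x.2.1.gcd x.2.2))
    (t := D ×ˢ E) (by
      intro x hx
      have hx' := (Finset.mem_product.1 (Finset.mem_filter.1 hx).1)
      exact Finset.mem_coe.2 (Finset.mem_product.2 ⟨hmaps hx'.1, hmaps hx'.2⟩)), Nat.cast_sum]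
  have hterm : ∀ de ∈ D ×ˢ E, (((((dyadic H ×ˢ dyadic H) ×ˢ (dyadic N ×ˢ dyadic N)).filter fun x =>
      |(x.1.1 : ℝ) / x.1.2 - √((x.2.1 : ℝ) / x.2.2)| ≤ r).filter fun x =>
        (x.1.1.gcd x.1.2, x.2.1.gcd x.2.2) = de).card : ℝ) ≤
      4 * N ^ 2 / de.2 ^ 2 * min 1 ((H * de.2 / N) ^ 2 / de.1 ^ 2) +
        128 * r * (H * N) ^ 2 * (1 / de.1 ^ 2) * (1 / de.2 ^ 2) := by
    intro de hde
    simp only [hD, hE, Finset.mem_product, Finset.mem_Ioc] at hde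
    have h1 : (0 : ℝ) < de.1 := by exact_mod_cast hde.1.1
    have h2 : (0 : ℝ) < de.2 := by exact_mod_cast hde.2.1
    refine le_trans ?_ ((card_close_gcdPairs_le hH hN0 hde.1.1 hde.2.1 hr).trans_eq ?_)
    · norm_cast
      refine Finset.card_le_card fun x hx => ?_
      simp only [Finset.mem_filter, Finset.mem_product, gcdPairs, Prod.ext_iff] at hx ⊢
      tauto
    · rw [mul_min_of_nonneg _ _ (by positivity), min_comm]
      congr 1
      · congr 1
        · ring
        · field_simp
      · field_simp
  refine (Finset.sum_le_sum hterm).trans ?_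
  rw [Finset.sum_add_distrib, Finset.sum_product_right, Finset.sum_product]
  refine add_le_add ?_ ?_
  · calc _ ≤ ∑ e ∈ E, 16 * (H * N) * (1 / (e : ℝ)) := by
          refine Finset.sum_le_sum fun e he => ?_
          have h2 : (0 : ℝ) < e := by exact_mod_cast (Finset.mem_Ioc.1 he).1
          simp only []
          rw [← Finset.mul_sum]
          calc _ ≤ 4 * N ^ 2 / (e : ℝ) ^ 2 * (4 * (H * e / N)) := by
                gcongr
                exact sum_min_one_div_sq_le (by positivity) _
            _ = _ := by field_simp; ring
      _ ≤ _ := by rw [← Finset.mul_sum]; gcongr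
  · simp_rw [← Finset.mul_sum, ← Finset.sum_mul, ← Finset.mul_sum]
    calc _ ≤ 128 * r * (H * N) ^ 2 * 2 * 2 := by
          gcongr <;> exact sum_inv_sq_le_two _
      _ = _ := by ring

theorem card_close_mul_sqrt_le {H N : ℝ} (hH : 0 < H) (hN : 1 ≤ N) {k : ℝ} (hk : 0 ≤ k) :
    ((((dyadic H ×ˢ dyadic N) ×ˢ (dyadic H ×ˢ dyadic N)).filter fun x =>
      |(x.1.1 : ℝ) * √x.1.2 - x.2.1 * √x.2.2| ≤ k / √N).card : ℝ) ≤
      H * N * (16 * (1 + Real.log (2 * N)) + 512 * k) := by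
  have hN0 : 0 < N := by linarith
  have h := card_close_quadruples_le hH hN (r := k / (H * N)) (by positivity)
  refine le_trans ?_ (h.trans_eq (by field_simp))
  norm_cast
  refine Finset.card_le_card_of_injOn (fun x => ((x.1.1, x.2.1), (x.2.2, x.1.2))) ?_ ?_
  · rintro ⟨⟨h, a⟩, ⟨h', a'⟩⟩ hx
    simp only [Finset.coe_filter, Finset.mem_product, Set.mem_ofPred_eq, mem_dyadic hH.le,
      mem_dyadic hN0.le] at hx ⊢
    obtain ⟨⟨⟨hh, ha⟩, hh', ha'⟩, hx⟩ := hx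
    refine ⟨⟨⟨hh, hh'⟩, ha', ha⟩, ?_⟩
    have p1 : (0 : ℝ) < h' := hH.trans hh'.1
    have p2 : (0 : ℝ) < √a := Real.sqrt_pos.2 (hN0.trans ha.1)
    have p3 : (0 : ℝ) < √N := Real.sqrt_pos.2 hN0
    have e : (h : ℝ) / h' - √a' / √a = (h * √a - h' * √a') / (h' * √a) := by
      field_simp
    rw [Real.sqrt_div (Nat.cast_nonneg _), e, abs_div, abs_of_pos (mul_pos p1 p2)]
    calc _ ≤ (k / √N) / (H * √N) := by
          gcongr
          · exact hh'.1.le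
          · exact ha.1.le
      _ = k / (H * (√N * √N)) := by field_simp
      _ = _ := by rw [Real.mul_self_sqrt hN0.le]
  · rintro ⟨⟨h, a⟩, ⟨h', a'⟩⟩ _ ⟨⟨h2, a2⟩, ⟨h2', a2'⟩⟩ _ hxy
    simp only [Prod.mk.injEq] at hxy ⊢
    tauto

open MeasureTheory in
theorem norm_sq_intervalIntegral_le {a b : ℝ} (hab : a < b) {G : ℝ → ℂ} (hG : Continuous G) :
    ‖∫ t in a..b, G t‖ ^ 2 ≤ (b - a) * ∫ t in a..b, ‖G t‖ ^ 2 := by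
  have hba : 0 < b - a := sub_pos.2 hab
  set I := ∫ t in a..b, ‖G t‖ with hI
  have h1 : ‖∫ t in a..b, G t‖ ≤ I := intervalIntegral.norm_integral_le_integral_norm hab.le
  have h2 : 0 ≤ ∫ t in a..b, (‖G t‖ - I / (b - a)) ^ 2 :=
    intervalIntegral.integral_nonneg hab.le fun t _ => sq_nonneg _
  have h3 : ∫ t in a..b, (‖G t‖ - I / (b - a)) ^ 2 =
      (∫ t in a..b, ‖G t‖ ^ 2) - I ^ 2 / (b - a) := by
    have e : ∀ t, (‖G t‖ - I / (b - a)) ^ 2 =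
        ‖G t‖ ^ 2 - 2 * (I / (b - a)) * ‖G t‖ + (I / (b - a)) ^ 2 := fun t => by ring
    simp_rw [e]
    rw [intervalIntegral.integral_add, intervalIntegral.integral_sub,
      intervalIntegral.integral_const_mul, ← hI, intervalIntegral.integral_const, smul_eq_mul]
    · field_simp
      ring
    all_goals exact Continuous.intervalIntegrable (by fun_prop) _ _
  rw [h3, sub_nonneg, div_le_iff₀ hba] at h2
  calc ‖∫ t in a..b, G t‖ ^ 2 ≤ I ^ 2 := by gcongr
    _ ≤ _ := by linarith

theorem continuous_eTwoPi : Continuous eTwoPi := by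
  unfold eTwoPi
  fun_prop

theorem eTwoPi_eq_average {x ε : ℝ} (hx : 0 < x) (hε : 0 < ε) (hxε : 4 * ε * x ≤ 1) :
    ∃ l : ℂ, ‖l‖ ≤ 2 ∧ ∀ y : ℝ, eTwoPi (x * y) =
      1 / (2 * ε) * ∫ t in (y - ε)..(y + ε), l * eTwoPi (x * t) := by
  have hpi := Real.pi_pos
  set θ := 2 * Real.pi * ε * x with hθ
  have hθ0 : 0 < θ := by positivity
  have hθ1 : θ ≤ Real.pi / 2 := by rw [hθ]; nlinarith
  have hsin := Real.mul_le_sin hθ0.le hθ1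
  have hsin0 : 0 < Real.sin θ := lt_of_lt_of_le (by positivity) hsin
  refine ⟨((θ / Real.sin θ : ℝ) : ℂ), ?_, fun y => ?_⟩
  · rw [Complex.norm_real, Real.norm_of_nonneg (by positivity), div_le_iff₀ hsin0]
    have : θ = Real.pi / 2 * (2 / Real.pi * θ) := by field_simp
    nlinarith [Real.pi_le_four]
  · have hc : (2 * Real.pi * Complex.I * x : ℂ) ≠ 0 := by
      simp [hpi.ne', hx.ne']
    have hint : ∫ t in (y - ε)..(y + ε), eTwoPi (x * t) =
        eTwoPi (x * y) * (Real.sin θ / (Real.pi * x) : ℝ) := by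
      have e : ∀ t : ℝ, eTwoPi (x * t) = Complex.exp ((2 * Real.pi * Complex.I * x) * t) := by
        intro t
        rw [eTwoPi]
        push_cast
        ring_nf
      simp_rw [e]
      rw [integral_exp_mul_complex hc]
      have e1 : Complex.exp (2 * Real.pi * Complex.I * x * ((y + ε : ℝ) : ℂ)) =
          Complex.exp (2 * Real.pi * Complex.I * x * y) * Complex.exp (θ * Complex.I) := by
        rw [← Complex.exp_add, hθ]; push_cast; ring_nf
      have e2 : Complex.exp (2 * Real.pi * Complex.I * x * ((y - ε : ℝ) : ℂ)) =
          Complex.exp (2 * Real.pi * Complex.I * x * y) * Complex.exp (-θ * Complex.I) := by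
        rw [← Complex.exp_add, hθ]; push_cast; ring_nf
      rw [e1, e2]
      push_cast
      rw [Complex.sin]
      have hI := Complex.I_sq
      have hpi' : (Real.pi : ℂ) ≠ 0 := by exact_mod_cast hpi.ne'
      have hx' : (x : ℂ) ≠ 0 := by exact_mod_cast hx.ne'
      generalize Complex.exp (-θ * Complex.I) = E₁
      generalize Complex.exp (θ * Complex.I) = E₂
      field_simp
      linear_combination (E₂ - E₁) * hI
    have hs : (Real.sin θ : ℂ) ≠ 0 := by exact_mod_cast hsin0.ne'
    have hpi' : (Real.pi : ℂ) ≠ 0 := by exact_mod_cast hpi.ne'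
    have hx' : (x : ℂ) ≠ 0 := by exact_mod_cast hx.ne'
    have hε' : (ε : ℂ) ≠ 0 := by exact_mod_cast hε.ne'
    rw [intervalIntegral.integral_const_mul, hint]
    generalize Real.sin θ = s at hs ⊢
    rw [hθ]
    push_cast
    field_simp

open MeasureTheory in
theorem integral_norm_sq_gaussian_le {ι : Type*} (P : Finset ι) (x : ι → ℝ) (c : ι → ℂ) {K : ℝ}
    (hc : ∀ p ∈ P, ‖c p‖ ≤ K) {T : ℝ} (hT : 0 < T) :
    Integrable (fun t : ℝ => ‖∑ p ∈ P, c p * eTwoPi (x p * t)‖ ^ 2 *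
      Real.exp (-(Real.pi / T ^ 2) * t ^ 2)) ∧
    ∫ t : ℝ, ‖∑ p ∈ P, c p * eTwoPi (x p * t)‖ ^ 2 * Real.exp (-(Real.pi / T ^ 2) * t ^ 2) ≤
      K ^ 2 * T * ∑ z ∈ P ×ˢ P, Real.exp (-Real.pi * T ^ 2 * (x z.1 - x z.2) ^ 2) := by
  have hpi := Real.pi_pos
  set b := Real.pi / T ^ 2 with hb
  have hb0 : 0 < b := by positivity
  have hb' : 0 < (b : ℂ).re := by simpa using hb0
  set φ : ι × ι → ℝ → ℂ := fun z t => c z.1 * (starRingEnd ℂ) (c z.2) *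
    (Complex.exp (Complex.I * ((2 * Real.pi * (x z.1 - x z.2) : ℝ) : ℂ) * t) *
      Complex.exp (-b * t ^ 2)) with hφ
  have hexp : ∀ t : ℝ, ((‖∑ p ∈ P, c p * eTwoPi (x p * t)‖ ^ 2 * Real.exp (-b * t ^ 2) : ℝ) : ℂ) =
      ∑ z ∈ P ×ˢ P, φ z t := by
    intro t
    push_cast
    rw [← Complex.mul_conj', map_sum, Finset.sum_mul_sum, Finset.sum_product, Finset.sum_mul]
    refine Finset.sum_congr rfl fun p _ => ?_
    rw [Finset.sum_mul]
    refine Finset.sum_congr rfl fun q _ => ?_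
    simp only [hφ, map_mul, eTwoPi, ← Complex.exp_conj]
    have : Complex.exp (Complex.I * ((2 * Real.pi * (x p - x q) : ℝ) : ℂ) * t) =
        Complex.exp (2 * Real.pi * Complex.I * ((x p * t : ℝ) : ℂ)) *
        Complex.exp ((starRingEnd ℂ) 2 * (starRingEnd ℂ) Real.pi * (starRingEnd ℂ) Complex.I *
          (starRingEnd ℂ) ((x q * t : ℝ) : ℂ)) := by
      rw [← Complex.exp_add, Complex.conj_ofReal, Complex.conj_ofReal, Complex.conj_I,
        Complex.conj_ofNat]
      push_cast
      ring_nf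
    rw [this]
    ring
  have hφi : ∀ z, Integrable (φ z) := by
    intro z
    refine Integrable.const_mul ?_ _
    have h := integrable_cexp_quadratic (b := b) hb'
      (Complex.I * ((2 * Real.pi * (x z.1 - x z.2) : ℝ) : ℂ)) 0
    refine h.congr (Filter.Eventually.of_forall fun t => ?_)
    simp only
    rw [← Complex.exp_add]
    ring_nf
  have hφv : ∀ z, ‖∫ t, φ z t‖ = ‖c z.1‖ * ‖c z.2‖ *
      (T * Real.exp (-Real.pi * T ^ 2 * (x z.1 - x z.2) ^ 2)) := by
    intro z
    rw [integral_const_mul, fourierIntegral_gaussian hb', norm_mul, norm_mul, norm_mul,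
      RCLike.norm_conj]
    congr 2
    · have : (Real.pi / b : ℂ) = ((T ^ 2 : ℝ) : ℂ) := by
        have : Real.pi / b = T ^ 2 := by rw [hb]; field_simp
        rw [← this]; push_cast; rfl
      rw [this, show (1 / 2 : ℂ) = ((1 / 2 : ℝ) : ℂ) by push_cast; rfl,
        ← Complex.ofReal_cpow (by positivity), ← Real.sqrt_eq_rpow, Real.sqrt_sq hT.le,
        Complex.norm_real, Real.norm_of_nonneg hT.le]
    · rw [Complex.norm_exp]
      congr 1
      have : (-((2 * Real.pi * (x z.1 - x z.2) : ℝ) : ℂ) ^ 2 / (4 * b) : ℂ) =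
          ((-Real.pi * T ^ 2 * (x z.1 - x z.2) ^ 2 : ℝ) : ℂ) := by
        rw [← Complex.ofReal_pow, ← Complex.ofReal_neg, hb]
        norm_cast
        field_simp
        ring
      rw [this, Complex.ofReal_re]
  have hsum : Integrable (fun t => ∑ z ∈ P ×ˢ P, φ z t) :=
    integrable_finsetSum _ fun z _ => hφi z
  simp_rw [← hexp] at hsum
  have hint := hsum.re
  simp only [RCLike.re_to_complex, Complex.ofReal_re] at hint
  refine ⟨hint, ?_⟩
  have hnn : 0 ≤ ∫ t : ℝ, ‖∑ p ∈ P, c p * eTwoPi (x p * t)‖ ^ 2 * Real.exp (-b * t ^ 2) :=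
    integral_nonneg fun t => by positivity
  rw [← Real.norm_of_nonneg hnn, ← Complex.norm_real, ← integral_complex_ofReal]
  simp_rw [hexp]
  rw [integral_finsetSum _ fun z _ => hφi z, Finset.mul_sum]
  refine (norm_sum_le _ _).trans (Finset.sum_le_sum fun z hz => ?_)
  rw [hφv, Finset.mem_product] at *
  have h1 := hc _ hz.1
  have h2 := hc _ hz.2
  calc _ ≤ K * K * (T * Real.exp (-Real.pi * T ^ 2 * (x z.1 - x z.2) ^ 2)) := by
        gcongr
        exact (norm_nonneg _).trans h1
    _ = _ := by ring

open MeasureTheory in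
/-- A large sieve inequality for exponential sums with arbitrary real frequencies. -/
theorem sum_norm_sq_le_of_spaced {ι κ : Type*} (P : Finset ι) (x : ι → ℝ) (c : ι → ℂ)
    (hc : ∀ p ∈ P, ‖c p‖ ≤ 1) {X T : ℝ} (hX : 0 < X) (hT : 0 < T)
    (hx : ∀ p ∈ P, 0 < x p ∧ x p ≤ X) (B : Finset κ) (y : κ → ℝ)
    (hy : ∀ b ∈ B, |y b| + 1 / (4 * X) ≤ T)
    (hsp : ∀ b ∈ B, ∀ b' ∈ B, b ≠ b' → 1 / (2 * X) ≤ |y b - y b'|) :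
    ∑ b ∈ B, ‖∑ p ∈ P, c p * eTwoPi (x p * y b)‖ ^ 2 ≤
      8 * Real.exp Real.pi * X * T *
        ∑ z ∈ P ×ˢ P, Real.exp (-Real.pi * T ^ 2 * (x z.1 - x z.2) ^ 2) := by
  classical
  have hpi := Real.pi_pos
  set ε := 1 / (4 * X) with hε
  have hε0 : 0 < ε := by positivity
  have h4 : 1 / (2 * ε) = 2 * X := by rw [hε]; field_simp; norm_num
  have hex : ∀ p, ∃ l : ℂ, p ∈ P → ‖l‖ ≤ 2 ∧ ∀ y : ℝ, eTwoPi (x p * y) =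
      1 / (2 * ε) * ∫ t in (y - ε)..(y + ε), l * eTwoPi (x p * t) := by
    intro p
    by_cases hp : p ∈ P
    · obtain ⟨l, hl⟩ := eTwoPi_eq_average (hx p hp).1 hε0 (by
        rw [hε]
        have := (hx p hp).2
        field_simp
        linarith)
      exact ⟨l, fun _ => hl⟩
    · exact ⟨0, fun h => absurd h hp⟩
  choose l hl using hex
  set G : ℝ → ℂ := fun t => ∑ p ∈ P, (c p * l p) * eTwoPi (x p * t) with hG
  have hGc : Continuous G := by
    have := continuous_eTwoPi
    rw [hG]
    fun_prop
  have hpoint : ∀ y : ℝ, ‖∑ p ∈ P, c p * eTwoPi (x p * y)‖ ^ 2 ≤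
      2 * X * ∫ t in (y - ε)..(y + ε), ‖G t‖ ^ 2 := by
    intro y
    have e : ∑ p ∈ P, c p * eTwoPi (x p * y) =
        ((1 / (2 * ε) : ℝ) : ℂ) * ∫ t in (y - ε)..(y + ε), G t := by
      rw [hG, intervalIntegral.integral_finsetSum, Finset.mul_sum]
      · refine Finset.sum_congr rfl fun p hp => ?_
        rw [(hl p hp).2 y]
        simp_rw [intervalIntegral.integral_const_mul]
        push_cast
        ring
      · intro p _
        have := continuous_eTwoPi
        exact Continuous.intervalIntegrable (by fun_prop) _ _
    have h := norm_sq_intervalIntegral_le (a := y - ε) (b := y + ε) (by linarith) hGc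
    rw [e, norm_mul, mul_pow, Complex.norm_real, Real.norm_of_nonneg (by positivity)]
    calc _ ≤ (1 / (2 * ε)) ^ 2 * ((y + ε - (y - ε)) * ∫ t in (y - ε)..(y + ε), ‖G t‖ ^ 2) := by
          gcongr
      _ = 1 / (2 * ε) * ∫ t in (y - ε)..(y + ε), ‖G t‖ ^ 2 := by field_simp; ring
      _ = _ := by rw [h4]
  obtain ⟨hi, hle⟩ := integral_norm_sq_gaussian_le P x (fun p => c p * l p) (K := 2) (by
    intro p hp
    rw [norm_mul]
    calc _ ≤ 1 * (2 : ℝ) := by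
          gcongr
          exacts [hc p hp, (hl p hp).1]
      _ = 2 := one_mul _) hT
  set W : ℝ → ℝ := fun t => ‖G t‖ ^ 2 * Real.exp (-(Real.pi / T ^ 2) * t ^ 2) with hW
  have hunion : ∑ b ∈ B, ∫ t in Set.Ioc (y b - ε) (y b + ε), W t ≤ ∫ t, W t := by
    rw [← integral_biUnion_finset B (fun _ _ => measurableSet_Ioc) ?_
      (fun _ _ => hi.integrableOn)]
    · exact setIntegral_le_integral hi (Filter.Eventually.of_forall fun t => by positivity)
    · intro b hb b' hb' hne
      refine Set.disjoint_left.2 fun t ht ht' => ?_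
      have h1 := hsp b hb b' hb' hne
      have h2 : 1 / (2 * X) = 2 * ε := by rw [hε]; field_simp; norm_num
      rw [h2] at h1
      rw [Set.mem_Ioc] at ht ht'
      have h3 : |y b - y b'| < 2 * ε := by rw [abs_lt]; constructor <;> linarith
      linarith
  have hlocal : ∀ b ∈ B, ∫ t in (y b - ε)..(y b + ε), ‖G t‖ ^ 2 ≤
      Real.exp Real.pi * ∫ t in Set.Ioc (y b - ε) (y b + ε), W t := by
    intro b hb
    rw [intervalIntegral.integral_of_le (by linarith), ← integral_const_mul]
    refine setIntegral_mono_on ?_ (hi.integrableOn.const_mul _) measurableSet_Ioc ?_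
    · exact (Continuous.integrableOn_Icc (by fun_prop)).mono_set Set.Ioc_subset_Icc_self
    · intro t ht
      have hyb := hy b hb
      have habs : |t| ≤ T := by
        rw [abs_le]
        have h1 := neg_abs_le (y b)
        have h2 := le_abs_self (y b)
        constructor <;> linarith [ht.1, ht.2]
      have hsq : t ^ 2 ≤ T ^ 2 := sq_le_sq' (abs_le.1 habs).1 (abs_le.1 habs).2
      have h1 : 1 ≤ Real.exp Real.pi * Real.exp (-(Real.pi / T ^ 2) * t ^ 2) := by
        rw [← Real.exp_add, Real.one_le_exp_iff]
        have : Real.pi / T ^ 2 * t ^ 2 ≤ Real.pi / T ^ 2 * T ^ 2 := by gcongr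
        have e : Real.pi / T ^ 2 * T ^ 2 = Real.pi := by field_simp
        linarith
      calc ‖G t‖ ^ 2 ≤ ‖G t‖ ^ 2 * (Real.exp Real.pi * Real.exp (-(Real.pi / T ^ 2) * t ^ 2)) :=
            le_mul_of_one_le_right (by positivity) h1
        _ = _ := by rw [hW]; ring
  calc _ ≤ ∑ b ∈ B, 2 * X * (Real.exp Real.pi * ∫ t in Set.Ioc (y b - ε) (y b + ε), W t) := by
        refine Finset.sum_le_sum fun b hb => (hpoint _).trans ?_
        gcongr
        exact hlocal b hb
    _ = 2 * X * Real.exp Real.pi * ∑ b ∈ B, ∫ t in Set.Ioc (y b - ε) (y b + ε), W t := by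
        rw [Finset.mul_sum]
        exact Finset.sum_congr rfl fun _ _ => by ring
    _ ≤ 2 * X * Real.exp Real.pi * (2 ^ 2 * T *
        ∑ z ∈ P ×ˢ P, Real.exp (-Real.pi * T ^ 2 * (x z.1 - x z.2) ^ 2)) := by
        gcongr
        exact hunion.trans hle
    _ = _ := by ring

theorem sum_half_pow_floor_le {ι : Type*} (S : Finset ι) (f : ι → ℝ)
    {α β : ℝ} (hα : 0 ≤ α) (hβ : 0 ≤ β)
    (hcount : ∀ k : ℕ, ((S.filter fun z => f z ≤ k).card : ℝ) ≤ α + β * k) :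
    ∑ z ∈ S, (1 / 2 : ℝ) ^ ⌊f z⌋₊ ≤ 2 * α + 4 * β := by
  have key : ∀ K : ℕ, ∑ k ∈ Finset.range K, (1 / 2 : ℝ) ^ k * (α + β * (k + 1)) =
      2 * α + 4 * β - (1 / 2 : ℝ) ^ K * (2 * α + β * (2 * K + 4)) := by
    intro K
    induction K with
    | zero => simp; ring
    | succ K ih =>
      rw [Finset.sum_range_succ, ih, pow_succ]
      push_cast
      ring
  set K := (S.sup fun z => ⌊f z⌋₊) + 1 with hK
  rw [← Finset.sum_fiberwise_of_maps_to (t := Finset.range K) (g := fun z => ⌊f z⌋₊)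
    (fun z hz => Finset.mem_range.2 (Nat.lt_succ_of_le (Finset.le_sup (f := fun z => ⌊f z⌋₊) hz)))]
  calc _ ≤ ∑ k ∈ Finset.range K, (1 / 2 : ℝ) ^ k * (α + β * (k + 1)) := by
        refine Finset.sum_le_sum fun k _ => ?_
        calc _ = ∑ z ∈ S with ⌊f z⌋₊ = k, (1 / 2 : ℝ) ^ k :=
              Finset.sum_congr rfl fun z hz => by rw [(Finset.mem_filter.1 hz).2]
          _ = (1 / 2 : ℝ) ^ k * ((S.filter fun z => ⌊f z⌋₊ = k).card : ℝ) := by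
              rw [Finset.sum_const, nsmul_eq_mul, mul_comm]
          _ ≤ _ := by
              gcongr
              have h := hcount (k + 1)
              push_cast at h
              refine le_trans ?_ h
              norm_cast
              refine Finset.card_le_card fun z hz => ?_
              rw [Finset.mem_filter] at hz ⊢
              refine ⟨hz.1, ?_⟩
              have := Nat.lt_floor_add_one (f z)
              rw [hz.2] at this
              exact_mod_cast this.le
    _ ≤ _ := by
        rw [key]
        have : 0 ≤ (1 / 2 : ℝ) ^ K * (2 * α + β * (2 * K + 4)) := by positivity
        linarith

theorem exp_neg_le_half_pow_floor {u : ℝ} (hu : 0 ≤ u) :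
    Real.exp (-(4 * Real.pi) * u ^ 2) ≤ (1 / 2 : ℝ) ^ ⌊u⌋₊ := by
  have hpi := Real.pi_gt_three
  have hfl := Nat.floor_le hu
  have hsq : (⌊u⌋₊ : ℝ) ≤ u ^ 2 := by
    have h1 : (⌊u⌋₊ : ℝ) ≤ (⌊u⌋₊ : ℝ) ^ 2 := by exact_mod_cast Nat.le_self_pow two_ne_zero _
    have h2 : (⌊u⌋₊ : ℝ) ^ 2 ≤ u ^ 2 := by gcongr
    linarith
  have hhalf : Real.exp (-1) ≤ 1 / 2 := by
    rw [Real.exp_neg, ← one_div]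
    exact one_div_le_one_div_of_le two_pos (by linarith [Real.add_one_le_exp (1 : ℝ)])
  calc Real.exp (-(4 * Real.pi) * u ^ 2) ≤ Real.exp (⌊u⌋₊ * (-1)) := by
        rw [Real.exp_le_exp]
        nlinarith [sq_nonneg u]
    _ = Real.exp (-1) ^ ⌊u⌋₊ := Real.exp_nat_mul _ _
    _ ≤ _ := by gcongr

theorem sum_gaussian_mul_sqrt_le {H : ℝ} (hH : 0 < H) {N : ℕ} (hN : 2 ≤ N) :
    ∑ z ∈ (dyadic H ×ˢ dyadic N) ×ˢ (dyadic H ×ˢ dyadic N),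
      Real.exp (-Real.pi * (2 * √N) ^ 2 * ((z.1.1 : ℝ) * √z.1.2 - z.2.1 * √z.2.2) ^ 2) ≤
      4224 * (H * N * Real.log N) := by
  have hN2 : (2 : ℝ) ≤ N := by exact_mod_cast hN
  have hsN : 0 < √(N : ℝ) := Real.sqrt_pos.2 (by linarith)
  have hlog2 : (1 / 2 : ℝ) ≤ Real.log 2 := by linarith [Real.log_two_gt_d9]
  have hlogN : Real.log 2 ≤ Real.log N := Real.log_le_log two_pos hN2
  have hlog : Real.log (2 * N) ≤ 2 * Real.log N := by
    rw [Real.log_mul two_ne_zero (by positivity)]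
    linarith
  have hlog0 : 0 ≤ Real.log (2 * N) := Real.log_nonneg (by linarith)
  have h := sum_half_pow_floor_le ((dyadic H ×ˢ dyadic N) ×ˢ (dyadic H ×ˢ dyadic N))
    (fun z => √N * |(z.1.1 : ℝ) * √z.1.2 - z.2.1 * √z.2.2|)
    (α := H * N * (16 * (1 + Real.log (2 * N)))) (β := H * N * 512) (by positivity) (by positivity)
    (fun k => by
      have := card_close_mul_sqrt_le hH (N := N) (by linarith) (k := k) (by positivity)
      simp_rw [le_div_iff₀' hsN] at this
      refine this.trans_eq ?_
      ring)
  calc _ ≤ ∑ z ∈ (dyadic H ×ˢ dyadic N) ×ˢ (dyadic H ×ˢ dyadic N),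
        (1 / 2 : ℝ) ^ ⌊√N * |(z.1.1 : ℝ) * √z.1.2 - z.2.1 * √z.2.2|⌋₊ := by
        refine Finset.sum_le_sum fun z _ => ?_
        refine le_trans (le_of_eq ?_) (exp_neg_le_half_pow_floor (by positivity))
        rw [mul_pow, mul_pow, sq_abs]
        ring_nf
    _ ≤ _ := h
    _ = H * N * (32 * (1 + Real.log (2 * N)) + 2048) := by ring
    _ ≤ H * N * (4224 * Real.log N) := by
        gcongr
        linarith
    _ = _ := by ring

/-- Mean-square estimate over `b` for the bilinear exponential sum in `h` and `a`. -/
theorem sum_norm_sq_eTwoPi_mul_sqrt_le {H : ℝ} (hH : 1 ≤ H) {N : ℕ} (hN : 2 ≤ N)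
    {A B : Finset ℕ} (hA : A ⊆ Finset.Icc (N + 1) (2 * N))
    (hB : B ⊆ Finset.Icc (N + 1) (2 * N)) (g : ℕ → ℂ) (hg : ∀ h ∈ dyadic H, ‖g h‖ ≤ 1) :
    ∑ b ∈ B, ‖∑ p ∈ dyadic H ×ˢ A, g p.1 * eTwoPi (p.1 * √p.2 * √b)‖ ^ 2 ≤
      202752 * Real.exp Real.pi * (H * N) ^ 2 * Real.log N := by
  have hH0 : 0 < H := by linarith
  have hN2 : (2 : ℝ) ≤ N := by exact_mod_cast hN
  have hN0 : (0 : ℝ) < N := by linarith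
  have hsN : 0 < √(N : ℝ) := Real.sqrt_pos.2 hN0
  have hss : √(N : ℝ) * √N = N := Real.mul_self_sqrt hN0.le
  have hsN1 : 1 ≤ √(N : ℝ) := Real.one_le_sqrt.2 (by linarith)
  have hsub : ∀ {D : Finset ℕ}, D ⊆ Finset.Icc (N + 1) (2 * N) → ∀ a ∈ D,
      (N : ℝ) < a ∧ (a : ℝ) ≤ 2 * N := by
    intro D hD a ha
    have := Finset.mem_Icc.1 (hD ha)
    exact ⟨by exact_mod_cast this.1, by exact_mod_cast this.2⟩
  have hsq : ∀ {a : ℕ}, (a : ℝ) ≤ 2 * N → √a ≤ 3 / 2 * √N := by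
    intro a ha
    rw [Real.sqrt_le_left (by positivity), mul_pow, Real.sq_sqrt hN0.le]
    linarith
  have h := sum_norm_sq_le_of_spaced (dyadic H ×ˢ A) (fun p => (p.1 : ℝ) * √p.2) (fun p => g p.1)
    (fun p hp => hg _ (Finset.mem_product.1 hp).1) (X := 3 * H * √N) (T := 2 * √N)
    (by positivity) (by positivity) (by
      intro p hp
      obtain ⟨h1, h2⟩ := Finset.mem_product.1 hp
      rw [mem_dyadic hH0.le] at h1
      have h2 := hsub hA _ h2
      have h3 := Real.sqrt_pos.2 (hN0.trans h2.1)
      refine ⟨mul_pos (hH0.trans h1.1) h3, ?_⟩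
      calc (p.1 : ℝ) * √p.2 ≤ 2 * H * (3 / 2 * √N) := by
            gcongr
            exacts [h1.2, hsq h2.2]
        _ = _ := by ring) B (fun b => √b) (by
      intro b hb
      rw [abs_of_nonneg (Real.sqrt_nonneg _)]
      have h1 := hsq (hsub hB b hb).2
      have h2 : 1 / (4 * (3 * H * √N)) ≤ 1 / 2 := by
        apply one_div_le_one_div_of_le two_pos
        nlinarith
      linarith) (by
      intro b hb b' hb' hne
      have h1 := hsub hB b hb
      have h2 := hsub hB b' hb'
      have p1 := Real.sqrt_pos.2 (hN0.trans h1.1)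
      have p2 := Real.sqrt_pos.2 (hN0.trans h2.1)
      have h3 : (1 : ℝ) ≤ |√b - √b'| * (√b + √b') := by
        rw [← abs_of_pos (add_pos p1 p2), ← abs_mul, mul_comm, ← sq_sub_sq,
          Real.sq_sqrt (Nat.cast_nonneg _), Real.sq_sqrt (Nat.cast_nonneg _)]
        have : (1 : ℤ) ≤ |(b : ℤ) - b'| := Int.one_le_abs (by omega)
        exact_mod_cast this
      have h4 : √(b : ℝ) + √b' ≤ 3 * √N := by linarith [hsq h1.2, hsq h2.2]
      have h5 : √(b : ℝ) + √b' ≤ 2 * (3 * H * √N) := by nlinarith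
      rw [div_le_iff₀ (by positivity)]
      exact h3.trans (by gcongr))
  refine h.trans ?_
  have hAd : A ⊆ dyadic N := fun a ha => (mem_dyadic hN0.le).2 (hsub hA a ha)
  have hPP := Finset.product_subset_product_right (s := dyadic H) hAd
  have hmono := Finset.sum_le_sum_of_subset_of_nonneg
    (f := fun z : (ℕ × ℕ) × (ℕ × ℕ) =>
      Real.exp (-Real.pi * (2 * √N) ^ 2 * ((z.1.1 : ℝ) * √z.1.2 - z.2.1 * √z.2.2) ^ 2))
    (Finset.product_subset_product hPP hPP) (fun _ _ _ => (Real.exp_pos _).le)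
  calc _ ≤ 8 * Real.exp Real.pi * (3 * H * √N) * (2 * √N) * (4224 * (H * N * Real.log N)) := by
        gcongr
        exact hmono.trans (sum_gaussian_mul_sqrt_le hH0 hN)
    _ = 202752 * Real.exp Real.pi * (H * (√N * √N)) * (H * N) * Real.log N := by ring
    _ = _ := by rw [hss]; ring

theorem norm_sq_bilinear_le {H : ℝ} (hH : 1 ≤ H) {N : ℕ} (hN : 2 ≤ N)
    {A B : Finset ℕ} (hA : A ⊆ Finset.Icc (N + 1) (2 * N))
    (hB : B ⊆ Finset.Icc (N + 1) (2 * N)) (g : ℕ → ℂ) (hg : ∀ h ∈ dyadic H, ‖g h‖ ≤ 1) :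
    ‖∑ h ∈ dyadic H, g h * ∑ a ∈ A, ∑ b ∈ B, eTwoPi (h * √(a * b))‖ ^ 2 ≤
      B.card * (202752 * Real.exp Real.pi * (H * N) ^ 2 * Real.log N) := by
  have e : ∑ h ∈ dyadic H, g h * ∑ a ∈ A, ∑ b ∈ B, eTwoPi (h * √(a * b)) =
      ∑ b ∈ B, ∑ p ∈ dyadic H ×ˢ A, g p.1 * eTwoPi (p.1 * √p.2 * √b) := by
    rw [Finset.sum_comm, Finset.sum_product]
    refine Finset.sum_congr rfl fun h _ => ?_
    rw [Finset.mul_sum]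
    refine Finset.sum_congr rfl fun a _ => ?_
    rw [Finset.mul_sum]
    refine Finset.sum_congr rfl fun b _ => ?_
    rw [Real.sqrt_mul (Nat.cast_nonneg _), mul_assoc]
  rw [e]
  calc _ ≤ (∑ b ∈ B, ‖∑ p ∈ dyadic H ×ˢ A, g p.1 * eTwoPi (p.1 * √p.2 * √b)‖) ^ 2 := by
        gcongr
        exact norm_sum_le _ _
    _ ≤ B.card * ∑ b ∈ B, ‖∑ p ∈ dyadic H ×ˢ A, g p.1 * eTwoPi (p.1 * √p.2 * √b)‖ ^ 2 :=
        sq_sum_le_card_mul_sum_sq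
    _ ≤ _ := by
        gcongr
        exact sum_norm_sq_eTwoPi_mul_sqrt_le hH hN hA hB g hg

/-- **Estimate (3.12).** For `1 ≤ H₀ ≤ N²` and coefficients `g(h)` bounded by `1`,
`|Σ_{h∼H₀} g(h) Σ_{a∈𝔄} Σ_{b∈𝔅} e(h√(ab))| ≪ H₀ N (|𝔄||𝔅|)^{1/4} (log N)^{1/2}`. -/
theorem exponential_sum_bound :
    ∃ C : ℝ, 0 < C ∧ ∀ N : ℕ, 2 ≤ N →
      ∀ A B : Finset ℕ, A ⊆ Finset.Icc (N + 1) (2 * N) → B ⊆ Finset.Icc (N + 1) (2 * N) →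
        ∀ H₀ : ℝ, 1 ≤ H₀ → H₀ ≤ (N : ℝ) ^ 2 →
          ∀ g : ℤ → ℂ, (∀ h ∈ Finset.Ioc ⌊H₀⌋ ⌊2 * H₀⌋, ‖g h‖ ≤ 1) →
            ‖∑ h ∈ Finset.Ioc ⌊H₀⌋ ⌊2 * H₀⌋,
                g h * ∑ a ∈ A, ∑ b ∈ B, eTwoPi (h * Real.sqrt (a * b))‖ ≤
              C * H₀ * N * ((A.card : ℝ) * B.card) ^ ((1 : ℝ) / 4) *
                (Real.log N) ^ ((1 : ℝ) / 2) := by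
  set K := 202752 * Real.exp Real.pi with hK
  have hK0 : 0 < K := by positivity
  refine ⟨√K, Real.sqrt_pos.2 hK0, ?_⟩
  intro N hN A B hA hB H hH _ g hg
  have hH0 : 0 ≤ H := by linarith
  have hlog : 0 ≤ Real.log N := Real.log_natCast_nonneg N
  have himg : Finset.Ioc ⌊H⌋ ⌊2 * H⌋ = (dyadic H).image ((↑) : ℕ → ℤ) := by
    apply Finset.coe_injective
    rw [dyadic, Finset.coe_image, Finset.coe_Ioc, Finset.coe_Ioc, Nat.image_cast_int_Ioc,
      Int.natCast_floor_eq_floor hH0, Int.natCast_floor_eq_floor (by positivity)]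
  rw [himg] at hg ⊢
  rw [Finset.sum_image (fun _ _ _ _ h => by exact_mod_cast h)]
  simp only [Int.cast_natCast]
  have hg' : ∀ h ∈ dyadic H, ‖g h‖ ≤ 1 := fun h hh => hg _ (Finset.mem_image_of_mem _ hh)
  have h1 := norm_sq_bilinear_le hH hN hA hB (fun h => g h) hg'
  have h2 := norm_sq_bilinear_le hH hN hB hA (fun h => g h) hg'
  have hswap : ∀ h : ℕ, ∑ b ∈ B, ∑ a ∈ A, eTwoPi (h * √(b * a)) =
      ∑ a ∈ A, ∑ b ∈ B, eTwoPi (h * √(a * b)) := fun h => by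
    rw [Finset.sum_comm]
    simp_rw [mul_comm]
  simp only [hswap] at h2
  set S := ‖∑ h ∈ dyadic H, g h * ∑ a ∈ A, ∑ b ∈ B, eTwoPi (h * √(a * b))‖ with hS
  set L := K * (H * N) ^ 2 * Real.log N with hL
  have hL0 : 0 ≤ L := by positivity
  set m := (A.card : ℝ) * B.card with hm
  have hm0 : 0 ≤ m := by positivity
  have h3 : S ^ 2 ≤ √m * L := by
    rcases le_total (A.card : ℝ) B.card with h | h
    · refine h2.trans ?_
      gcongr
      exact Real.le_sqrt_of_sq_le (by
        rw [sq, hm]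
        exact mul_le_mul_of_nonneg_left h (by positivity))
    · refine h1.trans ?_
      gcongr
      exact Real.le_sqrt_of_sq_le (by
        rw [sq, hm]
        exact mul_le_mul_of_nonneg_right h (by positivity))
  have h4 : (√K * H * N * m ^ ((1 : ℝ) / 4) * Real.log N ^ ((1 : ℝ) / 2)) ^ 2 = √m * L := by
    have e1 : (m ^ ((1 : ℝ) / 4)) ^ 2 = √m := by
      rw [← Real.rpow_natCast, ← Real.rpow_mul hm0, Real.sqrt_eq_rpow]
      norm_num
    rw [← Real.sqrt_eq_rpow (Real.log N)]
    simp only [mul_pow]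
    rw [e1, Real.sq_sqrt hK0.le, Real.sq_sqrt hlog, hL]
    ring
  rw [← h4] at h3
  exact le_of_sq_le_sq h3 (by positivity)
end
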